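/- The limit as X → ∞ of the ratio #{p ≤ X : p prime, p ≡ −1 (mod 16), (p) = −1} / #{p ≤ X : p prime, p ≡ −1 (mod 16)} equals 1/2, where for a prime p ≡ −1 (mod 8) the symbol (p) denotes the Jacobi symbol (2u/v) for any positive integers u, v with p = u² − 2v². -/

import Mathlib

namespace SpinDensity
open Finset
open scoped Classical

/-- Abstract bilinear (large sieve type) inequality. -/
theorem bilinear {M ι : Type*} [CommMonoid M]
    (Z : Finset ι) (W : Finset M) (χ : ι → M →* ℝ)
    (α : M → ℝ) (hα : ∀ w ∈ W, |α w| ≤ 1) (k : ℕ) (hk : Even k) (hk0 : k ≠ 0)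
    (hχ : ∀ z m, |χ z m| ≤ 1)
    (Box : Finset M)
    (hBox : ∀ f ∈ Fintype.piFinset (fun _ : Fin k => W), ∏ i, f i ∈ Box)
    (R : ℝ) (hR0 : 0 ≤ R)
    (hR : ∀ f₀ ∈ Fintype.piFinset (fun _ : Fin k => W),
      (#{f ∈ Fintype.piFinset (fun _ : Fin k => W) | ∏ i, f i = ∏ i, f₀ i} : ℝ) ≤ R)
    (Dg E : ℝ) (rel : ι → ι → Prop)
    (hD : (#{q ∈ Z ×ˢ Z | rel q.1 q.2} : ℝ) ≤ Dg)
    (hE0 : 0 ≤ E)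
    (hE : ∀ z₁ ∈ Z, ∀ z₂ ∈ Z, ¬ rel z₁ z₂ → |∑ m ∈ Box, χ z₁ m * χ z₂ m| ≤ E) :
    (∑ z ∈ Z, |∑ w ∈ W, α w * χ z w|) ^ (2 * k) ≤
      (#Z : ℝ) ^ (2 * (k - 1)) * (R * (#W : ℝ) ^ k * (Dg * #Box + (#Z : ℝ) ^ 2 * E)) := by
  set P := Fintype.piFinset (fun _ : Fin k => W) with hP
  let c : M → ℝ := fun m => ∑ f ∈ P with ∏ i, f i = m, ∏ i, α (f i)
  let r : M → ℝ := fun m => (#{f ∈ P | ∏ i, f i = m} : ℝ)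
  have hr0 : ∀ m, 0 ≤ r m := fun m => Nat.cast_nonneg _
  have hrR : ∀ m, r m ≤ R := by
    intro m
    by_cases h : ∃ f₀ ∈ P, ∏ i, f₀ i = m
    · obtain ⟨f₀, hf, rfl⟩ := h
      exact hR f₀ hf
    · have : ({f ∈ P | ∏ i, f i = m} : Finset _) = ∅ := by
        apply Finset.filter_eq_empty_iff.2
        intro f hf hm
        exact h ⟨f, hf, hm⟩
      simp only [r, this, Finset.card_empty, Nat.cast_zero]
      exact hR0
  have hcr : ∀ m, |c m| ≤ r m := by
    intro m
    calc |c m| ≤ ∑ f ∈ P with ∏ i, f i = m, |∏ i, α (f i)| := Finset.abs_sum_le_sum_abs _ _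
      _ ≤ ∑ f ∈ P with ∏ i, f i = m, (1 : ℝ) := by
        apply Finset.sum_le_sum
        intro f hf
        rw [Finset.abs_prod]
        apply Finset.prod_le_one
        · intros; positivity
        · intro i _
          exact hα _ (Fintype.mem_piFinset.1 (Finset.mem_filter.1 hf).1 i)
      _ = r m := by simp [r]
  have hrsum : ∑ m ∈ Box, r m = (#W : ℝ) ^ k := by
    have := Finset.card_eq_sum_card_fiberwise (s := P) (t := Box) (f := fun f => ∏ i, f i)
      (fun f hf => hBox f hf)
    have h2 : #P = #W ^ k := by simp [hP]
    rw [h2] at this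
    have h3 := congrArg (fun n : ℕ => (n : ℝ)) this
    push_cast at h3
    rw [h3]
  have hpow : ∀ z, (∑ w ∈ W, α w * χ z w) ^ k = ∑ m ∈ Box, c m * χ z m := by
    intro z
    have h1 : (∑ w ∈ W, α w * χ z w) ^ k = ∏ _i : Fin k, ∑ w ∈ W, α w * χ z w := by simp
    rw [h1, Finset.prod_univ_sum, ← Finset.sum_fiberwise_of_maps_to (t := Box)
      (g := fun f : Fin k → M => ∏ i, f i) (fun f hf => hBox f hf)]
    apply Finset.sum_congr rfl
    intro m _
    rw [Finset.sum_mul]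
    apply Finset.sum_congr rfl
    intro f hf
    rw [Finset.prod_mul_distrib, ← map_prod, (Finset.mem_filter.1 hf).2]
  have hsq : (∑ m ∈ Box, c m * ∑ z ∈ Z, χ z m) ^ 2 ≤
      (R * (#W : ℝ) ^ k) * (Dg * #Box + (#Z : ℝ) ^ 2 * E) := by
    refine (Finset.sum_mul_sq_le_sq_mul_sq _ _ _).trans ?_
    have hA : ∑ m ∈ Box, c m ^ 2 ≤ R * (#W : ℝ) ^ k := by
      rw [← hrsum, Finset.mul_sum]
      apply Finset.sum_le_sum
      intro m _
      have := hcr m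
      calc c m ^ 2 = |c m| * |c m| := by rw [← sq, sq_abs]
        _ ≤ R * r m := mul_le_mul (this.trans (hrR m)) this (abs_nonneg _) hR0
    have hB : ∑ m ∈ Box, (∑ z ∈ Z, χ z m) ^ 2 ≤ Dg * #Box + (#Z : ℝ) ^ 2 * E := by
      have e1 : ∑ m ∈ Box, (∑ z ∈ Z, χ z m) ^ 2 =
          ∑ q ∈ Z ×ˢ Z, ∑ m ∈ Box, χ q.1 m * χ q.2 m := by
        rw [Finset.sum_comm]
        apply Finset.sum_congr rfl
        intro m _
        rw [sq, Finset.sum_mul_sum, Finset.sum_product]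
      rw [e1, ← Finset.sum_filter_add_sum_filter_not (Z ×ˢ Z) (fun q => rel q.1 q.2)]
      apply add_le_add
      · calc ∑ q ∈ Z ×ˢ Z with rel q.1 q.2, ∑ m ∈ Box, χ q.1 m * χ q.2 m
            ≤ ∑ q ∈ Z ×ˢ Z with rel q.1 q.2, (#Box : ℝ) := by
              apply Finset.sum_le_sum
              intro q _
              calc ∑ m ∈ Box, χ q.1 m * χ q.2 m ≤ ∑ m ∈ Box, (1 : ℝ) := by
                    apply Finset.sum_le_sum
                    intro m _
                    refine (le_abs_self _).trans ?_
                    rw [abs_mul]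
                    exact mul_le_one₀ (hχ _ _) (abs_nonneg _) (hχ _ _)
                _ = #Box := by simp
          _ = (#{q ∈ Z ×ˢ Z | rel q.1 q.2} : ℝ) * #Box := by simp
          _ ≤ Dg * #Box := by gcongr
      · calc ∑ q ∈ Z ×ˢ Z with ¬ rel q.1 q.2, ∑ m ∈ Box, χ q.1 m * χ q.2 m
            ≤ ∑ q ∈ Z ×ˢ Z with ¬ rel q.1 q.2, E := by
              apply Finset.sum_le_sum
              intro q hq
              rw [Finset.mem_filter, Finset.mem_product] at hq
              exact (le_abs_self _).trans (hE _ hq.1.1 _ hq.1.2 hq.2)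
          _ = (#{q ∈ Z ×ˢ Z | ¬ rel q.1 q.2} : ℝ) * E := by simp
          _ ≤ (#(Z ×ˢ Z) : ℝ) * E := by
              gcongr
              exact Finset.filter_subset _ _
          _ = (#Z : ℝ) ^ 2 * E := by rw [Finset.card_product]; push_cast; ring
    exact mul_le_mul hA hB (Finset.sum_nonneg fun _ _ => sq_nonneg _) (by positivity)
  have hT : (∑ z ∈ Z, |∑ w ∈ W, α w * χ z w|) ^ k ≤
      (#Z : ℝ) ^ (k - 1) * ∑ m ∈ Box, c m * ∑ z ∈ Z, χ z m := by
    have e2 : ∑ m ∈ Box, c m * ∑ z ∈ Z, χ z m = ∑ z ∈ Z, |∑ w ∈ W, α w * χ z w| ^ k := by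
      simp_rw [hk.pow_abs, hpow, Finset.mul_sum]
      rw [Finset.sum_comm]
    rw [e2]
    obtain ⟨l, rfl⟩ : ∃ l, k = l + 1 := ⟨k - 1, by omega⟩
    rcases Z.eq_empty_or_nonempty with rfl | hne
    · simp
    have := pow_sum_div_card_le_sum_pow (s := Z)
      (f := fun z => |∑ w ∈ W, α w * χ z w|) (fun _ _ => abs_nonneg _) l
    rw [div_le_iff₀ (by have := Finset.card_pos.2 hne; positivity)] at this
    rw [Nat.add_sub_cancel, mul_comm]
    exact this
  calc (∑ z ∈ Z, |∑ w ∈ W, α w * χ z w|) ^ (2 * k)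
      = ((∑ z ∈ Z, |∑ w ∈ W, α w * χ z w|) ^ k) ^ 2 := by rw [← pow_mul, mul_comm]
    _ ≤ ((#Z : ℝ) ^ (k - 1) * ∑ m ∈ Box, c m * ∑ z ∈ Z, χ z m) ^ 2 := by
        apply pow_le_pow_left₀ _ hT
        exact pow_nonneg (Finset.sum_nonneg fun _ _ => abs_nonneg _) _
    _ = (#Z : ℝ) ^ (2 * (k - 1)) * (∑ m ∈ Box, c m * ∑ z ∈ Z, χ z m) ^ 2 := by
        rw [mul_pow, ← pow_mul, mul_comm (k - 1)]
    _ ≤ _ := by gcongr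

/-- Removing a coupled threshold condition. -/
theorem decouple {M ι : Type*} (Z : Finset ι) (W : Finset M) (g : ι → M → ℝ)
    (hg : ∀ z ∈ Z, ∀ w ∈ W, |g z w| ≤ 1) (key : M → ℕ) (f : ι → ℕ) (F h : ℕ)
    (hh : 0 < h) (hf : ∀ z ∈ Z, f z ≤ F) (B ω : ℝ)
    (hB : ∀ t : ℕ, ∑ z ∈ Z, |∑ w ∈ W with key w < t, g z w| ≤ B)
    (hω : ∀ t : ℕ, (#{w ∈ W | t ≤ key w ∧ key w < t + h} : ℝ) ≤ ω) :
    ∑ z ∈ Z, |∑ w ∈ W with key w < f z, g z w| ≤ ((F / h : ℕ) + 1) * B + #Z * ω := by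
  have h1 : ∀ z ∈ Z, |∑ w ∈ W with key w < f z, g z w| ≤
      ∑ i ∈ range (F / h + 1), |∑ w ∈ W with key w < h * i, g z w| + ω := by
    intro z hz
    have hdiv : h * (f z / h) ≤ f z := Nat.mul_div_le _ _
    have hlt : f z < h * (f z / h) + h := by
      have := Nat.lt_mul_div_succ (f z) hh
      linarith [this, Nat.mul_succ h (f z / h)]
    have hsplit : ∑ w ∈ W with key w < f z, g z w =
        ∑ w ∈ W with key w < h * (f z / h), g z w +
        ∑ w ∈ W with (h * (f z / h) ≤ key w ∧ key w < f z), g z w := by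
      rw [← Finset.sum_union]
      · apply Finset.sum_congr _ (fun _ _ => rfl)
        ext w
        simp only [Finset.mem_filter, Finset.mem_union]
        constructor
        · rintro ⟨a, b⟩
          rcases lt_or_ge (key w) (h * (f z / h)) with c | c
          · exact Or.inl ⟨a, c⟩
          · exact Or.inr ⟨a, c, b⟩
        · rintro (⟨a, b⟩ | ⟨a, _, c⟩)
          · exact ⟨a, lt_of_lt_of_le b hdiv⟩
          · exact ⟨a, c⟩
      · apply Finset.disjoint_left.2
        intro w h1 h2
        simp only [Finset.mem_filter] at h1 h2
        omega
    rw [hsplit]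
    refine (abs_add_le _ _).trans (add_le_add ?_ ?_)
    · exact Finset.single_le_sum (f := fun i => |∑ w ∈ W with key w < h * i, g z w|)
        (fun _ _ => abs_nonneg _)
        (Finset.mem_range.2 (Nat.lt_succ_of_le (Nat.div_le_div_right (hf z hz))))
    · refine (Finset.abs_sum_le_sum_abs _ _).trans ?_
      calc ∑ w ∈ W with (h * (f z / h) ≤ key w ∧ key w < f z), |g z w|
          ≤ ∑ w ∈ W with (h * (f z / h) ≤ key w ∧ key w < f z), (1 : ℝ) :=
            Finset.sum_le_sum fun w hw => hg z hz w (Finset.mem_filter.1 hw).1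
        _ = (#{w ∈ W | h * (f z / h) ≤ key w ∧ key w < f z} : ℝ) := by simp
        _ ≤ (#{w ∈ W | h * (f z / h) ≤ key w ∧ key w < h * (f z / h) + h} : ℝ) := by
            gcongr with w
        _ ≤ ω := hω _
  calc _ ≤ ∑ z ∈ Z, (∑ i ∈ range (F / h + 1), |∑ w ∈ W with key w < h * i, g z w| + ω) :=
        Finset.sum_le_sum h1
    _ = ∑ i ∈ range (F / h + 1), ∑ z ∈ Z, |∑ w ∈ W with key w < h * i, g z w| + #Z * ω := by
        rw [Finset.sum_add_distrib, Finset.sum_comm]; simp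
    _ ≤ ∑ i ∈ range (F / h + 1), B + #Z * ω := by
        gcongr with i
        exact hB _
    _ = _ := by simp

/-- A periodic function with mean zero has small sums over intervals. -/
theorem periodic_sum (f : ℤ → ℝ) (q : ℕ) (hq : 0 < q) (hper : ∀ x, f (x + q) = f x)
    (h0 : ∑ x ∈ range q, f x = 0) (h1 : ∀ x, |f x| ≤ 1) (a b : ℤ) :
    |∑ x ∈ Icc a b, f x| ≤ q := by
  have hfull : ∀ c : ℤ, ∑ x ∈ range q, f (c + x) = 0 := by
    have step : ∀ c : ℤ, ∑ x ∈ range q, f (c + 1 + x) = ∑ x ∈ range q, f (c + x) := by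
      intro c
      have e1 := Finset.sum_range_succ' (fun x : ℕ => f (c + x)) q
      have e2 := Finset.sum_range_succ (fun x : ℕ => f (c + x)) q
      rw [e1] at e2
      simp only [hper, Nat.cast_zero, add_zero] at e2
      have := add_right_cancel e2
      rw [← this]
      apply Finset.sum_congr rfl
      intro x _
      push_cast
      ring_nf
    intro c
    induction c using Int.induction_on with
    | zero => simpa using h0
    | succ i ih => rw [step]; exact ih
    | pred i ih => rw [← step]; simpa using ih
  have hn : ∀ n : ℕ, ∀ c : ℤ, |∑ x ∈ range n, f (c + x)| ≤ q := by
    intro n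
    induction n using Nat.strong_induction_on with
    | _ n ih =>
      intro c
      rcases lt_or_ge n q with h | h
      · calc |∑ x ∈ range n, f (c + x)| ≤ ∑ x ∈ range n, |f (c + x)| :=
            Finset.abs_sum_le_sum_abs _ _
          _ ≤ ∑ x ∈ range n, (1 : ℝ) := Finset.sum_le_sum fun _ _ => h1 _
          _ = n := by simp
          _ ≤ q := by exact_mod_cast h.le
      · obtain ⟨m, rfl⟩ := Nat.exists_eq_add_of_le h
        rw [Finset.sum_range_add, hfull, zero_add]
        have := ih m (by omega) (c + q)
        convert this using 4
        push_cast
        ring_nf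
  have hIcc : ∑ x ∈ Icc a b, f x = ∑ x ∈ range (b + 1 - a).toNat, f (a + x) := by
    symm
    apply Finset.sum_bij (fun (x : ℕ) _ => a + (x : ℤ))
    · intro x hx
      simp only [Finset.mem_range, Finset.mem_Icc] at *
      omega
    · intro x _ y _ h
      simpa using h
    · intro y hy
      simp only [Finset.mem_Icc] at hy
      refine ⟨(y - a).toNat, ?_, ?_⟩
      · simp only [Finset.mem_range]; omega
      · omega
    · intros; rfl
  rw [hIcc]
  exact hn _ _

end SpinDensity

namespace SpinDensity
open Finset
open scoped Classical

theorem exists_const_pow (A : ℕ) : ∃ C : ℕ, 1 ≤ C ∧ ∀ e : ℕ, (e + 1) ^ A ≤ C * 2 ^ e := by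
  have h := (tendsto_pow_const_div_const_pow_of_one_lt A (one_lt_two : (1 : ℝ) < 2)).bddAbove_range
  obtain ⟨B, hB⟩ := h
  refine ⟨⌈2 * B⌉₊ + 1, by omega, fun e => ?_⟩
  have h1 := hB ⟨e + 1, rfl⟩
  simp only at h1
  rw [div_le_iff₀ (by positivity)] at h1
  have h2 : (2 * B : ℝ) ≤ (⌈2 * B⌉₊ : ℝ) := Nat.le_ceil _
  have h3 : ((e + 1 : ℕ) : ℝ) ^ A ≤ ((⌈2 * B⌉₊ + 1 : ℕ) : ℝ) * 2 ^ e := by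
    have : (0 : ℝ) < 2 ^ e := by positivity
    calc ((e + 1 : ℕ) : ℝ) ^ A ≤ B * 2 ^ (e + 1) := h1
      _ = (2 * B) * 2 ^ e := by ring
      _ ≤ ((⌈2 * B⌉₊ + 1 : ℕ) : ℝ) * 2 ^ e := by
        push_cast
        gcongr
        linarith
  exact_mod_cast h3

theorem tau_pow_le (A : ℕ) : ∃ C : ℕ, 1 ≤ C ∧ ∀ n : ℕ, 0 < n → (#n.divisors) ^ A ≤ C * n := by
  obtain ⟨C₁, hC1, hC⟩ := exists_const_pow A
  refine ⟨C₁ ^ (2 ^ A), Nat.one_le_pow _ _ hC1, fun n hn => ?_⟩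
  rw [Nat.card_divisors hn.ne', ← Finset.prod_pow]
  let c : ℕ → ℕ := fun p => if p < 2 ^ A then C₁ else 1
  have h1 : ∀ p ∈ n.primeFactors, (n.factorization p + 1) ^ A ≤ c p * p ^ n.factorization p := by
    intro p hp
    have hpp := Nat.prime_of_mem_primeFactors hp
    by_cases h : p < 2 ^ A
    · simp only [c, h, if_true]
      refine (hC _).trans ?_
      gcongr
      exact hpp.two_le
    · simp only [c, h, if_false, one_mul]
      have : n.factorization p + 1 ≤ 2 ^ n.factorization p := Nat.lt_two_pow_self
      calc (n.factorization p + 1) ^ A ≤ (2 ^ n.factorization p) ^ A := by gcongr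
        _ = (2 ^ A) ^ n.factorization p := by rw [← pow_mul, ← pow_mul, mul_comm]
        _ ≤ p ^ n.factorization p := by gcongr; omega
  refine (Finset.prod_le_prod' h1).trans ?_
  rw [Finset.prod_mul_distrib]
  have h2 : ∏ p ∈ n.primeFactors, p ^ n.factorization p = n := Nat.prod_factorization_pow_eq_self hn.ne'
  rw [h2]
  gcongr
  calc ∏ p ∈ n.primeFactors, c p = ∏ p ∈ n.primeFactors with p < 2 ^ A, C₁ := by
        rw [Finset.prod_filter]
    _ = C₁ ^ #{p ∈ n.primeFactors | p < 2 ^ A} := by simp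
    _ ≤ C₁ ^ (2 ^ A) := by
        apply Nat.pow_le_pow_right hC1
        calc #{p ∈ n.primeFactors | p < 2 ^ A} ≤ #(range (2 ^ A)) := by
              apply Finset.card_le_card
              intro p hp
              exact Finset.mem_range.2 (Finset.mem_filter.1 hp).2
          _ = 2 ^ A := by simp

/-- Divisor bound. -/
theorem tau_bound (A : ℕ) : ∃ C : ℕ, 1 ≤ C ∧ ∀ N n : ℕ, 0 < N → 0 < n → n ≤ N ^ A → #n.divisors ≤ C * N := by
  obtain ⟨C, hC1, hC⟩ := tau_pow_le (A + 1)
  refine ⟨C, hC1, fun N n hN0 hn hN => ?_⟩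
  have h1 := hC n hn
  have h2 : (#n.divisors) ^ (A + 1) ≤ (C * N) ^ (A + 1) := by
    calc (#n.divisors) ^ (A + 1) ≤ C * n := h1
      _ ≤ C ^ (A + 1) * N ^ (A + 1) := by
        gcongr
        · exact Nat.le_self_pow (by omega) _
        · exact hN.trans (Nat.pow_le_pow_right hN0 (by omega))
      _ = (C * N) ^ (A + 1) := by rw [mul_pow]
  exact (Nat.pow_le_pow_iff_left (by omega)).1 h2

end SpinDensity

namespace SpinDensity
open Finset
open scoped Classical

/-- Totally positive elements of `ℤ[√2]`. -/
def Tp (w : ℤ√2) : Prop := 0 < w.re ∧ 0 < w.norm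

/-- The (primitive, odd) elements of the fundamental domain. -/
def IsS (w : ℤ√2) : Prop := 2 * |w.im| < w.re ∧ Odd w.re ∧ IsCoprime w.re w.im

theorem norm2 (w : ℤ√2) : w.norm = w.re * w.re - 2 * w.im * w.im := rfl

theorem IsS.bound {w : ℤ√2} (h : IsS w) : 0 < w.re ∧ 4 * (w.im * w.im) < w.re * w.re ∧
    w.re * w.re < 2 * w.norm := by
  obtain ⟨h1, _, _⟩ := h
  have h0 : 0 ≤ |w.im| := abs_nonneg _
  have h2 : |w.im| * |w.im| = w.im * w.im := abs_mul_abs_self _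
  have hpos : 0 < w.re := by linarith
  have : 4 * (w.im * w.im) < w.re * w.re := by rw [← h2]; nlinarith
  refine ⟨hpos, this, ?_⟩
  rw [norm2]; linarith

theorem IsS.tp {w : ℤ√2} (h : IsS w) : Tp w := by
  obtain ⟨h1, h2, h3⟩ := h.bound
  exact ⟨h1, by nlinarith⟩

theorem odd_norm {w : ℤ√2} (h : Odd w.re) : Odd w.norm := by
  rw [norm2, mul_assoc]
  exact (h.mul h).sub_even (even_two_mul _)

theorem odd_re_of_odd_norm {w : ℤ√2} (h : Odd w.norm) : Odd w.re := by
  rw [norm2, mul_assoc] at h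
  by_contra hc
  rw [Int.not_odd_iff_even] at hc
  exact (Int.not_even_iff_odd.2 h) ((hc.mul_left _).sub (even_two_mul _))

theorem eq_of_cross {w w' : ℤ√2} (h : IsS w) (h' : IsS w') (hc : w.re * w'.im = w'.re * w.im) :
    w = w' := by
  have e1 : w.re ∣ w'.re := h.2.2.dvd_of_dvd_mul_right (Dvd.intro _ hc)
  have e2 : w'.re ∣ w.re := h'.2.2.dvd_of_dvd_mul_right (Dvd.intro _ hc.symm)
  have e3 : w.re = w'.re := Int.dvd_antisymm h.bound.1.le h'.bound.1.le e1 e2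
  have e4 : w.im = w'.im := by
    rw [← e3] at hc
    exact (mul_left_cancel₀ h.bound.1.ne' hc).symm
  exact Zsqrtd.ext e3 e4

theorem eq_of_dvd {w w' : ℤ√2} (h : IsS w) (h' : IsS w') (hn : w.norm = w'.norm)
    (hd : w.norm ∣ w.re * w'.im - w'.re * w.im) : w = w' := by
  obtain ⟨B, hB⟩ := hd
  obtain ⟨p1, p2, p3⟩ := h.bound
  obtain ⟨p1', p2', p3'⟩ := h'.bound
  have hm : 0 < w.norm := h.tp.2
  have hodd : Odd w.norm := odd_norm h.2.1
  have k1 : w.re * w'.re < 2 * w.norm := by nlinarith [sq_nonneg (w.re - w'.re)]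
  have a1 : |w.im| * 2 < w.re := by linarith [h.1]
  have a2 : |w'.im| * 2 < w'.re := by linarith [h'.1]
  have k2 : |w.re * w'.im| < w.norm := by
    rw [abs_mul, abs_of_pos p1]; nlinarith
  have k3 : |w'.re * w.im| < w.norm := by
    rw [abs_mul, abs_of_pos p1']; nlinarith
  have k4 : |w.norm * B| < 2 * w.norm := by
    rw [← hB]
    have := abs_sub (w.re * w'.im) (w'.re * w.im)
    linarith
  have k5 : |B| < 2 := by
    rw [abs_mul, abs_of_pos hm] at k4
    nlinarith
  have key : (w.re * w'.re - 2 * w.im * w'.im) ^ 2 = w.norm ^ 2 * (1 + 2 * B ^ 2) := by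
    have : (w.re * w'.re - 2 * w.im * w'.im) ^ 2 =
      w.norm * w'.norm + 2 * (w.re * w'.im - w'.re * w.im) ^ 2 := by
      rw [norm2, norm2]; ring
    rw [this, ← hn, hB]; ring
  have hB0 : B = 0 := by
    by_contra hne
    have : B ^ 2 = 1 := by
      have := abs_lt.1 k5
      have : B = 1 ∨ B = -1 := by omega
      rcases this with rfl | rfl <;> norm_num
    rw [this] at key
    obtain ⟨t, ht⟩ := hodd
    rw [ht] at key
    set A := w.re * w'.re - 2 * w.im * w'.im
    have h4 : A ^ 2 % 4 = 3 := by
      rw [key]; ring_nf; omega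
    rcases Int.even_or_odd' A with ⟨s, hs | hs⟩ <;> rw [hs] at h4 <;> ring_nf at h4 <;> omega
  apply eq_of_cross h h'
  rw [hB0] at hB
  linarith

/-- boxes -/
noncomputable def box (L : ℕ) : Finset (ℤ√2) :=
  (Icc (-L : ℤ) L ×ˢ Icc (-L : ℤ) L).image fun q => ⟨q.1, q.2⟩

theorem mem_box {L : ℕ} {w : ℤ√2} : w ∈ box L ↔ |w.re| ≤ L ∧ |w.im| ≤ L := by
  simp only [box, Finset.mem_image, Finset.mem_product, Finset.mem_Icc, abs_le]
  constructor
  · rintro ⟨q, h, rfl⟩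
    exact h
  · intro h
    exact ⟨(w.re, w.im), h, rfl⟩

theorem sum_box (L : ℕ) (f : ℤ√2 → ℝ) :
    ∑ w ∈ box L, f w = ∑ b ∈ Icc (-L : ℤ) L, ∑ a ∈ Icc (-L : ℤ) L, f ⟨a, b⟩ := by
  rw [box, Finset.sum_image, Finset.sum_product_right]
  intro a _ b _ h
  have h1 := congrArg Zsqrtd.re h
  have h2 := congrArg Zsqrtd.im h
  exact Prod.ext h1 h2

theorem card_box (L : ℕ) : #(box L) = (2 * L + 1) ^ 2 := by
  have := sum_box L (fun _ => 1)
  simp only [Finset.sum_const, Int.card_Icc, nsmul_eq_mul, mul_one] at this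
  have h2 : ((L : ℤ) + 1 - -(L : ℤ)).toNat = 2 * L + 1 := by omega
  rw [h2] at this
  have h3 : (#(box L) : ℝ) = (((2 * L + 1) ^ 2 : ℕ) : ℝ) := by
    rw [this]; push_cast; ring
  exact_mod_cast h3

noncomputable def SF (Y : ℕ) : Finset (ℤ√2) := (box (2 * Y)).filter fun w => IsS w ∧ w.norm ≤ Y

theorem mem_SF {Y : ℕ} {w : ℤ√2} : w ∈ SF Y ↔ IsS w ∧ w.norm ≤ Y := by
  rw [SF, Finset.mem_filter, and_iff_right_iff_imp, mem_box]
  rintro ⟨h, hY⟩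
  obtain ⟨p1, p2, p3⟩ := h.bound
  have h1 : w.re ≤ 2 * Y := by nlinarith
  have h2 := h.1
  rw [abs_of_pos p1]
  have := abs_nonneg w.im
  push_cast
  constructor <;> omega

/-- norm as natural number -/
def nn (w : ℤ√2) : ℕ := w.norm.natAbs

theorem nn_mul (w w' : ℤ√2) : nn (w * w') = nn w * nn w' := by
  simp [nn, Zsqrtd.norm_mul, Int.natAbs_mul]

theorem Tp.nn_eq {w : ℤ√2} (h : Tp w) : (nn w : ℤ) = w.norm := Int.natAbs_of_nonneg h.2.le

theorem Tp.nn_pos {w : ℤ√2} (h : Tp w) : 0 < nn w := Int.natAbs_pos.2 h.2.ne'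

theorem mem_SF' {Y : ℕ} {w : ℤ√2} : w ∈ SF Y ↔ IsS w ∧ nn w ≤ Y := by
  rw [mem_SF]
  constructor
  · rintro ⟨h, h'⟩; exact ⟨h, by rw [← h.tp.nn_eq] at h'; exact_mod_cast h'⟩
  · rintro ⟨h, h'⟩; exact ⟨h, by rw [← h.tp.nn_eq]; exact_mod_cast h'⟩

theorem prime_not_dvd_re {w : ℤ√2} (h : IsCoprime w.re w.im) {p : ℤ} (hp : Prime p)
    (hodd : ¬ p ∣ 2) (hg : p ∣ w.norm) : ¬ p ∣ w.re := by
  intro hr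
  have h1 : p ∣ 2 * (w.im * w.im) := by
    have : 2 * (w.im * w.im) = w.re * w.re - w.norm := by rw [norm2]; ring
    rw [this]
    exact dvd_sub (hr.mul_right _) hg
  rcases hp.dvd_or_dvd h1 with h2 | h2
  · exact hodd h2
  · have h3 : p ∣ w.im := (hp.dvd_or_dvd h2).elim id id
    exact hp.not_isUnit (h.isUnit_of_dvd' hr h3)

theorem prime_not_dvd_im {w : ℤ√2} (h : IsCoprime w.re w.im) {p : ℤ} (hp : Prime p)
    (hg : p ∣ w.norm) : ¬ p ∣ w.im := by
  intro hr
  have h1 : p ∣ w.re * w.re := by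
    have : w.re * w.re = w.norm + 2 * w.im * w.im := by rw [norm2]; ring
    rw [this]
    exact dvd_add hg (hr.mul_left _)
  have h3 : p ∣ w.re := (hp.dvd_or_dvd h1).elim id id
  exact hp.not_isUnit (h.isUnit_of_dvd' h3 hr)

theorem odd_prime_not_dvd_two {p m : ℤ} (hp : Prime p) (hm : Odd m) (h : p ∣ m) : ¬ p ∣ 2 := by
  intro h2
  obtain ⟨t, ht⟩ := hm
  have : p ∣ 1 := by
    have e : (1 : ℤ) = m - 2 * t := by rw [ht]; ring
    rw [e]
    exact dvd_sub h (h2.mul_right _)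
  exact hp.not_isUnit (isUnit_of_dvd_one this)

/-- The cross terms. -/
theorem cross_coprime {w v : ℤ√2} (hw : IsS w) (hv : IsS v) (hn : w.norm = v.norm)
    {p : ℤ} (hp : Prime p) (hpm : p ∣ w.norm) (h1 : p ∣ w.re * v.im - v.re * w.im)
    (h2 : p ∣ w.re * v.im + v.re * w.im) : False := by
  have h2' := odd_prime_not_dvd_two hp (odd_norm hw.2.1) hpm
  have a : p ∣ 2 * (w.re * v.im) := by
    have := dvd_add h1 h2
    ring_nf at this ⊢
    exact this
  rcases hp.dvd_or_dvd a with b | b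
  · exact h2' b
  rcases hp.dvd_or_dvd b with c | c
  · exact prime_not_dvd_re hw.2.2 hp h2' hpm c
  · exact prime_not_dvd_im hv.2.2 hp (hn ▸ hpm) c

theorem isCoprime_of_no_prime {a b : ℤ} (h0 : a ≠ 0)
    (h : ∀ p : ℤ, Prime p → p ∣ a → p ∣ b → False) : IsCoprime a b := by
  apply isCoprime_of_prime_dvd
  · rintro ⟨h1, _⟩; exact h0 h1
  · intro p hp h1 h2
    exact h p hp h1 h2

theorem inj_gcd {w v v' : ℤ√2} (hw : IsS w) (hv : IsS v) (hv' : IsS v') (hn : w.norm = v.norm)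
    (hn' : w.norm = v'.norm)
    (hg : Int.gcd w.norm (w.re * v.im - v.re * w.im) = Int.gcd w.norm (w.re * v'.im - v'.re * w.im)) :
    v = v' := by
  have hm0 : w.norm ≠ 0 := hw.tp.2.ne'
  -- the complementary divisor divides the other cross term
  have comp : ∀ u : ℤ√2, IsS u → w.norm = u.norm → ∀ g h : ℤ,
      g = Int.gcd w.norm (w.re * u.im - u.re * w.im) → w.norm = g * h →
      h ∣ w.re * u.im + u.re * w.im ∧ IsCoprime g h := by
    intro u hu hnu g h hgdef hgh
    have hg0 : g ≠ 0 := by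
      rintro rfl; simp at hgh; exact hm0 hgh
    have hgx : g ∣ w.re * u.im - u.re * w.im := by rw [hgdef]; exact Int.gcd_dvd_right _ _
    obtain ⟨x, hx⟩ := hgx
    have hprod : (w.re * u.im - u.re * w.im) * (w.re * u.im + u.re * w.im) =
        w.norm * (u.im * u.im - w.im * w.im) := by
      have e : w.re * w.re - 2 * w.im * w.im = u.re * u.re - 2 * u.im * u.im := hnu
      rw [norm2]
      linear_combination (w.im * w.im) * e
    have hcop : IsCoprime h x := by
      apply isCoprime_of_no_prime
      · rintro rfl; simp at hgh; exact hm0 hgh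
      · intro p hp h1 h2
        have d1 : g * p ∣ w.norm := by rw [hgh]; exact mul_dvd_mul_left _ h1
        have d2 : g * p ∣ w.re * u.im - u.re * w.im := by rw [hx]; exact mul_dvd_mul_left _ h2
        have d3 : g * p ∣ g := by
          conv_rhs => rw [hgdef]
          exact Int.dvd_coe_gcd d1 d2
        have : p ∣ 1 := by
          have : g * p ∣ g * 1 := by simpa using d3
          exact (mul_dvd_mul_iff_left hg0).1 this
        exact hp.not_isUnit (isUnit_of_dvd_one this)
    have hh : h ∣ w.re * u.im + u.re * w.im := by
      rw [hx, hgh] at hprod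
      have : x * (w.re * u.im + u.re * w.im) = h * (u.im * u.im - w.im * w.im) := by
        apply mul_left_cancel₀ hg0
        linarith
      exact hcop.dvd_of_dvd_mul_left (Dvd.intro _ this.symm)
    refine ⟨hh, ?_⟩
    apply isCoprime_of_no_prime hg0
    intro p hp h1 h2
    exact cross_coprime hw hu hnu hp (hgh ▸ h1.mul_right _) (hx ▸ h1.mul_right _) (h2.trans hh)
  obtain ⟨h, hgh⟩ : ∃ h, w.norm = (Int.gcd w.norm (w.re * v.im - v.re * w.im) : ℤ) * h :=
    Int.gcd_dvd_left _ _
  obtain ⟨c1, c2⟩ := comp v hv hn _ h rfl hgh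
  have hgh' := hgh
  rw [hg] at hgh'
  obtain ⟨c1', -⟩ := comp v' hv' hn' _ h rfl hgh'
  set g : ℤ := (Int.gcd w.norm (w.re * v.im - v.re * w.im) : ℤ) with hgdef
  have g1 : g ∣ w.re * v.im - v.re * w.im := Int.gcd_dvd_right _ _
  have g2 : g ∣ w.re * v'.im - v'.re * w.im := by rw [hgdef, hg]; exact Int.gcd_dvd_right _ _
  have hcopre : IsCoprime w.norm w.re := by
    apply isCoprime_of_no_prime hm0
    intro p hp h1 h2
    exact prime_not_dvd_re hw.2.2 hp (odd_prime_not_dvd_two hp (odd_norm hw.2.1) h1) h1 h2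
  have hgre : IsCoprime g w.re := hcopre.of_isCoprime_of_dvd_left ⟨h, hgh⟩
  have hhre : IsCoprime h w.re := hcopre.of_isCoprime_of_dvd_left ⟨g, by rw [mul_comm]; exact hgh⟩
  have q1 : g ∣ v.re * v'.im - v'.re * v.im := by
    apply hgre.dvd_of_dvd_mul_left
    have e : w.re * (v.re * v'.im - v'.re * v.im) =
      v.re * (w.re * v'.im - v'.re * w.im) - v'.re * (w.re * v.im - v.re * w.im) := by ring
    rw [e]
    exact dvd_sub (g2.mul_left _) (g1.mul_left _)
  have q2 : h ∣ v.re * v'.im - v'.re * v.im := by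
    apply hhre.dvd_of_dvd_mul_left
    have e : w.re * (v.re * v'.im - v'.re * v.im) =
      v.re * (w.re * v'.im + v'.re * w.im) - v'.re * (w.re * v.im + v.re * w.im) := by ring
    rw [e]
    exact dvd_sub (c1'.mul_left _) (c1.mul_left _)
  apply eq_of_dvd hv hv' (hn.symm.trans hn')
  rw [← hn, hgh]
  exact c2.mul_dvd q1 q2

theorem card_norm_le (T : Finset (ℤ√2)) (m : ℕ) (hm : 0 < m) (hT : ∀ w ∈ T, IsS w ∧ nn w = m) :
    #T ≤ #m.divisors := by
  rcases T.eq_empty_or_nonempty with rfl | ⟨w, hw⟩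
  · simp
  have hnw : ∀ v ∈ T, v.norm = m := fun v hv => by
    rw [← (hT v hv).1.tp.nn_eq, (hT v hv).2]
  apply Finset.card_le_card_of_injOn (fun v => Int.gcd w.norm (w.re * v.im - v.re * w.im))
  · intro v _
    simp only [Finset.mem_coe, Nat.mem_divisors]
    refine ⟨?_, hm.ne'⟩
    have := Int.gcd_dvd_left w.norm (w.re * v.im - v.re * w.im)
    rw [hnw w hw] at this ⊢
    exact_mod_cast this
  · intro v hv v' hv' h
    exact inj_gcd (hT w hw).1 (hT v hv).1 (hT v' hv').1 ((hnw w hw).trans (hnw v hv).symm)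
      ((hnw w hw).trans (hnw v' hv').symm) h

end SpinDensity

namespace SpinDensity
open Finset
open scoped Classical

theorem Tp.mul {w z : ℤ√2} (hw : Tp w) (hz : Tp z) : Tp (w * z) := by
  obtain ⟨h1, h2⟩ := hw
  obtain ⟨h3, h4⟩ := hz
  refine ⟨?_, by rw [Zsqrtd.norm_mul]; positivity⟩
  rw [norm2] at h2 h4
  rw [Zsqrtd.re_mul]
  have h5 : (2 * w.im * z.im) ^ 2 < (w.re * z.re) ^ 2 := by
    have e1 : 0 ≤ w.im ^ 2 := sq_nonneg _
    have e2 : 0 ≤ z.im ^ 2 := sq_nonneg _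
    have e3 : 2 * w.im ^ 2 < w.re ^ 2 := by linarith
    have e4 : 2 * z.im ^ 2 < z.re ^ 2 := by linarith
    calc (2 * w.im * z.im) ^ 2 = (2 * w.im ^ 2) * (2 * z.im ^ 2) := by ring
      _ < w.re ^ 2 * z.re ^ 2 := by
        apply mul_lt_mul'' e3 e4 <;> positivity
      _ = _ := by ring
  have h6 := abs_lt_of_sq_lt_sq h5 (by positivity)
  have := (abs_lt.1 h6).1
  linarith

def e2 : (ℤ√2)ˣ where
  val := ⟨3, 2⟩
  inv := ⟨3, -2⟩
  val_inv := by decide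
  inv_val := by decide

theorem tp_one : Tp 1 := by constructor <;> decide

theorem norm_e2_zpow (k : ℤ) : ((e2 ^ k : (ℤ√2)ˣ) : ℤ√2).norm = 1 ∧
    0 < ((e2 ^ k : (ℤ√2)ˣ) : ℤ√2).re := by
  suffices h : Tp ((e2 ^ k : (ℤ√2)ˣ) : ℤ√2) by
    refine ⟨?_, h.1⟩
    have h1 : IsUnit (((e2 ^ k : (ℤ√2)ˣ) : ℤ√2).norm) := by
      have := (e2 ^ k).isUnit
      exact this.map Zsqrtd.normMonoidHom
    rcases Int.isUnit_iff.1 h1 with h2 | h2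
    · exact h2
    · have := h.2; omega
  have hn : ∀ n : ℕ, Tp ((e2 ^ n : (ℤ√2)ˣ) : ℤ√2) := by
    intro n
    induction n with
    | zero => simpa using tp_one
    | succ n ih =>
      rw [pow_succ, Units.val_mul]
      exact ih.mul (by constructor <;> decide)
  have hn' : ∀ n : ℕ, Tp ((e2⁻¹ ^ n : (ℤ√2)ˣ) : ℤ√2) := by
    intro n
    induction n with
    | zero => simpa using tp_one
    | succ n ih =>
      rw [pow_succ, Units.val_mul]
      exact ih.mul (by constructor <;> decide)
  rcases Int.eq_nat_or_neg k with ⟨n, rfl | rfl⟩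
  · simpa using hn n
  · simpa using hn' n

theorem tp_e2_zpow (k : ℤ) : Tp ((e2 ^ k : (ℤ√2)ˣ) : ℤ√2) :=
  ⟨(norm_e2_zpow k).2, by rw [(norm_e2_zpow k).1]; norm_num⟩

/-- Multiplication by a unit. -/
noncomputable def um (w : ℤ√2) (k : ℤ) : ℤ√2 := w * ((e2 ^ k : (ℤ√2)ˣ) : ℤ√2)

theorem um_um (w : ℤ√2) (k l : ℤ) : um (um w k) l = um w (k + l) := by
  simp [um, zpow_add, mul_assoc]

theorem um_zero (w : ℤ√2) : um w 0 = w := by simp [um]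

theorem um_inj {w w' : ℤ√2} {k : ℤ} (h : um w k = w') : um w' (-k) = w := by
  rw [← h, um_um, add_neg_cancel, um_zero]

theorem um_one (w : ℤ√2) : um w 1 = w * ⟨3, 2⟩ := by simp [um]; rfl

theorem um_neg_one (w : ℤ√2) : um w (-1) = w * ⟨3, -2⟩ := by simp [um]; rfl

theorem um_mul (z w : ℤ√2) (k : ℤ) : um (z * w) k = z * um w k := by simp [um, mul_assoc]

theorem norm_um (w : ℤ√2) (k : ℤ) : (um w k).norm = w.norm := by
  rw [um, Zsqrtd.norm_mul, (norm_e2_zpow k).1, mul_one]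

theorem nn_um (w : ℤ√2) (k : ℤ) : nn (um w k) = nn w := by rw [nn, norm_um, nn]

theorem Tp.um {w : ℤ√2} (h : Tp w) (k : ℤ) : Tp (um w k) := h.mul (tp_e2_zpow k)

theorem um_dvd (w : ℤ√2) (k : ℤ) : um w k ∣ w := by
  have : um (um w k) (-k) = w := by rw [um_um, add_neg_cancel, um_zero]
  exact ⟨_, this.symm⟩

theorem dvd_um (w : ℤ√2) (k : ℤ) : w ∣ um w k := ⟨_, rfl⟩

theorem coprime_um {w : ℤ√2} (h : IsCoprime w.re w.im) (k : ℤ) :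
    IsCoprime (um w k).re (um w k).im := Zsqrtd.isCoprime_of_dvd_isCoprime h (um_dvd w k)

theorem exists_red {w : ℤ√2} (h : Tp w) (ho : Odd w.norm) (hc : IsCoprime w.re w.im) :
    ∃ k : ℤ, IsS (um w k) := by
  have main : ∀ n : ℕ, ∀ w : ℤ√2, w.re.natAbs ≤ n → Tp w → Odd w.norm →
      IsCoprime w.re w.im → ∃ k : ℤ, IsS (um w k) := by
    intro n
    induction n with
    | zero =>
      intro w h1 h2
      have := h2.1
      omega
    | succ n ih =>
      intro w h1 h2 h3 h4
      by_cases hs : 2 * |w.im| < w.re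
      · exact ⟨0, by rw [um_zero]; exact ⟨hs, odd_re_of_odd_norm h3, h4⟩⟩
      · have hodd := odd_re_of_odd_norm h3
        have hre := h2.1
        rcases abs_cases w.im with ⟨e, e'⟩ | ⟨e, e'⟩
        · have hlt : w.re < 2 * w.im := by
            rw [e] at hs
            obtain ⟨t, ht⟩ := hodd
            omega
          have htp := h2.um (-1)
          have hr : (um w (-1)).re = 3 * w.re - 4 * w.im := by
            rw [um_neg_one, Zsqrtd.re_mul]; ring
          obtain ⟨k, hk⟩ := ih (um w (-1)) (by have := htp.1; omega) htp
            (by rw [norm_um]; exact h3) (coprime_um h4 _)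
          exact ⟨-1 + k, by rw [← um_um]; exact hk⟩
        · have hlt : w.re < - (2 * w.im) := by
            rw [e] at hs
            obtain ⟨t, ht⟩ := hodd
            omega
          have htp := h2.um 1
          have hr : (um w 1).re = 3 * w.re + 4 * w.im := by
            rw [um_one, Zsqrtd.re_mul]; ring
          obtain ⟨k, hk⟩ := ih (um w 1) (by have := htp.1; omega) htp
            (by rw [norm_um]; exact h3) (coprime_um h4 _)
          exact ⟨1 + k, by rw [← um_um]; exact hk⟩
  exact main _ w le_rfl h ho hc

theorem um_unique {w : ℤ√2} {k : ℤ} (h : IsS w) (h' : IsS (um w k)) : um w k = w := by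
  symm
  apply eq_of_dvd h h' (norm_um w k).symm
  refine ⟨((e2 ^ k : (ℤ√2)ˣ) : ℤ√2).im, ?_⟩
  rw [um, Zsqrtd.re_mul, Zsqrtd.im_mul, norm2]
  ring

theorem div_aux (X n : ℤ) (hn : n ≠ 0) : ∃ q : ℤ, 4 * (X - q * n) ^ 2 ≤ n ^ 2 := by
  refine ⟨round ((X : ℚ) / n), ?_⟩
  have h := abs_sub_round ((X : ℚ) / n)
  set q := round ((X : ℚ) / n)
  have hn' : (n : ℚ) ≠ 0 := by exact_mod_cast hn
  have e : ((X : ℚ) - q * n) = ((X : ℚ) / n - q) * n := by field_simp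
  have h2 : ((X : ℚ) / n - q) ^ 2 ≤ (1 / 2) ^ 2 := by
    rw [← sq_abs]; gcongr
  have : 4 * ((X : ℚ) - q * n) ^ 2 ≤ (n : ℚ) ^ 2 := by
    rw [e, mul_pow]
    have : (0 : ℚ) ≤ (n : ℚ) ^ 2 := by positivity
    nlinarith
  exact_mod_cast this

theorem norm_ne_zero' {w : ℤ√2} (h : w ≠ 0) : w.norm ≠ 0 := by
  intro h0
  apply h
  refine (Zsqrtd.norm_eq_zero ?_ w).1 h0
  intro n hn
  have : n * n = 2 := hn.symm
  have h1 : n < 2 := by nlinarith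
  have h2 : -2 < n := by nlinarith
  interval_cases n <;> omega

theorem exists_mod (x y : ℤ√2) (hy : y ≠ 0) : ∃ q : ℤ√2, nn (x - q * y) < nn y := by
  have hn := norm_ne_zero' hy
  obtain ⟨q1, h1⟩ := div_aux (x * star y).re y.norm hn
  obtain ⟨q2, h2⟩ := div_aux (x * star y).im y.norm hn
  refine ⟨⟨q1, q2⟩, ?_⟩
  have key : (x - ⟨q1, q2⟩ * y).norm * y.norm =
      ((x * star y).re - q1 * y.norm) ^ 2 - 2 * ((x * star y).im - q2 * y.norm) ^ 2 := by
    simp only [norm2, Zsqrtd.re_sub, Zsqrtd.im_sub, Zsqrtd.re_mul, Zsqrtd.im_mul, Zsqrtd.re_star,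
      Zsqrtd.im_star]
    ring
  have hpos : 0 < y.norm ^ 2 := by positivity
  have h3 : |(x - ⟨q1, q2⟩ * y).norm * y.norm| < y.norm ^ 2 := by
    rw [key, abs_lt]
    constructor <;> nlinarith [sq_nonneg ((x * star y).re - q1 * y.norm),
      sq_nonneg ((x * star y).im - q2 * y.norm)]
  rw [abs_mul, ← sq_abs y.norm, sq] at h3
  have h4 := lt_of_mul_lt_mul_right h3 (abs_nonneg _)
  rw [nn, nn]
  exact by zify; exact h4

theorem exists_gcd (x y : ℤ√2) : ∃ g s t : ℤ√2, g ∣ x ∧ g ∣ y ∧ g = s * x + t * y := by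
  have main : ∀ n : ℕ, ∀ x y : ℤ√2, nn y ≤ n → ∃ g s t : ℤ√2, g ∣ x ∧ g ∣ y ∧ g = s * x + t * y := by
    intro n
    induction n with
    | zero =>
      intro x y h
      have : y = 0 := by
        by_contra hc
        have := norm_ne_zero' hc
        rw [nn] at h
        omega
      exact ⟨x, 1, 0, dvd_rfl, by simp [this], by ring⟩
    | succ n ih =>
      intro x y h
      by_cases hy : y = 0
      · exact ⟨x, 1, 0, dvd_rfl, by simp [hy], by ring⟩
      obtain ⟨q, hq⟩ := exists_mod x y hy
      obtain ⟨g, s, t, h1, h2, h3⟩ := ih y (x - q * y) (by omega)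
      refine ⟨g, t, s - t * q, ?_, h1, by rw [h3]; ring⟩
      have : x = (x - q * y) + q * y := by ring
      rw [this]
      exact dvd_add h2 (h1.mul_left _)
  exact main _ x y le_rfl

/-- Existence of a prime divisor. -/
theorem exists_prime_div {w : ℤ√2} (hc : IsCoprime w.re w.im) {p : ℕ} (hp : p.Prime) (hp2 : p ≠ 2)
    (hd : (p : ℤ) ∣ w.norm) : ∃ z : ℤ√2, IsS z ∧ nn z = p ∧ z ∣ w := by
  have hpdvd : ¬ ((p : ℤ) : ℤ√2) ∣ w := by
    intro h
    rw [Zsqrtd.intCast_dvd] at h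
    have := hc.isUnit_of_dvd' h.1 h.2
    rw [Int.isUnit_iff_natAbs_eq] at this
    exact hp.one_lt.ne' (by simpa using this)
  obtain ⟨g, s, t, h1, h2, h3⟩ := exists_gcd ((p : ℤ) : ℤ√2) w
  obtain ⟨g', hg'⟩ := h1
  have hnn : nn g * nn g' = p ^ 2 := by
    rw [← nn_mul, ← hg', nn]
    simp [Zsqrtd.norm_intCast, Int.natAbs_mul, sq]
  have hunit : ∀ a : ℤ√2, nn a = 1 → IsUnit a := fun a ha => Zsqrtd.norm_eq_one_iff.1 ha
  have hg : nn g = p := by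
    obtain ⟨i, hi, hgi⟩ := (Nat.dvd_prime_pow hp).1 (Dvd.intro _ hnn)
    interval_cases i
    · exfalso
      have hu := hunit g (by simpa using hgi)
      apply hpdvd
      have : (((p : ℤ) : ℤ√2)) ∣ g * star w := by
        rw [h3, add_mul]
        apply dvd_add
        · exact (Dvd.intro_left s rfl).mul_right _
        · rw [mul_assoc, ← Zsqrtd.norm_eq_mul_conj]
          obtain ⟨r, hr⟩ := hd
          rw [hr]
          push_cast
          exact (Dvd.intro _ rfl).mul_left _
      rw [hu.dvd_mul_left] at this
      rw [Zsqrtd.intCast_dvd] at this ⊢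
      simpa using this
    · simpa using hgi
    · exfalso
      have : nn g' = 1 := by
        have : 0 < p ^ 2 := by have := hp.pos; positivity
        rw [hgi] at hnn
        exact Nat.eq_of_mul_eq_mul_left this (by rw [hnn, mul_one])
      have hu := hunit g' this
      apply hpdvd
      rw [hg', hu.mul_right_dvd]
      exact h2
  -- positive norm
  have ⟨g1, hg1, hg1n⟩ : ∃ g1 : ℤ√2, g1 ∣ w ∧ g1.norm = p := by
    rcases Int.natAbs_eq g.norm with h | h
    · exact ⟨g, h2, by rw [h]; exact_mod_cast hg⟩
    · have hu : IsUnit (⟨1, 1⟩ : ℤ√2) := hunit _ (by decide)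
      refine ⟨g * ⟨1, 1⟩, by rwa [hu.mul_right_dvd], ?_⟩
      rw [Zsqrtd.norm_mul, h]
      have : (⟨1, 1⟩ : ℤ√2).norm = -1 := by decide
      rw [this, ← nn, hg]; ring
  have ⟨g2, hg2, hg2n⟩ : ∃ g2 : ℤ√2, g2 ∣ w ∧ g2.norm = p ∧ 0 < g2.re := by
    have hppos : (0 : ℤ) < p := by exact_mod_cast hp.pos
    rcases lt_trichotomy g1.re 0 with h | h | h
    · exact ⟨-g1, by rwa [neg_dvd], by rw [Zsqrtd.norm_neg, hg1n], by simpa using h⟩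
    · exfalso
      rw [norm2, h] at hg1n
      nlinarith [sq_nonneg g1.im]
    · exact ⟨g1, hg1, hg1n, h⟩
  have htp : Tp g2 := ⟨hg2n.2, by rw [hg2n.1]; exact_mod_cast hp.pos⟩
  obtain ⟨k, hk⟩ := exists_red htp (by rw [hg2n.1]; exact_mod_cast hp.odd_of_ne_two hp2)
    (Zsqrtd.isCoprime_of_dvd_isCoprime hc hg2)
  refine ⟨um g2 k, hk, ?_, (um_dvd _ _).trans hg2⟩
  rw [nn_um, nn, hg2n.1]; simp

theorem cofactor_tp {w z : ℤ√2} (hw : Tp w) (hz : Tp z) (t : ℤ√2) (h : w = z * t) : Tp t := by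
  have hs : Tp (star z) := by
    refine ⟨by simpa using hz.1, ?_⟩
    have : (star z).norm = z.norm := Zsqrtd.norm_conj z
    rw [this]; exact hz.2
  have h1 := hw.mul hs
  have h2 : w * star z = ((z.norm : ℤ) : ℤ√2) * t := by
    rw [h, Zsqrtd.norm_eq_mul_conj]; ring
  rw [h2] at h1
  refine ⟨?_, ?_⟩
  · have := h1.1
    rw [Zsqrtd.re_smul] at this
    exact pos_of_mul_pos_right this hz.2.le
  · have := hw.2
    rw [h, Zsqrtd.norm_mul] at this
    exact pos_of_mul_pos_right this hz.2.le

theorem exists_factor {w : ℤ√2} (hw : IsS w) {p : ℕ} (hp : p.Prime) (hd : p ∣ nn w) :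
    ∃ z t : ℤ√2, ∃ k : ℤ, IsS z ∧ IsS t ∧ nn z = p ∧ um (z * t) k = w := by
  have hd' : (p : ℤ) ∣ w.norm := by rw [← hw.tp.nn_eq]; exact_mod_cast hd
  have hp2 : p ≠ 2 := by
    rintro rfl
    have := odd_norm hw.2.1
    exact (Int.not_even_iff_odd.2 this) (even_iff_two_dvd.2 hd')
  obtain ⟨z, hz, hzn, t, ht⟩ := exists_prime_div hw.2.2 hp hp2 hd'
  have htt : Tp t := cofactor_tp hw.tp hz.tp t ht
  have hto : Odd t.norm := by
    have := odd_norm hw.2.1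
    rw [ht, Zsqrtd.norm_mul] at this
    exact (Int.odd_mul.1 this).2
  obtain ⟨k, hk⟩ := exists_red htt hto (Zsqrtd.isCoprime_of_dvd_isCoprime hw.2.2 ⟨z, by rw [ht, mul_comm]⟩)
  refine ⟨z, um t k, -k, hz, hk, hzn, ?_⟩
  rw [um_mul, um_um, add_neg_cancel, um_zero, ht]

theorem factor_unique {z t z' t' : ℤ√2} {k k' : ℤ} (hz : IsS z) (ht : IsS t) (hz' : IsS z')
    (ht' : IsS t') {p : ℕ} (hp : p.Prime) (hzp : nn z = p) (hzp' : nn z' = p)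
    (hS : IsS (um (z * t) k)) (h : um (z * t) k = um (z' * t') k') : z = z' ∧ t = t' := by
  have hzz : z = z' := by
    have hn : z.norm = p := by rw [← hz.tp.nn_eq, hzp]
    have hn' : z'.norm = p := by rw [← hz'.tp.nn_eq, hzp']
    set W := um (z * t) k with hW
    have d1 : z ∣ W := by rw [hW, um_mul]; exact Dvd.intro _ rfl
    have d2 : z' ∣ W := by rw [h, um_mul]; exact Dvd.intro _ rfl
    have cr : ∀ y : ℤ√2, y.norm = p → y ∣ W → (p : ℤ) ∣ W.im * y.re - W.re * y.im := by
      rintro y hy ⟨s, hs⟩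
      refine ⟨s.im, ?_⟩
      rw [← hy, hs, norm2, Zsqrtd.re_mul, Zsqrtd.im_mul]; ring
    have hpW : (p : ℤ) ∣ W.norm := by
      obtain ⟨s, hs⟩ := d1
      rw [hs, Zsqrtd.norm_mul, hn]; exact Dvd.intro _ rfl
    have hpp : Prime (p : ℤ) := Nat.prime_iff_prime_int.1 hp
    have him := prime_not_dvd_im hS.2.2 hpp hpW
    apply eq_of_dvd hz hz' (hn.trans hn'.symm)
    rw [hn]
    have : (p : ℤ) ∣ W.im * (z.re * z'.im - z'.re * z.im) := by
      have e : W.im * (z.re * z'.im - z'.re * z.im) =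
        z'.im * (W.im * z.re - W.re * z.im) - z.im * (W.im * z'.re - W.re * z'.im) := by ring
      rw [e]
      exact dvd_sub ((cr z hn d1).mul_left _) ((cr z' hn' d2).mul_left _)
    exact (hpp.dvd_or_dvd this).resolve_left him
  refine ⟨hzz, ?_⟩
  subst hzz
  have hz0 : z ≠ 0 := by
    rintro rfl
    have := hz.tp.1
    simp at this
  have h2 : um t k = um t' k' := by
    rw [um_mul, um_mul] at h
    have hn0 : z.norm ≠ 0 := norm_ne_zero' hz0
    have h4 : ((z.norm : ℤ) : ℤ√2) * um t k = ((z.norm : ℤ) : ℤ√2) * um t' k' := by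
      rw [Zsqrtd.norm_eq_mul_conj, mul_comm z, mul_assoc, mul_assoc, h]
    apply Zsqrtd.ext
    · have := congrArg Zsqrtd.re h4
      rw [Zsqrtd.re_smul, Zsqrtd.re_smul] at this
      exact mul_left_cancel₀ hn0 this
    · have := congrArg Zsqrtd.im h4
      rw [Zsqrtd.im_smul, Zsqrtd.im_smul] at this
      exact mul_left_cancel₀ hn0 this
  have h3 : um t (k + -k') = t' := by rw [← um_um, h2, um_um, add_neg_cancel, um_zero]
  rw [← h3]
  exact (um_unique ht (by rw [h3]; exact ht')).symm

end SpinDensity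

namespace SpinDensity
open Finset
open scoped Classical

def th (u v : ℤ) : ℤ := ZMod.χ₈ v * (if u % 4 = 3 ∧ v % 4 = 3 then -1 else 1)

/-- The spin. -/
def spin (w : ℤ√2) : ℤ := if w.norm % 16 = 15 then jacobiSym w.im w.re.natAbs * th w.re w.im else 0

theorem res_of_norm {w : ℤ√2} (h : w.norm % 16 = 15) :
    (w.re % 8 = 1 ∨ w.re % 8 = 7) ∧ w.im % 2 = 1 := by
  rw [norm2] at h
  have h1 : ((w.re : ZMod 16)) * w.re - 2 * w.im * w.im = 15 := by
    have : ((w.re * w.re - 2 * w.im * w.im : ℤ) : ZMod 16) = ((15 : ℤ) : ZMod 16) := by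
      rw [ZMod.intCast_eq_intCast_iff']; exact h
    push_cast at this
    exact this
  have key : ∀ a b : ZMod 16, a * a - 2 * b * b = 15 →
      (a.val % 8 = 1 ∨ a.val % 8 = 7) ∧ b.val % 2 = 1 := by decide
  have h2 := key _ _ h1
  have e1 : (((w.re : ZMod 16).val : ℕ) : ℤ) = w.re % 16 := by rw [ZMod.val_intCast]; rfl
  have e2 : (((w.im : ZMod 16).val : ℕ) : ℤ) = w.im % 16 := by rw [ZMod.val_intCast]; rfl
  omega

theorem chi8_mod (x : ℤ) : ZMod.χ₈ (x : ZMod 8) = ZMod.χ₈ ((x % 8 : ℤ) : ZMod 8) := by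
  have : ((x : ℤ) : ZMod 8) = ((x % 8 : ℤ) : ZMod 8) := by
    rw [ZMod.intCast_eq_intCast_iff']; omega
  rw [this]

theorem chi4_mod (x : ℤ) : ZMod.χ₄ (x : ZMod 4) = ZMod.χ₄ ((x % 4 : ℤ) : ZMod 4) := by
  have : ((x : ℤ) : ZMod 4) = ((x % 4 : ℤ) : ZMod 4) := by
    rw [ZMod.intCast_eq_intCast_iff']; omega
  rw [this]

theorem th_sq {u v : ℤ} (hv : v % 2 = 1) : th u v * th u v = 1 := by
  have : v % 8 = 1 ∨ v % 8 = 3 ∨ v % 8 = 5 ∨ v % 8 = 7 := by omega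
  rw [th, chi8_mod v]
  have e : ∀ c : ℤ, (if u % 4 = 3 ∧ v % 4 = 3 then (-1 : ℤ) else 1) * (if u % 4 = 3 ∧ v % 4 = 3 then (-1 : ℤ) else 1) = 1 := by
    intro c; split_ifs <;> norm_num
  have e' := e 0
  have : ZMod.χ₈ ((v % 8 : ℤ) : ZMod 8) * ZMod.χ₈ ((v % 8 : ℤ) : ZMod 8) = 1 := by
    rcases this with h | h | h | h <;> rw [h] <;> decide
  calc _ = (ZMod.χ₈ ((v % 8 : ℤ) : ZMod 8) * ZMod.χ₈ ((v % 8 : ℤ) : ZMod 8)) * ((if u % 4 = 3 ∧ v % 4 = 3 then (-1 : ℤ) else 1) * (if u % 4 = 3 ∧ v % 4 = 3 then (-1 : ℤ) else 1)) := by ring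
    _ = 1 := by rw [this, e']; norm_num

theorem abs_jacobi (a : ℤ) (b : ℕ) : |jacobiSym a b| ≤ 1 := by
  rcases jacobiSym.trichotomy a b with h | h | h <;> rw [h] <;> norm_num

theorem abs_th (u v : ℤ) : |th u v| ≤ 1 := by
  have h1 : ∀ x : ZMod 8, |ZMod.χ₈ x| ≤ 1 := by decide
  rw [th, abs_mul]
  have := h1 v
  split_ifs <;> simpa using this

theorem abs_spin (w : ℤ√2) : |spin w| ≤ 1 := by
  unfold spin
  split_ifs
  · rw [abs_mul]
    exact mul_le_one₀ (abs_jacobi _ _) (abs_nonneg _) (abs_th _ _)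
  · norm_num

theorem spin_zero {w : ℤ√2} (h : ¬ IsCoprime w.re w.im) : spin w = 0 := by
  unfold spin
  split_ifs with h1
  · have h2 := (res_of_norm h1).1
    have h3 : w.re ≠ 0 := by rintro h; rw [h] at h2; omega
    have : jacobiSym w.im w.re.natAbs = 0 := by
      have : NeZero w.re.natAbs := ⟨by omega⟩
      rw [jacobiSym.eq_zero_iff_not_coprime]
      intro h4
      apply h
      rw [Int.isCoprime_iff_gcd_eq_one, Int.gcd_comm, ← h4]
      simp only [Int.gcd, Int.natAbs_natCast]
    rw [this, zero_mul]
  · rfl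

theorem spin_um_one {w : ℤ√2} (h : Tp w) : spin (um w 1) = spin w := by
  unfold spin
  rw [norm_um]
  split_ifs with h1
  swap; · rfl
  obtain ⟨hu, hv⟩ := res_of_norm h1
  have h' := (h.um 1).1
  have hr : (um w 1).re = 3 * w.re + 4 * w.im := by rw [um_one, Zsqrtd.re_mul]; ring
  have hi : (um w 1).im = 2 * w.re + 3 * w.im := by rw [um_one, Zsqrtd.im_mul]; ring
  have hpos := h.1
  generalize (um w 1).im = V at *
  generalize (um w 1).re = U at *
  generalize w.re = u at *
  generalize w.im = v at *
  lift u to ℕ using hpos.le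
  lift U to ℕ using h'.le
  simp only [Int.natAbs_natCast]
  have hUo : Odd U := by rw [Nat.odd_iff]; omega
  have huo : Odd u := by rw [Nat.odd_iff]; omega
  have c4 : jacobiSym 4 U = 1 := by
    have : (4 : ℤ) = 2 ^ 2 := by norm_num
    rw [this]
    apply jacobiSym.sq_one'
    have := hUo.coprime_two_left
    simpa [Int.gcd] using this
  have c4' : jacobiSym 4 u = 1 := by
    have : (4 : ℤ) = 2 ^ 2 := by norm_num
    rw [this]
    apply jacobiSym.sq_one'
    have := huo.coprime_two_left
    simpa [Int.gcd] using this
  have s1 : jacobiSym V U = jacobiSym (-1) U * jacobiSym u U := by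
    have : jacobiSym V U = jacobiSym 4 U * jacobiSym V U := by rw [c4, one_mul]
    rw [this, ← jacobiSym.mul_left, ← jacobiSym.mul_left, jacobiSym.mod_left,
      jacobiSym.mod_left (-1 * u)]
    congr 1
    have : 4 * V = -1 * u + U * 3 := by linarith
    rw [this, Int.add_mul_emod_self_left]
  have s2 : jacobiSym u U = jacobiSym U u := by
    by_cases h4 : u % 4 = 1
    · exact jacobiSym.quadratic_reciprocity_one_mod_four h4 hUo
    · have : U % 4 = 1 := by omega
      exact (jacobiSym.quadratic_reciprocity_one_mod_four this huo).symm
  have s3 : jacobiSym U u = jacobiSym v u := by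
    have : jacobiSym v u = jacobiSym 4 u * jacobiSym v u := by rw [c4', one_mul]
    rw [this, ← jacobiSym.mul_left, jacobiSym.mod_left, jacobiSym.mod_left (4 * v)]
    congr 1
    have : (U : ℤ) = 4 * v + u * 3 := by linarith
    rw [this, Int.add_mul_emod_self_left]
  rw [s1, s2, s3, jacobiSym.at_neg_one hUo]
  have s4 : ZMod.χ₄ (U : ZMod 4) * th U V = th u v := by
    have e : (U : ZMod 4) = ((U : ℤ) : ZMod 4) := by push_cast; rfl
    rw [e, chi4_mod, th, th, chi8_mod v, chi8_mod V]
    have : v % 8 = 1 ∨ v % 8 = 3 ∨ v % 8 = 5 ∨ v % 8 = 7 := by omega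
    rcases hu with hu | hu <;> rcases this with hv | hv | hv | hv
    · have a1 : (U : ℤ) % 4 = 3 := by omega
      have a2 : V % 8 = 5 := by omega
      have a3 : V % 4 = 1 := by omega
      have a4 : v % 4 = 1 := by omega
      have a5 : (u : ℤ) % 4 = 1 := by omega
      rw [a1, a2, a3, a4, a5, hv]; decide
    · have a1 : (U : ℤ) % 4 = 3 := by omega
      have a2 : V % 8 = 3 := by omega
      have a3 : V % 4 = 3 := by omega
      have a4 : v % 4 = 3 := by omega
      have a5 : (u : ℤ) % 4 = 1 := by omega
      rw [a1, a2, a3, a4, a5, hv]; decide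
    · have a1 : (U : ℤ) % 4 = 3 := by omega
      have a2 : V % 8 = 1 := by omega
      have a3 : V % 4 = 1 := by omega
      have a4 : v % 4 = 1 := by omega
      have a5 : (u : ℤ) % 4 = 1 := by omega
      rw [a1, a2, a3, a4, a5, hv]; decide
    · have a1 : (U : ℤ) % 4 = 3 := by omega
      have a2 : V % 8 = 7 := by omega
      have a3 : V % 4 = 3 := by omega
      have a4 : v % 4 = 3 := by omega
      have a5 : (u : ℤ) % 4 = 1 := by omega
      rw [a1, a2, a3, a4, a5, hv]; decide
    · have a1 : (U : ℤ) % 4 = 1 := by omega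
      have a2 : V % 8 = 1 := by omega
      have a3 : V % 4 = 1 := by omega
      have a4 : v % 4 = 1 := by omega
      have a5 : (u : ℤ) % 4 = 3 := by omega
      rw [a1, a2, a3, a4, a5, hv]; decide
    · have a1 : (U : ℤ) % 4 = 1 := by omega
      have a2 : V % 8 = 7 := by omega
      have a3 : V % 4 = 3 := by omega
      have a4 : v % 4 = 3 := by omega
      have a5 : (u : ℤ) % 4 = 3 := by omega
      rw [a1, a2, a3, a4, a5, hv]; decide
    · have a1 : (U : ℤ) % 4 = 1 := by omega
      have a2 : V % 8 = 5 := by omega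
      have a3 : V % 4 = 1 := by omega
      have a4 : v % 4 = 1 := by omega
      have a5 : (u : ℤ) % 4 = 3 := by omega
      rw [a1, a2, a3, a4, a5, hv]; decide
    · have a1 : (U : ℤ) % 4 = 1 := by omega
      have a2 : V % 8 = 3 := by omega
      have a3 : V % 4 = 3 := by omega
      have a4 : v % 4 = 3 := by omega
      have a5 : (u : ℤ) % 4 = 3 := by omega
      rw [a1, a2, a3, a4, a5, hv]; decide
  rw [← s4]; ring

theorem spin_um {w : ℤ√2} (h : Tp w) (k : ℤ) : spin (um w k) = spin w := by
  have hn : ∀ n : ℕ, ∀ w : ℤ√2, Tp w → spin (um w n) = spin w := by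
    intro n
    induction n with
    | zero => intro w _; simp [um_zero]
    | succ n ih =>
      intro w h
      push_cast
      rw [← um_um, spin_um_one (h.um _), ih w h]
  rcases Int.eq_nat_or_neg k with ⟨n, rfl | rfl⟩
  · exact hn n w h
  · rw [← hn n _ (h.um _), um_um, neg_add_cancel, um_zero]

theorem spin_neg {u v : ℤ} (hu : 0 < u) : spin ⟨u, -v⟩ = spin ⟨u, v⟩ := by
  unfold spin
  have e : (⟨u, -v⟩ : ℤ√2).norm = (⟨u, v⟩ : ℤ√2).norm := by rw [norm2, norm2]; ring
  rw [e]
  split_ifs with h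
  swap; · rfl
  obtain ⟨h1, h2⟩ := res_of_norm h
  simp only at h1 h2 ⊢
  lift u to ℕ using hu.le
  simp only [Int.natAbs_natCast]
  have huo : Odd u := by rw [Nat.odd_iff]; omega
  rw [jacobiSym.neg _ huo]
  have e' : (u : ZMod 4) = ((u : ℤ) : ZMod 4) := by push_cast; rfl
  have s4 : ZMod.χ₄ (u : ZMod 4) * th u (-v) = th u v := by
    rw [e', chi4_mod, th, th, chi8_mod v, chi8_mod (-v)]
    have : v % 8 = 1 ∨ v % 8 = 3 ∨ v % 8 = 5 ∨ v % 8 = 7 := by omega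
    have h3 : (u : ℤ) % 4 = 1 ∨ (u : ℤ) % 4 = 3 := by omega
    rcases this with hv | hv | hv | hv
    · have a2 : (-v) % 8 = 7 := by omega
      have a3 : (-v) % 4 = 3 := by omega
      have a4 : v % 4 = 1 := by omega
      rcases h3 with h3 | h3 <;> rw [a2, a3, a4, hv, h3] <;> decide
    · have a2 : (-v) % 8 = 5 := by omega
      have a3 : (-v) % 4 = 1 := by omega
      have a4 : v % 4 = 3 := by omega
      rcases h3 with h3 | h3 <;> rw [a2, a3, a4, hv, h3] <;> decide
    · have a2 : (-v) % 8 = 3 := by omega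
      have a3 : (-v) % 4 = 3 := by omega
      have a4 : v % 4 = 1 := by omega
      rcases h3 with h3 | h3 <;> rw [a2, a3, a4, hv, h3] <;> decide
    · have a2 : (-v) % 8 = 1 := by omega
      have a3 : (-v) % 4 = 1 := by omega
      have a4 : v % 4 = 3 := by omega
      rcases h3 with h3 | h3 <;> rw [a2, a3, a4, hv, h3] <;> decide
  rw [← s4]; ring

theorem spin_pos {u v : ℕ} (h : (⟨u, v⟩ : ℤ√2).norm % 16 = 15) :
    spin ⟨u, v⟩ = jacobiSym (2 * u) v := by
  obtain ⟨h1, h2⟩ := res_of_norm h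
  simp only at h1 h2
  have huo : Odd u := by rw [Nat.odd_iff]; omega
  have hvo : Odd v := by rw [Nat.odd_iff]; omega
  rw [spin, if_pos h]
  simp only [Int.natAbs_natCast]
  rw [jacobiSym.mul_left, jacobiSym.at_two hvo, th]
  push_cast
  by_cases hc : (u : ℤ) % 4 = 3 ∧ (v : ℤ) % 4 = 3
  · rw [if_pos hc, jacobiSym.quadratic_reciprocity_three_mod_four (a := v) (b := u) (by omega) (by omega)]
    ring
  · rw [if_neg hc]
    by_cases hv : v % 4 = 1
    · rw [jacobiSym.quadratic_reciprocity_one_mod_four hv huo]; ring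
    · rw [← jacobiSym.quadratic_reciprocity_one_mod_four (a := u) (b := v) (by omega) hvo]; ring

end SpinDensity

namespace SpinDensity
open Finset
open scoped Classical

theorem prime_reps {p : ℕ} (hp : p.Prime) (h16 : p % 16 = 15) : ∃ s : ℤ, (s = 1 ∨ s = -1) ∧
    (∀ x : ℕ, p ≤ x → ∑ w ∈ SF x with nn w = p, (spin w : ℝ) = 2 * s) ∧
    ((∀ u v : ℕ, 0 < u → 0 < v → (p : ℤ) = u ^ 2 - 2 * v ^ 2 → jacobiSym (2 * u) v = -1) ↔ s = -1) := by
  have hfact : Fact p.Prime := ⟨hp⟩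
  have hp2 : p ≠ 2 := by omega
  have hz : ∃ z : ℤ√2, IsS z ∧ nn z = p := by
    obtain ⟨r, hr⟩ := (ZMod.exists_sq_eq_two_iff hp2).2 (by omega : p % 8 = 1 ∨ p % 8 = 7)
    obtain ⟨z, h1, h2, -⟩ := exists_prime_div (w := ⟨(r.val : ℤ), 1⟩) (p := p)
      (by exact isCoprime_one_right) hp hp2 (by
        rw [norm2, ← ZMod.intCast_zmod_eq_zero_iff_dvd]
        push_cast
        rw [ZMod.natCast_zmod_val, hr]; ring)
    exact ⟨z, h1, h2⟩
  obtain ⟨z, hzS, hzp⟩ := hz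
  have hzn : z.norm = p := by rw [← hzS.tp.nn_eq, hzp]
  have hz16 : z.norm % 16 = 15 := by rw [hzn]; omega
  obtain ⟨r1, r2⟩ := res_of_norm hz16
  have hre := hzS.bound.1
  let z' : ℤ√2 := ⟨z.re, -z.im⟩
  have hz'S : IsS z' := by
    refine ⟨?_, hzS.2.1, ?_⟩
    · simpa [z'] using hzS.1
    · exact hzS.2.2.neg_right
  have hz'n : z'.norm = p := by rw [← hzn, norm2, norm2]; simp [z']
  have hz'p : nn z' = p := by rw [nn, hz'n]; simp
  have hne : z ≠ z' := by
    intro h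
    have := congrArg Zsqrtd.im h
    simp only [z'] at this
    omega
  have hsp : spin z' = spin z := spin_neg hre
  have hs1 : spin z = 1 ∨ spin z = -1 := by
    have h1 : spin z * spin z = 1 := by
      rw [spin, if_pos hz16]
      have h2 : jacobiSym z.im z.re.natAbs * jacobiSym z.im z.re.natAbs = 1 := by
        rw [← sq]
        apply jacobiSym.sq_one
        have := Int.isCoprime_iff_gcd_eq_one.1 hzS.2.2
        rw [Int.gcd_comm] at this
        simpa only [Int.gcd, Int.natAbs_natCast] using this
      calc _ = (jacobiSym z.im z.re.natAbs * jacobiSym z.im z.re.natAbs) *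
            (th z.re z.im * th z.re z.im) := by ring
        _ = 1 := by rw [h2, th_sq r2]; norm_num
    exact mul_self_eq_one_iff.1 h1
  have hset : ∀ x : ℕ, p ≤ x → (SF x).filter (fun w => nn w = p) = {z, z'} := by
    intro x hx
    symm
    apply Finset.eq_of_subset_of_card_le
    · intro w hw
      rw [Finset.mem_insert, Finset.mem_singleton] at hw
      rw [Finset.mem_filter, mem_SF']
      rcases hw with rfl | rfl
      · exact ⟨⟨hzS, by omega⟩, hzp⟩
      · exact ⟨⟨hz'S, by omega⟩, hz'p⟩
    · rw [Finset.card_pair hne]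
      have := card_norm_le ((SF x).filter (fun w => nn w = p)) p hp.pos (by
        intro w hw
        rw [Finset.mem_filter, mem_SF'] at hw
        exact ⟨hw.1.1, hw.2⟩)
      rw [hp.divisors, Finset.card_pair hp.one_lt.ne] at this
      exact this
  refine ⟨spin z, hs1, ?_, ?_⟩
  · intro x hx
    rw [hset x hx, Finset.sum_pair hne, hsp]; ring
  · have hall : ∀ u v : ℕ, 0 < u → 0 < v → (p : ℤ) = u ^ 2 - 2 * v ^ 2 →
        jacobiSym (2 * u) v = spin z := by
      intro u v hu hv h
      have hn : (⟨u, v⟩ : ℤ√2).norm = p := by rw [norm2, h]; ring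
      rw [← spin_pos (by rw [hn]; omega)]
      have htp : Tp (⟨u, v⟩ : ℤ√2) := ⟨by simpa using hu, by rw [hn]; exact_mod_cast hp.pos⟩
      have hcop : IsCoprime (u : ℤ) (v : ℤ) := by
        apply isCoprime_of_no_prime (by positivity)
        intro q hq h1 h2
        have : q * q ∣ (p : ℤ) := by
          rw [h, sq, sq]
          exact dvd_sub (mul_dvd_mul h1 h1) ((mul_dvd_mul h2 h2).mul_left _)
        have h4 : Squarefree (p : ℤ) := (Nat.prime_iff_prime_int.1 hp).irreducible.squarefree
        exact hq.not_isUnit (h4 _ this)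
      obtain ⟨k, hk⟩ := exists_red htp (by
        rw [hn]; exact_mod_cast hp.odd_of_ne_two hp2) hcop
      rw [← spin_um htp k]
      have hmem : um ⟨u, v⟩ k ∈ (SF p).filter (fun w => nn w = p) := by
        rw [Finset.mem_filter, mem_SF', nn_um]
        have : nn ⟨u, v⟩ = p := by rw [nn, hn]; simp
        exact ⟨⟨hk, this.le⟩, this⟩
      rw [hset p le_rfl, Finset.mem_insert, Finset.mem_singleton] at hmem
      rcases hmem with h | h <;> rw [h]
      exact hsp
    constructor
    · intro h
      have him : z.im.natAbs ≠ 0 := by omega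
      have e : (p : ℤ) = (z.re.natAbs : ℤ) ^ 2 - 2 * (z.im.natAbs : ℤ) ^ 2 := by
        rw [← hzn, norm2]; simp [sq_abs]; ring
      rw [← hall z.re.natAbs z.im.natAbs (by omega) (by omega) e]
      exact h _ _ (by omega) (by omega) e
    · intro h u v h1 h2 h3
      rw [hall u v h1 h2 h3, h]

end SpinDensity

namespace SpinDensity
open Finset
open scoped Classical

noncomputable def rexp (w : ℤ√2) : ℤ := if h : ∃ k : ℤ, IsS (um w k) then h.choose else 0

theorem rexp_spec {w : ℤ√2} (h : ∃ k : ℤ, IsS (um w k)) : IsS (um w (rexp w)) := by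
  rw [rexp, dif_pos h]; exact h.choose_spec

theorem rexp_mul {z t : ℤ√2} (hz : IsS z) (ht : IsS t) (hc : IsCoprime (z * t).re (z * t).im) :
    IsS (um (z * t) (rexp (z * t))) := by
  apply rexp_spec
  apply exists_red (hz.tp.mul ht.tp) _ hc
  rw [Zsqrtd.norm_mul]
  exact (odd_norm hz.2.1).mul (odd_norm ht.2.1)

theorem bij (x : ℕ) (G : ℕ → ℕ → ℝ) :
    ∑ w ∈ SF x, (spin w : ℝ) * ∑ p ∈ (nn w).primeFactors, G p (nn w / p) =
    ∑ z ∈ SF x with (nn z).Prime, ∑ t ∈ SF x with nn z * nn t ≤ x,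
      (spin (z * t) : ℝ) * G (nn z) (nn t) := by
  simp_rw [Finset.mul_sum]
  rw [Finset.sum_sigma', Finset.sum_sigma']
  symm
  rw [← Finset.sum_filter_of_ne (p := fun q : (_ : ℤ√2) × ℤ√2 =>
    IsCoprime (q.1 * q.2).re (q.1 * q.2).im)]
  swap
  · rintro ⟨z, t⟩ _ h
    by_contra hc
    apply h
    simp only
    rw [spin_zero hc]; simp
  refine Finset.sum_bij (fun q _ => ⟨um (q.1 * q.2) (rexp (q.1 * q.2)), nn q.1⟩) ?_ ?_ ?_ ?_
  · rintro ⟨z, t⟩ h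
    simp only [Finset.mem_filter, Finset.mem_sigma, mem_SF'] at h ⊢
    obtain ⟨⟨⟨⟨h1, h2⟩, h3⟩, ⟨⟨h4, h5⟩, h6⟩⟩, h7⟩ := h
    refine ⟨⟨rexp_mul h1 h4 h7, ?_⟩, ?_⟩
    · rw [nn_um, nn_mul]; exact h6
    · rw [nn_um, nn_mul, Nat.mem_primeFactors]
      exact ⟨h3, Dvd.intro _ rfl, Nat.mul_ne_zero h1.tp.nn_pos.ne' h4.tp.nn_pos.ne'⟩
  · rintro ⟨z, t⟩ h ⟨z', t'⟩ h' heq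
    simp only [Finset.mem_filter, Finset.mem_sigma, mem_SF'] at h h'
    obtain ⟨⟨⟨⟨h1, h2⟩, h3⟩, ⟨⟨h4, h5⟩, h6⟩⟩, h7⟩ := h
    obtain ⟨⟨⟨⟨h1', h2'⟩, h3'⟩, ⟨⟨h4', h5'⟩, h6'⟩⟩, h7'⟩ := h'
    simp only [Sigma.mk.injEq, heq_eq_eq] at heq
    obtain ⟨e1, e2⟩ := heq
    obtain ⟨r1, r2⟩ := factor_unique h1 h4 h1' h4' h3 rfl e2.symm (rexp_mul h1 h4 h7) e1
    rw [r1, r2]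
  · rintro ⟨w, p⟩ h
    simp only [Finset.mem_sigma, mem_SF', Nat.mem_primeFactors] at h
    obtain ⟨⟨h1, h2⟩, h3, h4, h5⟩ := h
    obtain ⟨z, t, k, hz, ht, hzp, hk⟩ := exists_factor h1 h3 h4
    have hcop : IsCoprime (z * t).re (z * t).im := by
      apply Zsqrtd.isCoprime_of_dvd_isCoprime h1.2.2
      rw [← hk]; exact dvd_um _ _
    have hnn : nn z * nn t = nn w := by rw [← hk, nn_um, nn_mul]
    have hpz := hz.tp.nn_pos
    have hpt := ht.tp.nn_pos
    refine ⟨⟨z, t⟩, ?_, ?_⟩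
    · simp only [Finset.mem_filter, Finset.mem_sigma, mem_SF']
      refine ⟨⟨⟨⟨hz, ?_⟩, by rw [hzp]; exact h3⟩, ⟨ht, ?_⟩, by omega⟩, hcop⟩
      · nlinarith
      · nlinarith
    · simp only [Sigma.mk.injEq, heq_eq_eq]
      refine ⟨?_, hzp⟩
      have h7 := rexp_mul hz ht hcop
      have e : um (z * t) (rexp (z * t)) = um w (-k + rexp (z * t)) := by
        rw [← um_um, um_inj hk]
      rw [e] at h7 ⊢
      exact um_unique h1 h7
  · rintro ⟨z, t⟩ h
    simp only [Finset.mem_filter, Finset.mem_sigma, mem_SF'] at h ⊢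
    obtain ⟨⟨⟨⟨h1, h2⟩, h3⟩, ⟨⟨h4, h5⟩, h6⟩⟩, h7⟩ := h
    rw [spin_um (h1.tp.mul h4.tp), nn_um, nn_mul, Nat.mul_div_cancel_left _ h1.tp.nn_pos]

end SpinDensity

namespace SpinDensity
open Finset
open scoped Classical

theorem jac_congr {a b : ℤ} {n : ℕ} (h : (n : ℤ) ∣ a - b) : jacobiSym a n = jacobiSym b n := by
  rw [jacobiSym.mod_left a, jacobiSym.mod_left b]
  congr 1
  exact (Int.emod_emod_of_dvd _ dvd_rfl).symm.trans (by
    rw [Int.emod_emod_of_dvd _ dvd_rfl]; exact Int.ModEq.symm (Int.modEq_iff_dvd.2 h))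

theorem jac_sq {a : ℤ} {n : ℕ} (h : IsCoprime a (n : ℤ)) : jacobiSym a n * jacobiSym a n = 1 := by
  rw [← sq]; apply jacobiSym.sq_one
  exact Int.isCoprime_iff_gcd_eq_one.1 h

theorem jacobi_core (a d S : ℤ) (β c u p : ℕ) (hβ : Odd β) (hc : Odd c) (hu : Odd u)
    (hue : (u : ℤ) = a * c + 2 * (S * β) * d) (hp : (p : ℤ) = c * c - 2 * d * d)
    (hcd : IsCoprime (c : ℤ) d) (hS : IsCoprime S (c : ℤ)) :
    jacobiSym (a * d + S * β * c) u = jacobiSym a β * jacobiSym d c * jacobiSym 2 c * jacobiSym S c *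
      jacobiSym S u * qrSign c β * qrSign u c * qrSign u β * jacobiSym p u := by
  obtain ⟨g, β', c', hg, hcop, rfl, rfl⟩ := Nat.exists_coprime' (m := β) (n := c)
    (Nat.gcd_pos_of_pos_left _ hβ.pos)
  have hβ' : Odd β' := (Nat.odd_mul.1 hβ).1
  have hgo : Odd g := (Nat.odd_mul.1 hβ).2
  have hc' : Odd c' := (Nat.odd_mul.1 hc).1
  have hgu : g ∣ u := by
    have : (g : ℤ) ∣ u := by
      rw [hue]; push_cast
      refine ⟨a * c' + 2 * (S * β') * d, by ring⟩
    exact_mod_cast this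
  obtain ⟨u', rfl⟩ := hgu
  have hu' : Odd u' := (Nat.odd_mul.1 hu).2
  have hg0 : (g : ℤ) ≠ 0 := by exact_mod_cast hg.ne'
  have hue' : (u' : ℤ) = a * c' + 2 * (S * β') * d := by
    apply mul_left_cancel₀ hg0
    push_cast at hue
    rw [hue]; ring
  push_cast at hcd hS hp
  have n1 : NeZero g := ⟨hg.ne'⟩
  have n2 : NeZero β' := ⟨hβ'.pos.ne'⟩
  have n3 : NeZero c' := ⟨hc'.pos.ne'⟩
  have n4 : NeZero u' := ⟨hu'.pos.ne'⟩
  have cgd : IsCoprime (d : ℤ) g := hcd.symm.of_mul_right_right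
  have cSg : IsCoprime S (g : ℤ) := hS.of_mul_right_right
  have cSc' : IsCoprime S (c' : ℤ) := hS.of_mul_right_left
  have ccd : IsCoprime (c' : ℤ) d := hcd.of_mul_left_left
  have ccβ : IsCoprime (c' : ℤ) (β' : ℤ) := (Nat.isCoprime_iff_coprime.2 hcop).symm
  have cc2 : IsCoprime (c' : ℤ) 2 := by
    have := Nat.isCoprime_iff_coprime.2 hc'.coprime_two_right
    exact_mod_cast this
  have ccu : IsCoprime (c' : ℤ) (u' : ℤ) := by
    rw [hue', add_comm]
    have : IsCoprime (c' : ℤ) (2 * (S * β') * d) :=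
      (cc2.mul_right (cSc'.symm.mul_right ccβ)).mul_right ccd
    exact this.add_mul_right_right a
  have c2g : IsCoprime (2 : ℤ) (g : ℤ) := by
    have := Nat.isCoprime_iff_coprime.2 hgo.coprime_two_left
    exact_mod_cast this
  push_cast
  set v : ℤ := a * d + S * (β' * g) * (c' * g) with hv
  have E2 : jacobiSym v g = jacobiSym a g * jacobiSym d g := by
    rw [← jacobiSym.mul_left]
    exact jac_congr ⟨S * β' * (c' * g), by rw [hv]; ring⟩
  have E3 : jacobiSym c' u' * jacobiSym v u' = jacobiSym S u' * jacobiSym β' u' * jacobiSym p u' := by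
    rw [← jacobiSym.mul_left, ← jacobiSym.mul_left, ← jacobiSym.mul_left]
    refine jac_congr ⟨d, ?_⟩
    rw [hue', hp, hv]; ring
  have E4 : jacobiSym β' u' = qrSign u' β' * (jacobiSym a β' * jacobiSym c' β') := by
    rw [jacobiSym.quadratic_reciprocity' hβ' hu', ← jacobiSym.mul_left]
    congr 1
    refine jac_congr ⟨2 * S * d, ?_⟩
    rw [hue']; ring
  have E5 : jacobiSym c' u' = qrSign u' c' * (jacobiSym 2 c' * (jacobiSym S c' * jacobiSym β' c') *
      jacobiSym d c') := by
    rw [jacobiSym.quadratic_reciprocity' hc' hu', ← jacobiSym.mul_left, ← jacobiSym.mul_left,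
      ← jacobiSym.mul_left]
    congr 1
    refine jac_congr ⟨a, ?_⟩
    rw [hue']; ring
  have E6 : jacobiSym β' c' = qrSign c' β' * jacobiSym c' β' :=
    jacobiSym.quadratic_reciprocity' hβ' hc'
  have E7 : jacobiSym p g = qrSign g g * jacobiSym 2 g := by
    have h1 : jacobiSym p g = jacobiSym (-1) g * jacobiSym 2 g * (jacobiSym d g * jacobiSym d g) := by
      rw [← jacobiSym.mul_left, ← jacobiSym.mul_left, ← jacobiSym.mul_left]
      refine jac_congr ⟨c' * (c' * g), ?_⟩
      rw [hp]; ring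
    rw [h1, jac_sq cgd, mul_one]
    congr 1
    rw [qrSign, jacobiSym.at_neg_one hgo]
    rcases Nat.odd_mod_four_iff.1 (Nat.odd_iff.1 hgo) with h | h
    · rw [ZMod.χ₄_nat_one_mod_four h, jacobiSym.one_left]
    · rw [ZMod.χ₄_nat_three_mod_four h, jacobiSym.at_neg_one hgo, ZMod.χ₄_nat_three_mod_four h]
  have Q1 := jac_sq ccu
  have Q2 := jac_sq ccβ
  have Q3 := jac_sq cSg
  have Q4 := jac_sq c2g
  have R1 := qrSign.sq_eq_one hgo hgo
  have R2 := qrSign.sq_eq_one hgo hβ'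
  have R3 := qrSign.sq_eq_one hgo hc'
  have R4 := qrSign.sq_eq_one hgo hu'
  have e1 : jacobiSym v u' = jacobiSym c' u' * (jacobiSym S u' * jacobiSym β' u' * jacobiSym p u') := by
    rw [← E3, ← mul_assoc, Q1, one_mul]
  rw [jacobiSym.mul_right, E2, e1, E4, E5, E6]
  simp only [jacobiSym.mul_right, qrSign.mul_left, qrSign.mul_right, E7]
  rw [qrSign.symm hc' hgo, qrSign.symm hu' hgo]
  generalize jacobiSym (c' : ℤ) β' = x at *
  generalize jacobiSym S g = y at *
  generalize jacobiSym 2 g = y2 at *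
  generalize qrSign g g = r1 at *
  generalize qrSign g β' = r2 at *
  generalize qrSign g c' = r3 at *
  generalize qrSign g u' = r4 at *
  have T1 : r1 ^ 4 = 1 := by rw [show r1 ^ 4 = (r1 ^ 2) ^ 2 by ring, R1]; norm_num
  have Q2' : x ^ 2 = 1 := by rw [sq]; exact Q2
  have Q3' : y ^ 2 = 1 := by rw [sq]; exact Q3
  have Q4' : y2 ^ 2 = 1 := by rw [sq]; exact Q4
  generalize jacobiSym a g = a1 at *
  generalize jacobiSym d g = a2 at *
  generalize jacobiSym 2 c' = a3
  generalize jacobiSym S c' = a4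
  generalize jacobiSym d c' = a5
  generalize jacobiSym S u' = a6
  generalize jacobiSym a β' = a7
  generalize jacobiSym p u' = a8
  generalize qrSign u' c' = a9
  generalize qrSign c' β' = a10
  generalize qrSign u' β' = a11
  trans (a1 * a2 * a3 * a4 * a5 * a6 * a7 * a8 * a9 * a10 * a11) * x ^ 2
  · ring
  trans (a1 * a2 * a3 * a4 * a5 * a6 * a7 * a8 * a9 * a10 * a11) *
    (y ^ 2 * y2 ^ 2 * r1 ^ 4 * r2 ^ 2 * r3 ^ 2 * r4 ^ 2)
  · rw [Q2', Q3', Q4', T1, R2, R3, R4]; ring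
  · ring

end SpinDensity

namespace SpinDensity
open Finset
open scoped Classical

noncomputable def chiHom (p : ℕ) (R : ℤ) (h : (p : ℤ) ∣ R * R - 2) : ℤ√2 →* ℝ where
  toFun w := (jacobiSym (w.re + w.im * R) p : ℤ)
  map_one' := by simp
  map_mul' w w' := by
    rw [← Int.cast_mul, ← jacobiSym.mul_left]
    congr 1
    apply jac_congr
    obtain ⟨t, ht⟩ := h
    refine ⟨-(w.im * w'.im * t), ?_⟩
    rw [Zsqrtd.re_mul, Zsqrtd.im_mul]
    linear_combination (-(w.im * w'.im)) * ht

noncomputable def chi (z : ℤ√2) : ℤ√2 →* ℝ :=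
  if h : ∃ R : ℤ, (nn z : ℤ) ∣ R * R - 2 ∧ (nn z : ℤ) ∣ R * z.re - 2 * z.im then
    chiHom (nn z) h.choose h.choose_spec.1 else 1

theorem chi_spec {z : ℤ√2} (hz : IsS z) (hp : (nn z).Prime) : ∃ R : ℤ, (nn z : ℤ) ∣ R * R - 2 ∧
    (nn z : ℤ) ∣ R * z.re - 2 * z.im ∧
    ∀ w : ℤ√2, chi z w = (jacobiSym (w.re + w.im * R) (nn z) : ℤ) := by
  have h : ∃ R : ℤ, (nn z : ℤ) ∣ R * R - 2 ∧ (nn z : ℤ) ∣ R * z.re - 2 * z.im := by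
    have hpp : Prime (nn z : ℤ) := Nat.prime_iff_prime_int.1 hp
    have hn : (nn z : ℤ) = z.norm := hz.tp.nn_eq
    have hc : ¬ (nn z : ℤ) ∣ z.re := prime_not_dvd_re hz.2.2 hpp
      (odd_prime_not_dvd_two hpp (odd_norm hz.2.1) hn.dvd) hn.dvd
    have hcop : IsCoprime (nn z : ℤ) z.re := (hpp.coprime_iff_not_dvd).2 hc
    obtain ⟨s, t, hst⟩ := hcop
    have h1 : (nn z : ℤ) ∣ (2 * z.im * t) * z.re - 2 * z.im :=
      ⟨-(2 * z.im * s), by linear_combination (2 * z.im) * hst⟩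
    refine ⟨2 * z.im * t, ?_, h1⟩
    have h2 : (nn z : ℤ) ∣ (z.re * z.re) * ((2 * z.im * t) * (2 * z.im * t) - 2) := by
      obtain ⟨y, hy⟩ := h1
      have e : (z.re * z.re) * ((2 * z.im * t) * (2 * z.im * t) - 2) =
        ((2 * z.im * t) * z.re - 2 * z.im) * ((2 * z.im * t) * z.re + 2 * z.im) - 2 * (nn z : ℤ) := by
        rw [hn, norm2]; ring
      rw [e, hy]
      exact dvd_sub ((Dvd.intro _ rfl).mul_right _) (Dvd.intro_left _ rfl)
    rcases hpp.dvd_or_dvd h2 with h3 | h3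
    · exact absurd ((hpp.dvd_or_dvd h3).elim id id) hc
    · exact h3
  refine ⟨h.choose, h.choose_spec.1, h.choose_spec.2, fun w => ?_⟩
  rw [chi, dif_pos h]; rfl

theorem abs_chi (z w : ℤ√2) : |chi z w| ≤ 1 := by
  unfold chi
  split_ifs with h
  · have := abs_jacobi (w.re + w.im * h.choose) (nn z)
    have h2 : |((jacobiSym (w.re + w.im * h.choose) (nn z) : ℤ) : ℝ)| ≤ 1 := by exact_mod_cast this
    exact h2
  · simp

/-- Odd part. -/
def bet (b : ℤ) : ℕ := ordCompl[2] b.natAbs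

def cw (w : ℤ√2) : ℤ × ℤ × ℤ × ℕ :=
  (w.re % 16, w.im % 16, w.im.sign * 2 ^ (w.im.natAbs.factorization 2 % 2), bet w.im % 4)

noncomputable def fw (w : ℤ√2) : ℝ := if w.im = 0 then 1 else (jacobiSym w.re (bet w.im) : ℤ)

def kapZ (z : ℤ√2) (t : ℤ × ℤ × ℤ × ℕ) : ℤ :=
  if t.2.2.1 = 0 then spin z else
  if (z.norm * (t.1 * t.1 - 2 * t.2.1 * t.2.1)) % 16 = 15 then
    jacobiSym z.im z.re.natAbs * (jacobiSym 2 z.re.natAbs * (jacobiSym t.2.2.1 z.re.natAbs *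
    (jacobiSym t.2.2.1 ((z.re * t.1 + 2 * z.im * t.2.1) % 16).toNat *
    (qrSign t.2.2.2 z.re.natAbs *
    (qrSign ((z.re * t.1 + 2 * z.im * t.2.1) % 16).toNat z.re.natAbs *
    (qrSign t.2.2.2 ((z.re * t.1 + 2 * z.im * t.2.1) % 16).toNat *
    (qrSign ((z.re * t.1 + 2 * z.im * t.2.1) % 16).toNat (nn z) *
    (jacobiSym z.re (nn z) * th (z.re * t.1 + 2 * z.im * t.2.1) (z.re * t.2.1 + z.im * t.1)))))))))
  else 0

noncomputable def kap (z : ℤ√2) (t : ℤ × ℤ × ℤ × ℕ) : ℝ := kapZ z t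

theorem abs_mul_le_one {a b : ℤ} (ha : |a| ≤ 1) (hb : |b| ≤ 1) : |a * b| ≤ 1 := by
  rw [abs_mul]; exact mul_le_one₀ ha (abs_nonneg _) hb

theorem abs_kap (z : ℤ√2) (t) : |kap z t| ≤ 1 := by
  have : |kapZ z t| ≤ 1 := by
    unfold kapZ
    split_ifs
    · exact abs_spin z
    · have hq : ∀ m n : ℕ, |qrSign m n| ≤ 1 := fun m n => abs_jacobi _ _
      exact abs_mul_le_one (abs_jacobi _ _) (abs_mul_le_one (abs_jacobi _ _)
        (abs_mul_le_one (abs_jacobi _ _) (abs_mul_le_one (abs_jacobi _ _)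
        (abs_mul_le_one (hq _ _) (abs_mul_le_one (hq _ _) (abs_mul_le_one (hq _ _)
        (abs_mul_le_one (hq _ _) (abs_mul_le_one (abs_jacobi _ _) (abs_th _ _)))))))))
    · simp
  rw [kap]; exact_mod_cast this

theorem abs_fw (w : ℤ√2) : |fw w| ≤ 1 := by
  unfold fw
  split_ifs
  · simp
  · have := abs_jacobi w.re (bet w.im)
    exact_mod_cast this

noncomputable def clsT : Finset (ℤ × ℤ × ℤ × ℕ) := Finset.Icc 0 15 ×ˢ Finset.Icc 0 15 ×ˢ Finset.Icc (-2) 2 ×ˢ range 4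

theorem cw_mem (w : ℤ√2) : cw w ∈ clsT := by
  simp only [cw, clsT, Finset.mem_product, Finset.mem_Icc, Finset.mem_range]
  refine ⟨by omega, by omega, ?_, by omega⟩
  have h2 : w.im.natAbs.factorization 2 % 2 = 0 ∨ w.im.natAbs.factorization 2 % 2 = 1 := by omega
  rcases Int.sign_trichotomy w.im with h | h | h <;> rcases h2 with h2 | h2 <;> rw [h, h2] <;> norm_num

theorem th_congr {u u' v v' : ℤ} (hu : u % 4 = u' % 4) (hv : v % 8 = v' % 8) : th u v = th u' v' := by
  have : v % 4 = v' % 4 := by omega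
  rw [th, th, chi8_mod v, chi8_mod v', hu, hv, this]

theorem qr_left {m m' n : ℕ} (h : m % 4 = m' % 4) : qrSign m n = qrSign m' n := by
  have : (m : ZMod 4) = (m' : ZMod 4) := (ZMod.natCast_eq_natCast_iff' _ _ _).2 h
  rw [qrSign, qrSign, this]

theorem jac_S {s : ℤ} {k n : ℕ} (hn : Odd n) : jacobiSym (s * 2 ^ k) n = jacobiSym (s * 2 ^ (k % 2)) n := by
  have h2 : jacobiSym 2 n ^ 2 = 1 := by
    apply jacobiSym.sq_one
    have := hn.coprime_two_left
    simpa [Int.gcd] using this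
  rw [jacobiSym.mul_left, jacobiSym.mul_left, jacobiSym.pow_left, jacobiSym.pow_left]
  congr 1
  conv_lhs => rw [← Nat.mod_add_div k 2]
  rw [pow_add, pow_mul, h2, one_pow, mul_one]

theorem jac_16 {S : ℤ} {n m : ℕ} (hn : Odd n) (hm : Odd m) (h : n % 16 = m % 16)
    (hS : 4 * S.natAbs ∣ 16) : jacobiSym S n = jacobiSym S m := by
  rw [jacobiSym.mod_right S hn, jacobiSym.mod_right S hm]
  congr 1
  rw [← Nat.mod_mod_of_dvd n hS, h, Nat.mod_mod_of_dvd m hS]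

theorem spin_factor {z w : ℤ√2} (hz : IsS z) (hw : IsS w) (hp : (nn z).Prime) :
    (spin (z * w) : ℝ) = fw w * kap z (cw w) * chi z w := by
  by_cases hb : w.im = 0
  · have ha : w = 1 := by
      have h1 := hw.2.2
      rw [hb, isCoprime_zero_right, Int.isUnit_iff] at h1
      have h2 := hw.bound.1
      apply Zsqrtd.ext
      · rw [Zsqrtd.re_one]; omega
      · rw [Zsqrtd.im_one]; exact hb
    subst ha
    simp [fw, kap, kapZ, cw]
  obtain ⟨R, hR1, hR2, hR3⟩ := chi_spec hz hp
  rw [hR3, fw, if_neg hb, kap, ← Int.cast_mul, ← Int.cast_mul]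
  congr 1
  have hS0 : (cw w).2.2.1 ≠ 0 := by
    simp only [cw]
    exact mul_ne_zero (by simpa [Int.sign_eq_zero_iff_zero] using hb) (by positivity)
  rw [kapZ, if_neg hS0]
  have hcond : (z * w).norm % 16 = (z.norm * ((cw w).1 * (cw w).1 - 2 * (cw w).2.1 * (cw w).2.1)) % 16 := by
    rw [Zsqrtd.norm_mul, norm2 w]
    simp only [cw]
    apply Int.ModEq.mul_left
    have h1 : w.re % 16 ≡ w.re [ZMOD 16] := Int.mod_modEq _ _
    have h2 : w.im % 16 ≡ w.im [ZMOD 16] := Int.mod_modEq _ _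
    exact ((h1.mul h1).sub ((h2.mul_left 2).mul h2)).symm
  rw [spin, hcond]
  split_ifs with hc
  swap; · simp
  rw [← hcond] at hc
  have htp := hz.tp.mul hw.tp
  have hupos := htp.1
  have hures := (res_of_norm hc).1
  have hre : (z * w).re = w.re * z.re + 2 * w.im * z.im := by rw [Zsqrtd.re_mul]; ring
  have him : (z * w).im = w.re * z.im + w.im * z.re := by rw [Zsqrtd.im_mul]; ring
  have hzre := hz.bound.1
  obtain ⟨c, hcc⟩ : ∃ c : ℕ, z.re = c := ⟨z.re.natAbs, by omega⟩
  obtain ⟨u, huu⟩ : ∃ u : ℕ, (z * w).re = u := ⟨(z * w).re.natAbs, by omega⟩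
  have hco : Odd c := by have := hz.2.1; rw [hcc] at this; exact_mod_cast this
  have huo : Odd u := by rw [Nat.odd_iff]; omega
  have hpo : Odd (nn z) := by
    have := odd_norm hz.2.1
    rw [← hz.tp.nn_eq] at this; exact_mod_cast this
  have hn0 : w.im.natAbs ≠ 0 := by omega
  have hbo : Odd (bet w.im) := by
    rw [Nat.odd_iff]
    have := Nat.not_dvd_ordCompl Nat.prime_two hn0
    rw [bet]; omega
  set k := w.im.natAbs.factorization 2 with hk
  have hbeq : w.im = (w.im.sign * 2 ^ k) * (bet w.im : ℕ) := by
    have h1 := Nat.ordProj_mul_ordCompl_eq_self w.im.natAbs 2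
    conv_lhs => rw [← Int.sign_mul_natAbs w.im]
    rw [mul_assoc]
    congr 1
    rw [bet, hk]
    exact_mod_cast h1.symm
  set S : ℤ := w.im.sign * 2 ^ k with hS
  set S' : ℤ := w.im.sign * 2 ^ (k % 2) with hS'
  have hsgn : w.im.sign = 1 ∨ w.im.sign = -1 := by
    rcases Int.sign_trichotomy w.im with h | h | h
    · exact Or.inl h
    · exact absurd (Int.sign_eq_zero_iff_zero.1 h) hb
    · exact Or.inr h
  have hScop : IsCoprime S (c : ℤ) := by
    apply IsCoprime.mul_left
    · rcases hsgn with h | h <;> rw [h]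
      · exact isCoprime_one_left
      · exact isCoprime_one_left.neg_left
    · apply IsCoprime.pow_left
      have := Nat.isCoprime_iff_coprime.2 hco.coprime_two_left
      exact_mod_cast this
  have hS16 : 4 * S'.natAbs ∣ 16 := by
    have : k % 2 = 0 ∨ k % 2 = 1 := by omega
    rcases hsgn with h | h <;> rcases this with h' | h' <;> rw [hS', h, h'] <;> decide
  have core := jacobi_core w.re z.im S (bet w.im) c u (nn z) hbo hco huo
    (by rw [← huu, hre, ← hcc, ← hbeq])
    (by rw [hz.tp.nn_eq, norm2, hcc]) (by rw [← hcc]; exact hz.2.2) hScop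
  rw [← hbeq, ← hcc, ← him] at core
  -- residues of u
  have hmod : (z.re * (w.re % 16) + 2 * z.im * (w.im % 16)) % 16 = (u : ℤ) % 16 := by
    rw [← huu, Zsqrtd.re_mul]
    have h1 : w.re % 16 ≡ w.re [ZMOD 16] := Int.mod_modEq _ _
    have h2 : w.im % 16 ≡ w.im [ZMOD 16] := Int.mod_modEq _ _
    exact (h1.mul_left _).add (h2.mul_left _)
  have hmodv : (z.re * (w.im % 16) + z.im * (w.re % 16)) % 16 = (z * w).im % 16 := by
    rw [Zsqrtd.im_mul]
    have h1 : w.re % 16 ≡ w.re [ZMOD 16] := Int.mod_modEq _ _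
    have h2 : w.im % 16 ≡ w.im [ZMOD 16] := Int.mod_modEq _ _
    exact (h2.mul_left _).add (h1.mul_left _)
  have hut : ((z.re * (w.re % 16) + 2 * z.im * (w.im % 16)) % 16).toNat = u % 16 := by
    rw [hmod]; omega
  have hu16 : Odd (u % 16) := by rw [Nat.odd_iff] at *; omega
  have hb4 : Odd (bet w.im % 4) := by rw [Nat.odd_iff] at *; omega
  simp only [cw]
  rw [hut, hcc]
  simp only [Int.natAbs_natCast]
  rw [← hS', huu, Int.natAbs_natCast, core, jac_S hco, jac_S huo, ← hS',
    jac_16 (S := S') huo hu16 (by omega) hS16]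
  have q1 : qrSign c (bet w.im) = qrSign (bet w.im % 4) c := by
    rw [qrSign.symm hco hbo]; exact qr_left (by omega)
  have q2 : qrSign u c = qrSign (u % 16) c := qr_left (by omega)
  have q3 : qrSign u (bet w.im) = qrSign (bet w.im % 4) (u % 16) := by
    rw [qr_left (m' := u % 16) (by omega), qrSign.symm hu16 hbo]; exact qr_left (by omega)
  have q4 : jacobiSym (nn z : ℤ) u = qrSign (u % 16) (nn z) *
      (jacobiSym c (nn z) * jacobiSym (w.re + w.im * R) (nn z)) := by
    rw [jacobiSym.quadratic_reciprocity' hpo huo, qr_left (m' := u % 16) (by omega),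
      ← jacobiSym.mul_left]
    congr 1
    apply jac_congr
    obtain ⟨y, hy⟩ := hR2
    refine ⟨-(w.im * y), ?_⟩
    rw [← huu, hre, ← hcc]
    linear_combination (-w.im) * hy
  have q5 : th u (z * w).im = th (c * (w.re % 16) + 2 * z.im * (w.im % 16))
      (c * (w.im % 16) + z.im * (w.re % 16)) := by
    rw [hcc] at hmod hmodv
    apply th_congr <;> omega
  rw [q1, q2, q3, q4, q5]
  ring

end SpinDensity

namespace SpinDensity
open Finset
open scoped Classical

theorem exists_jac_neg {n : ℕ} (hn : Odd n) (hs : ¬ IsSquare n) :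
    ∃ a : ℤ, IsCoprime a (n : ℤ) ∧ jacobiSym a n = -1 := by
  have hn0 : n ≠ 0 := hn.pos.ne'
  obtain ⟨p, hp, hpo⟩ : ∃ p, p.Prime ∧ Odd (n.factorization p) := by
    by_contra hc
    push Not at hc
    apply hs
    refine ⟨n.primeFactors.prod fun p => p ^ (n.factorization p / 2), ?_⟩
    conv_lhs => rw [← Nat.prod_factorization_pow_eq_self hn0]
    rw [← Finset.prod_mul_distrib]
    apply Finset.prod_congr rfl
    intro p hp
    have h := hc p (Nat.prime_of_mem_primeFactors hp)
    rw [Nat.not_odd_iff_even] at h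
    rw [← pow_add]
    congr 1
    obtain ⟨t, ht⟩ := h
    omega
  have hpd : p ∣ n := by
    by_contra hc
    rw [Nat.factorization_eq_zero_of_not_dvd hc] at hpo
    exact absurd hpo (by decide)
  have hp2 : p ≠ 2 := by
    rintro rfl
    exact (Nat.not_even_iff_odd.2 hn) (even_iff_two_dvd.2 hpd)
  have hfact : Fact p.Prime := ⟨hp⟩
  obtain ⟨r, hr⟩ := FiniteField.exists_nonsquare (F := ZMod p) (by rw [ZMod.ringChar_zmod_n]; exact hp2)
  set m := ordCompl[p] n with hm
  have hm0 : m ≠ 0 := (Nat.ordCompl_pos p hn0).ne'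
  have hcop : Nat.Coprime p m := Nat.coprime_ordCompl hp hn0
  obtain ⟨a, ha1, ha2⟩ := Nat.chineseRemainder hcop r.val 1
  have hnm : n = p ^ n.factorization p * m := (Nat.ordProj_mul_ordCompl_eq_self n p).symm
  have j1 : jacobiSym a p = -1 := by
    rw [ZMod.nonsquare_iff_jacobiSym_eq_neg_one]
    have : ((a : ℤ) : ZMod p) = r := by
      have := (ZMod.natCast_eq_natCast_iff _ _ _).2 ha1
      push_cast
      rw [this, ZMod.natCast_zmod_val]
    rw [this]; exact hr
  have j2 : jacobiSym a m = 1 := by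
    have : jacobiSym a m = jacobiSym 1 m := by
      apply jac_congr
      have := (Nat.modEq_iff_dvd.1 ha2)
      have h2 := dvd_neg.2 this
      simpa using h2
    rw [this, jacobiSym.one_left]
  have j3 : jacobiSym a n = -1 := by
    have e : jacobiSym a n = jacobiSym a (p ^ n.factorization p * m) := by rw [← hnm]
    rw [e, jacobiSym.mul_right' _ (pow_ne_zero _ hp.pos.ne') hm0, jacobiSym.pow_right, j1, j2,
      hpo.neg_one_pow, mul_one]
  refine ⟨a, ?_, j3⟩
  rw [Int.isCoprime_iff_gcd_eq_one]
  by_contra hc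
  have : NeZero n := ⟨hn0⟩
  have := jacobiSym.eq_zero_iff_not_coprime.2 hc
  omega

theorem jac_sum_zero {n : ℕ} (hn : Odd n) (hs : ¬ IsSquare n) :
    ∑ x ∈ range n, (jacobiSym x n : ℝ) = 0 := by
  obtain ⟨a, hac, ha⟩ := exists_jac_neg hn hs
  have : NeZero n := ⟨hn.pos.ne'⟩
  have hu : IsUnit (a : ZMod n) := by
    obtain ⟨s, t, hst⟩ := hac
    have h1 : ((s * a + t * n : ℤ) : ZMod n) = 1 := by rw [hst]; simp
    push_cast at h1
    rw [ZMod.natCast_self, mul_zero, add_zero] at h1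
    exact IsUnit.of_mul_eq_one _ (by rw [mul_comm]; exact h1)
  have e : ∑ x ∈ range n, (jacobiSym x n : ℝ) = ∑ x : ZMod n, (jacobiSym (x.val : ℤ) n : ℝ) := by
    rw [← Finset.sum_image (s := Finset.univ) (g := fun x : ZMod n => x.val) (f := fun y : ℕ => (jacobiSym (y : ℤ) n : ℝ))
      (fun x _ y _ h => ZMod.val_injective n h)]
    apply Finset.sum_congr _ (fun _ _ => rfl)
    ext y
    simp only [Finset.mem_range, Finset.mem_image, Finset.mem_univ, true_and]
    constructor
    · intro h; exact ⟨(y : ZMod n), ZMod.val_cast_of_lt h⟩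
    · rintro ⟨x, rfl⟩; exact ZMod.val_lt x
  rw [e]
  have h1 : ∑ x : ZMod n, (jacobiSym (x.val : ℤ) n : ℝ) =
      ∑ x : ZMod n, (jacobiSym (((a : ZMod n) * x).val : ℤ) n : ℝ) := by
    symm
    exact Fintype.sum_bijective (fun x => (a : ZMod n) * x) ((IsUnit.isUnit_iff_mulLeft_bijective).1 hu) _ _ (fun _ => rfl)
  have h2 : ∀ x : ZMod n, (jacobiSym (((a : ZMod n) * x).val : ℤ) n : ℝ) = - (jacobiSym (x.val : ℤ) n : ℝ) := by
    intro x
    have : jacobiSym (((a : ZMod n) * x).val : ℤ) n = jacobiSym (a * (x.val : ℤ)) n := by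
      apply jac_congr
      rw [← ZMod.intCast_zmod_eq_zero_iff_dvd]
      push_cast
      simp
    rw [this, jacobiSym.mul_left, ha]; simp
  simp_rw [h2] at h1
  rw [Finset.sum_neg_distrib] at h1
  linarith

theorem abs_jacR (a : ℤ) (b : ℕ) : |(jacobiSym a b : ℝ)| ≤ 1 := by exact_mod_cast abs_jacobi a b

theorem jac_sum_bound {n : ℕ} (hn : Odd n) (hs : ¬ IsSquare n) (t a b : ℤ) :
    |∑ x ∈ Icc a b, (jacobiSym (x + t) n : ℝ)| ≤ n := by
  have h := periodic_sum (fun x => (jacobiSym x n : ℝ)) n hn.pos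
    (fun x => by
      have : jacobiSym (x + n) n = jacobiSym x n := jac_congr ⟨1, by ring⟩
      simp only [this]) (by exact_mod_cast jac_sum_zero hn hs) (fun x => abs_jacR x n) (a + t) (b + t)
  rw [← Finset.map_add_right_Icc, Finset.sum_map] at h
  exact h

theorem chi_offdiag {z₁ z₂ : ℤ√2} (h1 : IsS z₁) (h2 : IsS z₂) (p1 : (nn z₁).Prime) (p2 : (nn z₂).Prime)
    (hne : nn z₁ ≠ nn z₂) (L : ℕ) :
    |∑ m ∈ box L, chi z₁ m * chi z₂ m| ≤ (2 * L + 1) * (nn z₁ * nn z₂) := by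
  obtain ⟨R1, -, -, hR1⟩ := chi_spec h1 p1
  obtain ⟨R2, -, -, hR2⟩ := chi_spec h2 p2
  have o1 : Odd (nn z₁) := by
    have := odd_norm h1.2.1
    rw [← h1.tp.nn_eq] at this; exact_mod_cast this
  have o2 : Odd (nn z₂) := by
    have := odd_norm h2.2.1
    rw [← h2.tp.nn_eq] at this; exact_mod_cast this
  have hcop : Nat.Coprime (nn z₁) (nn z₂) := (Nat.coprime_primes p1 p2).2 hne
  have hsq : ¬ IsSquare (nn z₁ * nn z₂) := by
    rintro ⟨r, hr⟩
    have hd : nn z₁ ∣ r * r := by rw [← hr]; exact Dvd.intro _ rfl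
    have hd' : nn z₁ ∣ r := (p1.dvd_mul.1 hd).elim id id
    have h3 : nn z₁ * nn z₁ ∣ nn z₁ * nn z₂ := by rw [hr]; exact mul_dvd_mul hd' hd'
    have h4 := Nat.dvd_of_mul_dvd_mul_left p1.pos h3
    exact hne ((Nat.prime_dvd_prime_iff_eq p1 p2).1 h4)
  rw [sum_box]
  have hb : ∀ b ∈ Icc (-(L : ℤ)) L, |∑ a ∈ Icc (-(L : ℤ)) L, chi z₁ ⟨a, b⟩ * chi z₂ ⟨a, b⟩| ≤
      ((nn z₁ * nn z₂ : ℕ) : ℝ) := by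
    intro b _
    obtain ⟨t, ht1, ht2⟩ : ∃ t : ℤ, (nn z₁ : ℤ) ∣ b * R1 - t ∧ (nn z₂ : ℤ) ∣ b * R2 - t := by
      obtain ⟨s, r, hsr⟩ := Nat.isCoprime_iff_coprime.2 hcop
      refine ⟨s * nn z₁ * (b * R2) + r * nn z₂ * (b * R1), ⟨s * (b * R1 - b * R2), ?_⟩,
        ⟨r * (b * R2 - b * R1), ?_⟩⟩
      · linear_combination (-(b * R1)) * hsr
      · linear_combination (-(b * R2)) * hsr
    have e : ∀ a : ℤ, chi z₁ ⟨a, b⟩ * chi z₂ ⟨a, b⟩ = (jacobiSym (a + t) (nn z₁ * nn z₂) : ℝ) := by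
      intro a
      rw [hR1, hR2, jacobiSym.mul_right' _ p1.pos.ne' p2.pos.ne']
      push_cast
      congr 2
      · apply jac_congr
        simpa using ht1
      · apply jac_congr
        simpa using ht2
    simp_rw [e]
    exact jac_sum_bound (o1.mul o2) hsq t _ _
  refine (Finset.abs_sum_le_sum_abs _ _).trans ((Finset.sum_le_sum hb).trans ?_)
  rw [Finset.sum_const, Int.card_Icc, nsmul_eq_mul]
  have : (((L : ℤ) + 1 - -(L : ℤ)).toNat : ℝ) = 2 * L + 1 := by
    have : ((L : ℤ) + 1 - -(L : ℤ)).toNat = 2 * L + 1 := by omega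
    rw [this]; push_cast; ring
  rw [this]; push_cast
  exact le_rfl

end SpinDensity

namespace SpinDensity
open Finset
open scoped Classical

theorem reps_le {M : Type*} [CommMonoid M] (W : Finset M) (k : ℕ) (f₀ : Fin k → M) (S : Finset M)
    (hS : ∀ w ∈ W, w ∣ ∏ i, f₀ i → w ∈ S) (r : ℕ) (hr : #S ≤ r) :
    (#{f ∈ Fintype.piFinset (fun _ : Fin k => W) | ∏ i, f i = ∏ i, f₀ i} : ℝ) ≤ (r : ℝ) ^ k := by
  have h : {f ∈ Fintype.piFinset (fun _ : Fin k => W) | ∏ i, f i = ∏ i, f₀ i} ⊆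
      Fintype.piFinset (fun _ : Fin k => S) := by
    intro f hf
    rw [Finset.mem_filter, Fintype.mem_piFinset] at hf
    rw [Fintype.mem_piFinset]
    intro i
    apply hS _ (hf.1 i)
    rw [← hf.2]
    exact Finset.dvd_prod_of_mem _ (Finset.mem_univ i)
  have h2 := Finset.card_le_card h
  rw [Fintype.card_piFinset] at h2
  simp only [Finset.prod_const, Finset.card_univ, Fintype.card_fin] at h2
  have h3 := h2.trans (Nat.pow_le_pow_left hr k)
  exact_mod_cast h3

theorem root_le {T C : ℝ} {m : ℕ} {N : ℝ} (hm : m ≠ 0) (hC : 1 ≤ C) (hN : 0 ≤ N)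
    (h : T ^ m ≤ C * N ^ m) : T ≤ C * N := by
  by_contra hc
  push Not at hc
  have h1 : (C * N) ^ m < T ^ m := pow_lt_pow_left₀ hc (by positivity) hm
  rw [mul_pow] at h1
  have h2 : C ≤ C ^ m := le_self_pow₀ hC hm
  have h3 : C * N ^ m ≤ C ^ m * N ^ m := by gcongr
  linarith

/-- the Jacobi symbol as a multiplicative function of the numerator -/
noncomputable def jm (u : ℕ) : ℕ →* ℝ where
  toFun v := (jacobiSym v u : ℝ)
  map_one' := by simp [jacobiSym.one_left]
  map_mul' a b := by push_cast; rw [jacobiSym.mul_left]; push_cast; ring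

theorem jm_apply (u v : ℕ) : jm u v = (jacobiSym v u : ℝ) := rfl

theorem square_pairs (A : ℕ) : ∃ C : ℕ, 1 ≤ C ∧ ∀ N D : ℕ, 0 < N → D ≤ N ^ A →
    (#{q ∈ Icc 1 D ×ˢ Icc 1 D | IsSquare (q.1 * q.2)} : ℝ) ≤ D * (C * N) := by
  obtain ⟨C, hC, h⟩ := tau_bound (2 * A)
  refine ⟨C, hC, fun N D hN hD => ?_⟩
  have h1 : #{q ∈ Icc 1 D ×ˢ Icc 1 D | IsSquare (q.1 * q.2)} ≤
      #((Icc 1 D).sigma (fun t => (t ^ 2).divisors)) := by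
    apply Finset.card_le_card_of_injOn (fun q => ⟨Nat.sqrt (q.1 * q.2), q.1⟩)
    · rintro ⟨a, b⟩ hq
      simp only [Finset.coe_filter, Finset.mem_product, Finset.mem_Icc, Set.mem_ofPred_eq] at hq
      obtain ⟨⟨⟨ha, ha'⟩, hb, hb'⟩, t, ht⟩ := hq
      have e : Nat.sqrt (a * b) = t := by rw [ht, Nat.sqrt_eq]
      simp only [Finset.coe_sigma, Set.mem_sigma_iff, Finset.mem_coe, Finset.mem_Icc, Nat.mem_divisors, e]
      have hab : a * b ≤ D * D := Nat.mul_le_mul ha' hb'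
      have hab' : 0 < a * b := Nat.mul_pos ha hb
      have ht0 : 0 < t := by
        rcases Nat.eq_zero_or_pos t with h | h
        · subst h; omega
        · exact h
      refine ⟨⟨ht0, ?_⟩, ⟨b, ?_⟩, by positivity⟩
      · rw [ht] at hab; exact Nat.mul_self_le_mul_self_iff.1 hab
      · rw [sq, ht]
    · rintro ⟨a, b⟩ hq ⟨a', b'⟩ hq' he
      simp only [Finset.coe_filter, Finset.mem_product, Finset.mem_Icc, Set.mem_ofPred_eq] at hq hq'
      obtain ⟨⟨⟨ha, ha'⟩, hb, hb'⟩, t, ht⟩ := hq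
      obtain ⟨⟨⟨ha2, ha2'⟩, hb2, hb2'⟩, t', ht'⟩ := hq'
      simp only [Sigma.mk.injEq, heq_eq_eq] at he
      rw [ht, ht', Nat.sqrt_eq, Nat.sqrt_eq] at he
      obtain ⟨rfl, rfl⟩ := he
      have : b = b' := Nat.eq_of_mul_eq_mul_left ha (ht.trans ht'.symm)
      rw [this]
  rw [Finset.card_sigma] at h1
  have h2 : ∑ t ∈ Icc 1 D, #(t ^ 2).divisors ≤ ∑ t ∈ Icc 1 D, C * N := by
    apply Finset.sum_le_sum
    intro t ht
    rw [Finset.mem_Icc] at ht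
    apply h N _ hN (by have := ht.1; positivity)
    calc t ^ 2 ≤ (N ^ A) ^ 2 := Nat.pow_le_pow_left (ht.2.trans hD) 2
      _ = N ^ (2 * A) := by rw [← pow_mul]; ring_nf
  have h3 := h1.trans h2
  simp only [Finset.sum_const, Nat.card_Icc, smul_eq_mul, Nat.add_sub_cancel] at h3
  exact_mod_cast h3

theorem jacBil (A : ℕ) : ∃ C : ℕ, 1 ≤ C ∧ ∀ N D : ℕ, 0 < N → D ≤ N ^ A →
    ∀ Z W : Finset ℕ, (∀ u ∈ Z, Odd u ∧ u ≤ D) → W ⊆ Icc 1 D →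
    (∑ u ∈ Z, |∑ v ∈ W, (jacobiSym v u : ℝ)|) ^ 8 ≤ C * (D : ℝ) ^ 15 * (N : ℝ) ^ 5 := by
  obtain ⟨C1, hC1, h1⟩ := tau_bound (4 * A)
  obtain ⟨C2, hC2, h2⟩ := square_pairs A
  refine ⟨2 * C1 ^ 4 * C2, by nlinarith [Nat.one_le_pow 4 C1 hC1], fun N D hN hD Z W hZ hW => ?_⟩
  have hN1 : (1 : ℝ) ≤ N := by exact_mod_cast hN
  have hC2' : (1 : ℝ) ≤ C2 := by exact_mod_cast hC2
  rcases Nat.eq_zero_or_pos D with hD0 | hD0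
  · have : Z = ∅ := by
      apply Finset.eq_empty_of_forall_notMem
      intro u hu
      have := hZ u hu
      have := this.1.pos
      omega
    rw [this]; simp; positivity
  have hD1 : (1 : ℝ) ≤ D := by exact_mod_cast hD0
  have hZs : Z ⊆ Icc 1 D := fun u hu => Finset.mem_Icc.2 ⟨(hZ u hu).1.pos, (hZ u hu).2⟩
  have hprod : ∀ f ∈ Fintype.piFinset (fun _ : Fin 4 => W), ∏ i, f i ∈ Icc 1 (D ^ 4) := by
    intro f hf
    rw [Fintype.mem_piFinset] at hf
    have h := fun i => Finset.mem_Icc.1 (hW (hf i))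
    rw [Finset.mem_Icc]
    constructor
    · exact Nat.pos_of_ne_zero (Finset.prod_ne_zero_iff.2 fun i _ => by have := (h i).1; omega)
    · calc ∏ i, f i ≤ ∏ _i : Fin 4, D := Finset.prod_le_prod' fun i _ => (h i).2
        _ = D ^ 4 := by simp
  have hb := bilinear Z W jm (fun _ => 1) (by simp) 4 (by decide) (by decide)
    (fun z m => by rw [jm_apply]; exact abs_jacR _ _) (Icc 1 (D ^ 4)) hprod
    (((C1 * N : ℕ) : ℝ) ^ 4) (by positivity)
    (fun f₀ hf₀ => by
      have h := Finset.mem_Icc.1 (hprod f₀ hf₀)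
      apply reps_le W 4 f₀ (∏ i, f₀ i).divisors
      · intro w _ hw
        exact Nat.mem_divisors.2 ⟨hw, by omega⟩
      · apply h1 N _ hN (by omega)
        calc _ ≤ D ^ 4 := h.2
          _ ≤ (N ^ A) ^ 4 := Nat.pow_le_pow_left hD 4
          _ = N ^ (4 * A) := by rw [← pow_mul]; ring_nf)
    (D * (C2 * N)) ((D : ℝ) ^ 2) (fun u1 u2 => IsSquare (u1 * u2))
    (by
      refine le_trans ?_ (h2 N D hN hD)
      apply Nat.cast_le.2
      apply Finset.card_le_card
      intro q hq
      simp only [Finset.mem_filter, Finset.mem_product] at hq ⊢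
      exact ⟨⟨hZs hq.1.1, hZs hq.1.2⟩, hq.2⟩)
    (by positivity)
    (fun z₁ hz₁ z₂ hz₂ hr => by
      have ho : Odd (z₁ * z₂) := (hZ z₁ hz₁).1.mul (hZ z₂ hz₂).1
      have hj := jac_sum_bound ho hr 0 1 ((D ^ 4 : ℕ) : ℤ)
      have e : ∑ x ∈ Icc (1 : ℤ) ((D ^ 4 : ℕ) : ℤ), (jacobiSym (x + 0) (z₁ * z₂) : ℝ) =
          ∑ m ∈ Icc 1 (D ^ 4), jm z₁ m * jm z₂ m := by
        symm
        apply Finset.sum_bij (fun (m : ℕ) _ => (m : ℤ))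
        · intro m hm
          simp only [Finset.mem_Icc] at hm ⊢
          omega
        · intro a _ b _ h; exact_mod_cast h
        · intro b hb
          simp only [Finset.mem_Icc] at hb
          refine ⟨b.toNat, ?_, by omega⟩
          rw [Finset.mem_Icc]; omega
        · intro m _
          have : NeZero z₁ := ⟨(hZ z₁ hz₁).1.pos.ne'⟩
          have : NeZero z₂ := ⟨(hZ z₂ hz₂).1.pos.ne'⟩
          rw [jm_apply, jm_apply, add_zero, jacobiSym.mul_right]
          push_cast; ring
      rw [← e]
      refine hj.trans ?_
      have a1 : (z₁ : ℝ) ≤ D := by exact_mod_cast (hZ z₁ hz₁).2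
      have a2 : (z₂ : ℝ) ≤ D := by exact_mod_cast (hZ z₂ hz₂).2
      push_cast
      rw [sq]
      gcongr)
  simp only [one_mul, jm_apply] at hb
  refine hb.trans ?_
  have cZ : (#Z : ℝ) ≤ D := by
    have := Finset.card_le_card hZs
    rw [Nat.card_Icc, Nat.add_sub_cancel] at this; exact_mod_cast this
  have cW : (#W : ℝ) ≤ D := by
    have := Finset.card_le_card hW
    rw [Nat.card_Icc, Nat.add_sub_cancel] at this; exact_mod_cast this
  have cB : (#(Icc 1 (D ^ 4)) : ℝ) = (D : ℝ) ^ 4 := by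
    rw [Nat.card_Icc, Nat.add_sub_cancel]; push_cast; rfl
  rw [cB]
  have key : (D : ℝ) * (C2 * N) * (D : ℝ) ^ 4 + (#Z : ℝ) ^ 2 * (D : ℝ) ^ 2 ≤ 2 * C2 * N * (D : ℝ) ^ 5 := by
    have : (#Z : ℝ) ^ 2 * (D : ℝ) ^ 2 ≤ C2 * N * (D : ℝ) ^ 5 := by
      calc (#Z : ℝ) ^ 2 * (D : ℝ) ^ 2 ≤ (D : ℝ) ^ 2 * (D : ℝ) ^ 2 := by gcongr
        _ = 1 * (D : ℝ) ^ 4 := by ring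
        _ ≤ (C2 * N) * (D : ℝ) ^ 5 := by
          apply mul_le_mul (one_le_mul_of_one_le_of_one_le hC2' hN1) (pow_le_pow_right₀ hD1 (by norm_num)) (by positivity) (by positivity)
        _ = _ := by ring
    linarith [this, show (D : ℝ) * (C2 * N) * (D : ℝ) ^ 4 = C2 * N * (D : ℝ) ^ 5 by ring]
  calc (#Z : ℝ) ^ (2 * (4 - 1)) * (((C1 * N : ℕ) : ℝ) ^ 4 * (#W : ℝ) ^ 4 *
        ((D : ℝ) * (C2 * N) * (D : ℝ) ^ 4 + (#Z : ℝ) ^ 2 * (D : ℝ) ^ 2))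
      ≤ (D : ℝ) ^ (2 * (4 - 1)) * (((C1 * N : ℕ) : ℝ) ^ 4 * (D : ℝ) ^ 4 * (2 * C2 * N * (D : ℝ) ^ 5)) := by
        gcongr
    _ = _ := by push_cast; ring

end SpinDensity

namespace SpinDensity
open Finset
open scoped Classical

theorem cutBil (c : ℕ) : ∃ C : ℝ, 1 ≤ C ∧ ∀ N : ℕ, 2 ≤ N →
    ∀ Z W : Finset ℕ, (∀ u ∈ Z, Odd u ∧ u ≤ 2 * N ^ (16 * c + 8)) → W ⊆ Icc 1 (2 * N ^ (16 * c + 8)) →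
    ∀ f : ℕ → ℕ, (∀ u ∈ Z, f u ≤ 2 * N ^ (16 * c + 8)) →
    ∑ u ∈ Z, |∑ v ∈ W with v < f u, (jacobiSym v u : ℝ)| ≤ C * (N : ℝ) ^ (31 * c + 16) := by
  obtain ⟨C, hC, h⟩ := jacBil (16 * c + 9)
  have hC' : (1 : ℝ) ≤ C := by exact_mod_cast hC
  refine ⟨3 * (C * 2 ^ 15) + 2, by linarith, fun N hN Z W hZ hW f hf => ?_⟩
  have hN1 : (1 : ℝ) ≤ N := by exact_mod_cast (by omega : 1 ≤ N)
  have hN0 : 0 < N := by omega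
  set D := 2 * N ^ (16 * c + 8) with hD
  have hDA : D ≤ N ^ (16 * c + 9) := by
    rw [hD, pow_succ N (16 * c + 8), mul_comm]; exact Nat.mul_le_mul_left _ hN
  have hB : ∀ t : ℕ, ∑ u ∈ Z, |∑ v ∈ W with v < t, (jacobiSym v u : ℝ)| ≤
      (C * 2 ^ 15) * (N : ℝ) ^ (30 * c + 16) := by
    intro t
    apply root_le (m := 8) (by norm_num) (by linarith) (by positivity)
    refine (h N D hN0 hDA Z (W.filter (· < t)) hZ ((Finset.filter_subset _ _).trans hW)).trans ?_
    rw [hD]; push_cast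
    calc (C : ℝ) * (2 * (N : ℝ) ^ (16 * c + 8)) ^ 15 * (N : ℝ) ^ 5
        = (C * 2 ^ 15) * (N : ℝ) ^ ((16 * c + 8) * 15 + 5) := by rw [mul_pow, ← pow_mul, pow_add]; ring
      _ ≤ (C * 2 ^ 15) * (N : ℝ) ^ ((30 * c + 16) * 8) := by
        gcongr
        omega
      _ = _ := by rw [pow_mul]
  have hd := decouple Z W (fun u v => (jacobiSym v u : ℝ)) (fun _ _ _ _ => abs_jacR _ _) (fun v => v) f D
    (N ^ (15 * c + 8)) (by positivity) hf _ ((N ^ (15 * c + 8) : ℕ) : ℝ) hB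
    (fun t => by
      apply Nat.cast_le.2
      calc _ ≤ #(Ico t (t + N ^ (15 * c + 8))) := by
            apply Finset.card_le_card
            intro w hw
            simp only [Finset.mem_filter] at hw
            exact Finset.mem_Ico.2 hw.2
        _ = _ := by simp)
  refine hd.trans ?_
  have e1 : D / N ^ (15 * c + 8) = 2 * N ^ c := by
    rw [hD, show 16 * c + 8 = c + (15 * c + 8) by ring, pow_add, ← mul_assoc]
    exact Nat.mul_div_cancel _ (by positivity)
  have cZ : (#Z : ℝ) ≤ D := by
    have : Z ⊆ Icc 1 D := fun u hu => Finset.mem_Icc.2 ⟨(hZ u hu).1.pos, (hZ u hu).2⟩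
    have := Finset.card_le_card this
    rw [Nat.card_Icc, Nat.add_sub_cancel] at this; exact_mod_cast this
  rw [e1]
  have hNc : (1 : ℝ) ≤ (N : ℝ) ^ c := one_le_pow₀ hN1
  calc (((2 * N ^ c : ℕ) : ℝ) + 1) * ((C * 2 ^ 15) * (N : ℝ) ^ (30 * c + 16)) + #Z * ((N ^ (15 * c + 8) : ℕ) : ℝ)
      ≤ (3 * (N : ℝ) ^ c) * ((C * 2 ^ 15) * (N : ℝ) ^ (30 * c + 16)) + D * ((N ^ (15 * c + 8) : ℕ) : ℝ) := by
        gcongr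
        push_cast; linarith
    _ = _ := by
      rw [hD]; push_cast
      ring

theorem isS_star {w : ℤ√2} (h : IsS w) : IsS (star w) := by
  obtain ⟨h1, h2, h3⟩ := h
  refine ⟨?_, ?_, ?_⟩
  · simpa using h1
  · simpa using h2
  · simpa using h3.neg_right

theorem nn_star (w : ℤ√2) : nn (star w) = nn w := by rw [nn, Zsqrtd.norm_conj, nn]

theorem typeI_half (x q : ℕ) :
    ∑ w ∈ SF x with q ∣ nn w, (spin w : ℝ) = 2 * ∑ w ∈ SF x with q ∣ nn w ∧ 0 < w.im, (spin w : ℝ) := by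
  have h1 : ∑ w ∈ SF x with q ∣ nn w ∧ w.im < 0, (spin w : ℝ) =
      ∑ w ∈ SF x with q ∣ nn w ∧ 0 < w.im, (spin w : ℝ) := by
    apply Finset.sum_nbij' star star
    · intro w hw
      simp only [Finset.mem_filter, mem_SF'] at hw ⊢
      exact ⟨⟨isS_star hw.1.1, by rw [nn_star]; exact hw.1.2⟩, by rw [nn_star]; exact hw.2.1,
        by have := hw.2.2; simp only [Zsqrtd.im_star]; omega⟩
    · intro w hw
      simp only [Finset.mem_filter, mem_SF'] at hw ⊢
      exact ⟨⟨isS_star hw.1.1, by rw [nn_star]; exact hw.1.2⟩, by rw [nn_star]; exact hw.2.1,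
        by have := hw.2.2; simp only [Zsqrtd.im_star]; omega⟩
    · intro w _; simp
    · intro w _; simp
    · intro w hw
      simp only [Finset.mem_filter, mem_SF'] at hw
      have := spin_neg (u := w.re) (v := w.im) hw.1.1.bound.1
      have e : star w = ⟨w.re, -w.im⟩ := rfl
      rw [e, this]
  have h2 : ∑ w ∈ SF x with q ∣ nn w, (spin w : ℝ) =
      ∑ w ∈ SF x with q ∣ nn w ∧ w.im < 0, (spin w : ℝ) + ∑ w ∈ SF x with q ∣ nn w ∧ 0 < w.im, (spin w : ℝ) := by
    rw [Finset.sum_filter, Finset.sum_filter, Finset.sum_filter, ← Finset.sum_add_distrib]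
    apply Finset.sum_congr rfl
    intro w _
    by_cases hq : q ∣ nn w
    · rcases lt_trichotomy w.im 0 with h | h | h
      · simp [hq, h, h.le]
      · have : spin w = 0 := by
          unfold spin
          rw [if_neg]
          intro hh
          have := (res_of_norm hh).2
          omega
        simp [this]
      · simp [hq, h, h.le]
    · simp [hq]
  rw [h2, h1]; ring

/-- coefficient -/
noncomputable def cI (q u v : ℕ) : ℝ :=
  if (⟨u, v⟩ : ℤ√2).norm % 16 = 15 ∧ (q : ℤ) ∣ (⟨u, v⟩ : ℤ√2).norm then (th u v : ℝ) else 0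

theorem abs_cI (q u v : ℕ) : |cI q u v| ≤ 1 := by
  unfold cI
  split_ifs
  · exact_mod_cast abs_th _ _
  · simp

theorem cI_mod (q u v : ℕ) : cI q u v = cI q u (v % (16 * q)) := by
  obtain ⟨m, hm⟩ : ∃ m : ℤ, (v : ℤ) = ((v % (16 * q) : ℕ) : ℤ) + 16 * q * m := by
    refine ⟨((v / (16 * q) : ℕ) : ℤ), ?_⟩
    exact_mod_cast (Nat.mod_add_div v (16 * q)).symm
  set r := v % (16 * q)
  have e : (⟨u, v⟩ : ℤ√2).norm = (⟨u, r⟩ : ℤ√2).norm + 16 * (q * (-2 * m * (v + r))) := by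
    rw [norm2, norm2]; simp only
    have : (v : ℤ) * v - r * r = 16 * q * m * (v + r) := by
      rw [show (v : ℤ) * v - r * r = (v - r) * (v + r) by ring, show (v : ℤ) - r = 16 * q * m by linarith]
    linarith
  unfold cI
  have h1 : (⟨u, v⟩ : ℤ√2).norm % 16 = 15 ↔ (⟨u, r⟩ : ℤ√2).norm % 16 = 15 := by rw [e]; omega
  have h2 : (q : ℤ) ∣ (⟨u, v⟩ : ℤ√2).norm ↔ (q : ℤ) ∣ (⟨u, r⟩ : ℤ√2).norm := by
    rw [e]
    exact dvd_add_left ⟨16 * (-2 * m * (v + r)), by ring⟩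
  have h3 : th u v = th u r := th_congr rfl (by
    rw [hm, show (16 : ℤ) * q * m = 8 * (2 * q * m) by ring]; omega)
  rw [h3]
  exact if_congr (and_congr h1 h2) rfl rfl

theorem typeI_sum (x q D : ℕ) (hD : 2 * x ≤ D * D) :
    ∑ w ∈ SF x with q ∣ nn w ∧ 0 < w.im, (spin w : ℝ) =
    ∑ u ∈ Icc 1 D with Odd u, ∑ v ∈ Icc 1 D,
      if 2 * v < u ∧ u * u ≤ x + 2 * (v * v) then cI q u v * (jacobiSym v u : ℝ) else 0 := by
  have hcs : ∀ u v : ℕ, Odd u → cI q u v * (jacobiSym v u : ℝ) = if (q : ℤ) ∣ (⟨u, v⟩ : ℤ√2).norm then (spin ⟨u, v⟩ : ℝ) else 0 := by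
    intro u v hu
    unfold cI spin
    by_cases h1 : (⟨u, v⟩ : ℤ√2).norm % 16 = 15 <;> by_cases h2 : (q : ℤ) ∣ (⟨u, v⟩ : ℤ√2).norm
    · simp [h1, h2]; ring
    · simp [h2]
    · simp [h1]
    · simp [h2]
  set T' := {p ∈ ({u ∈ Icc 1 D | Odd u} : Finset ℕ) ×ˢ Icc 1 D | (2 * p.2 < p.1 ∧ p.1 * p.1 ≤ x + 2 * (p.2 * p.2)) ∧
    (q : ℤ) ∣ (⟨p.1, p.2⟩ : ℤ√2).norm} with hT'
  have hR : ∑ u ∈ Icc 1 D with Odd u, ∑ v ∈ Icc 1 D,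
      (if 2 * v < u ∧ u * u ≤ x + 2 * (v * v) then cI q u v * (jacobiSym v u : ℝ) else 0) =
      ∑ p ∈ T', (spin ⟨p.1, p.2⟩ : ℝ) := by
    rw [hT', Finset.sum_filter (s := _ ×ˢ _), Finset.sum_product]
    apply Finset.sum_congr rfl
    intro u hu
    apply Finset.sum_congr rfl
    intro v _
    rw [hcs u v (Finset.mem_filter.1 hu).2]
    by_cases h1 : 2 * v < u ∧ u * u ≤ x + 2 * (v * v) <;> simp [h1]
  rw [hR]
  have hsub : ∑ p ∈ T' with IsCoprime (p.1 : ℤ) (p.2 : ℤ), (spin ⟨p.1, p.2⟩ : ℝ) = ∑ p ∈ T', (spin ⟨p.1, p.2⟩ : ℝ) := by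
    apply Finset.sum_subset (Finset.filter_subset _ _)
    intro p hp hn
    have : ¬ IsCoprime (p.1 : ℤ) (p.2 : ℤ) := fun h => hn (Finset.mem_filter.2 ⟨hp, h⟩)
    rw [spin_zero this]; simp
  rw [← hsub]
  apply Finset.sum_nbij' (fun w => (w.re.toNat, w.im.toNat)) (fun p => ⟨p.1, p.2⟩)
  · intro w hw
    simp only [Finset.mem_filter, mem_SF, hT', Finset.mem_product, Finset.mem_Icc] at hw ⊢
    obtain ⟨⟨hS, hn⟩, hq, hv⟩ := hw
    obtain ⟨b1, b2, b3⟩ := hS.bound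
    obtain ⟨s1, s2, s3⟩ := hS
    rw [abs_of_pos hv] at s1
    obtain ⟨u, hu⟩ : ∃ u : ℕ, w.re = u := ⟨w.re.toNat, by omega⟩
    obtain ⟨v, hv'⟩ : ∃ v : ℕ, w.im = v := ⟨w.im.toNat, by omega⟩
    have hw : w = ⟨u, v⟩ := by ext <;> assumption
    have hq' : (q : ℤ) ∣ w.norm := Int.natCast_dvd.2 hq
    rw [norm2, hu, hv'] at hn b3
    rw [hu] at b1
    rw [hu, hv'] at s1 s3 ⊢
    rw [hv'] at hv
    rw [hu] at s2
    simp only [Int.toNat_natCast]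
    rw [hw] at hq'
    have c1 : u < D := by
      by_contra hc
      push Not at hc
      have : D * D ≤ u * u := Nat.mul_le_mul hc hc
      have : ((2 * x : ℕ) : ℤ) ≤ ((u * u : ℕ) : ℤ) := by exact_mod_cast hD.trans this
      push_cast at this
      linarith
    refine ⟨⟨⟨⟨⟨by omega, by omega⟩, by exact_mod_cast s2⟩, by omega, by omega⟩, ⟨by omega, ?_⟩, hq'⟩, s3⟩
    zify; linarith
  · intro p hp
    simp only [Finset.mem_filter, mem_SF, hT', Finset.mem_product, Finset.mem_Icc] at hp ⊢
    obtain ⟨⟨⟨⟨⟨a1, a2⟩, a3⟩, a4, a5⟩, ⟨a6, a7⟩, a8⟩, a9⟩ := hp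
    refine ⟨⟨⟨?_, by simpa using a3, a9⟩, ?_⟩, Int.natCast_dvd.1 a8, by omega⟩
    · simp only [Nat.abs_cast]; omega
    · rw [norm2]; simp only; zify at a7; linarith
  · intro w hw
    simp only [Finset.mem_filter, mem_SF] at hw
    obtain ⟨⟨hS, hn⟩, hq, hv⟩ := hw
    obtain ⟨b1, b2, b3⟩ := hS.bound
    ext <;> simp <;> omega
  · intro p hp; simp
  · intro w hw
    simp only [Finset.mem_filter, mem_SF] at hw
    obtain ⟨⟨hS, hn⟩, hq, hv⟩ := hw
    obtain ⟨b1, b2, b3⟩ := hS.bound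
    have : w = ⟨(w.re.toNat : ℤ), (w.im.toNat : ℤ)⟩ := by ext <;> simp <;> omega
    rw [← this]

theorem typeI (c : ℕ) : ∃ C : ℝ, 1 ≤ C ∧ ∀ N x q : ℕ, 2 ≤ N → x ≤ N ^ (32 * c + 16) → 0 < q →
    |∑ w ∈ SF x with q ∣ nn w, (spin w : ℝ)| ≤ C * q * (N : ℝ) ^ (31 * c + 16) := by
  obtain ⟨C, hC, h⟩ := cutBil c
  refine ⟨64 * C, by linarith, fun N x q hN hx hq => ?_⟩
  set D := 2 * N ^ (16 * c + 8) with hD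
  have hxD : 2 * x ≤ D * D := by
    have : D * D = 4 * N ^ (32 * c + 16) := by
      rw [hD, show 32 * c + 16 = (16 * c + 8) + (16 * c + 8) by ring, pow_add]; ring
    omega
  rw [typeI_half, typeI_sum x q D hxD]
  set Z := ({u ∈ Icc 1 D | Odd u} : Finset ℕ) with hZ
  have hZ' : ∀ u ∈ Z, Odd u ∧ u ≤ D := fun u hu => by
    simp only [hZ, Finset.mem_filter, Finset.mem_Icc] at hu; exact ⟨hu.2, hu.1.2⟩
  let f1 : ℕ → ℕ := fun u => (u + 1) / 2
  let f2 : ℕ → ℕ := fun u => min (f1 u) (if u * u ≤ x then 0 else Nat.sqrt ((u * u - x - 1) / 2) + 1)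
  let W : ℕ → Finset ℕ := fun ρ => {v ∈ Icc 1 D | v % (16 * q) = ρ}
  have hcond : ∀ u v : ℕ, (2 * v < u ∧ u * u ≤ x + 2 * (v * v)) ↔ (v < f1 u ∧ ¬ v < f2 u) := by
    intro u v
    have e1 : v < f1 u ↔ 2 * v < u := by simp only [f1]; omega
    have e2 : v < f2 u ↔ v < f1 u ∧ ¬ (u * u ≤ x + 2 * (v * v)) := by
      simp only [f2, lt_min_iff]
      apply and_congr_right
      intro _
      split_ifs with h
      · constructor
        · intro h'; omega
        · intro h'; exfalso; apply h'; omega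
      · rw [Nat.lt_succ_iff, Nat.le_sqrt, Nat.le_div_iff_mul_le (by norm_num)]
        omega
    rw [e2, e1]; tauto
  have hsw : ∑ u ∈ Z, ∑ v ∈ Icc 1 D,
      (if 2 * v < u ∧ u * u ≤ x + 2 * (v * v) then cI q u v * (jacobiSym v u : ℝ) else 0) =
      ∑ ρ ∈ range (16 * q), ∑ u ∈ Z, cI q u ρ * (∑ v ∈ W ρ with v < f1 u, (jacobiSym v u : ℝ) -
        ∑ v ∈ W ρ with v < f2 u, (jacobiSym v u : ℝ)) := by
    rw [Finset.sum_comm (s := range (16 * q))]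
    apply Finset.sum_congr rfl
    intro u _
    rw [← Finset.sum_fiberwise_of_maps_to (t := range (16 * q)) (g := fun v => v % (16 * q))
      (fun v _ => Finset.mem_range.2 (Nat.mod_lt _ (by omega)))]
    apply Finset.sum_congr rfl
    intro ρ _
    rw [Finset.sum_filter (s := W ρ), Finset.sum_filter (s := W ρ), ← Finset.sum_sub_distrib, Finset.mul_sum]
    apply Finset.sum_congr rfl
    intro v hv
    have hv' := (Finset.mem_filter.1 hv).2
    rw [cI_mod, hv', if_congr (hcond u v) rfl rfl]
    have hlt : v < f2 u → v < f1 u := fun h => lt_of_lt_of_le h (min_le_left _ _)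
    by_cases a1 : v < f1 u <;> by_cases a2 : v < f2 u
    · simp [a1, a2]
    · simp [a1, a2]
    · exact absurd (hlt a2) a1
    · simp [a1, a2]
  rw [hsw]
  have hρ : ∀ ρ ∈ range (16 * q), |∑ u ∈ Z, cI q u ρ * (∑ v ∈ W ρ with v < f1 u, (jacobiSym v u : ℝ) -
        ∑ v ∈ W ρ with v < f2 u, (jacobiSym v u : ℝ))| ≤ 2 * (C * (N : ℝ) ^ (31 * c + 16)) := by
    intro ρ _
    have hf1 : ∀ u ∈ Z, f1 u ≤ D := fun u hu => by
      have h1 := (hZ' u hu).2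
      have h2 := (hZ' u hu).1.pos
      simp only [f1]; omega
    have b1 := h N hN Z (W ρ) hZ' (Finset.filter_subset _ _) f1 hf1
    have b2 := h N hN Z (W ρ) hZ' (Finset.filter_subset _ _) f2 (fun u hu => (min_le_left _ _).trans (hf1 u hu))
    refine (Finset.abs_sum_le_sum_abs _ _).trans ?_
    calc _ ≤ ∑ u ∈ Z, (|∑ v ∈ W ρ with v < f1 u, (jacobiSym v u : ℝ)| +
        |∑ v ∈ W ρ with v < f2 u, (jacobiSym v u : ℝ)|) := by
          apply Finset.sum_le_sum
          intro u _
          rw [abs_mul]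
          calc _ ≤ 1 * |∑ v ∈ W ρ with v < f1 u, (jacobiSym v u : ℝ) -
              ∑ v ∈ W ρ with v < f2 u, (jacobiSym v u : ℝ)| := by
                gcongr
                exact abs_cI _ _ _
            _ ≤ _ := by rw [one_mul]; exact abs_sub _ _
      _ ≤ _ := by rw [Finset.sum_add_distrib]; linarith
  have hs := (Finset.abs_sum_le_sum_abs _ _).trans (Finset.sum_le_sum hρ)
  rw [Finset.sum_const, Finset.card_range, nsmul_eq_mul] at hs
  rw [abs_mul, abs_two]
  push_cast at hs
  linarith

end SpinDensity

namespace SpinDensity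
open Finset
open scoped Classical

theorem card_S (T : Finset (ℤ√2)) (S : Finset ℕ) (r : ℕ) (hT : ∀ w ∈ T, IsS w ∧ nn w ∈ S)
    (hr : ∀ m ∈ S, 0 < m → #m.divisors ≤ r) : #T ≤ r * #S := by
  apply Finset.card_le_mul_card_image_of_maps_to (f := nn) (fun w hw => (hT w hw).2)
  intro m hm
  rcases Nat.eq_zero_or_pos m with h | h
  · have : ({a ∈ T | nn a = m} : Finset _) = ∅ := by
      apply Finset.filter_eq_empty_iff.2
      intro w hw hm
      have := (hT w hw).1.tp.nn_pos
      omega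
    rw [this]; simp
  · refine le_trans (card_norm_le _ m h ?_) (hr m hm h)
    intro w hw
    rw [Finset.mem_filter] at hw
    exact ⟨(hT w hw.1).1, hw.2⟩

/-- gauge -/
def gau (w : ℤ√2) : ℤ := |w.re| + 2 * |w.im|

theorem gau_nonneg (w : ℤ√2) : 0 ≤ gau w := by unfold gau; positivity

theorem gau_mul (w z : ℤ√2) : gau (w * z) ≤ gau w * gau z := by
  unfold gau
  rw [Zsqrtd.re_mul, Zsqrtd.im_mul]
  have h1 : |w.re * z.re + 2 * w.im * z.im| ≤ |w.re| * |z.re| + 2 * (|w.im| * |z.im|) := by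
    refine (abs_add_le _ _).trans ?_
    rw [abs_mul, abs_mul, abs_mul, abs_two]; linarith
  have h2 : |w.re * z.im + w.im * z.re| ≤ |w.re| * |z.im| + |w.im| * |z.re| := by
    refine (abs_add_le _ _).trans ?_
    rw [abs_mul, abs_mul]
  have h3 : 0 ≤ |w.im| * |z.im| := by positivity
  nlinarith

theorem gau_prod {k : ℕ} (f : Fin k → ℤ√2) (H : ℤ) (hf : ∀ i, gau (f i) ≤ H) : gau (∏ i, f i) ≤ H ^ k := by
  induction k with
  | zero => simp [gau]
  | succ k ih =>
    rw [Fin.prod_univ_succ, pow_succ']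
    refine (gau_mul _ _).trans ?_
    have h1 := ih (fun i => f i.succ) (fun i => hf i.succ)
    have h0 := gau_nonneg (f 0)
    exact mul_le_mul (hf 0) h1 (gau_nonneg _) (h0.trans (hf 0))

theorem gau_S {w : ℤ√2} (hw : IsS w) (N J : ℕ) (hN : 1 ≤ N) (hn : nn w ≤ N ^ J) :
    gau w ≤ 3 * (N : ℤ) ^ ((J + 1) / 2) := by
  obtain ⟨b1, b2, b3⟩ := hw.bound
  have b0 := hw.1
  rw [← hw.tp.nn_eq] at b3
  have h1 : (nn w : ℤ) ≤ (N : ℤ) ^ (2 * ((J + 1) / 2)) := by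
    have : nn w ≤ N ^ (2 * ((J + 1) / 2)) := hn.trans (Nat.pow_le_pow_right hN (by omega))
    exact_mod_cast this
  rw [mul_comm 2 ((J + 1) / 2), pow_mul] at h1
  set H := (N : ℤ) ^ ((J + 1) / 2)
  have hH : 0 ≤ H := by positivity
  unfold gau
  rw [abs_of_pos b1]
  have hre : 2 * w.re ≤ 3 * H := by
    by_contra hc
    push Not at hc
    nlinarith
  linarith

theorem nn_prod {k : ℕ} (f : Fin k → ℤ√2) : nn (∏ i, f i) = ∏ i, nn (f i) := by
  induction k with
  | zero => simp [nn]
  | succ k ih => rw [Fin.prod_univ_succ, Fin.prod_univ_succ, nn_mul, ih]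

theorem dvd_nn {a b : ℤ√2} (h : a ∣ b) : nn a ∣ nn b := by
  obtain ⟨c, rfl⟩ := h
  rw [nn_mul]; exact Dvd.intro _ rfl

theorem biPart (K k : ℕ) (hk : 1 ≤ k) : ∃ C : ℝ, 1 ≤ C ∧ ∀ N j J : ℕ, 2 ≤ N → j + J = K → 1 ≤ J →
    ∀ Z W : Finset (ℤ√2), (∀ z ∈ Z, IsS z ∧ (nn z).Prime ∧ nn z ≤ N ^ (j + 1)) →
    (∀ w ∈ W, IsS w ∧ nn w ≤ N ^ J) → ∀ α : ℤ√2 → ℝ, (∀ w ∈ W, |α w| ≤ 1) →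
    (∑ z ∈ Z, |∑ w ∈ W, α w * chi z w|) ^ (2 * (2 * k)) ≤
      C * ((N : ℝ) ^ ((j + 2) * (4 * k - 2) + 4 * k + (J + 1) * (2 * k)) *
        ((N : ℝ) ^ (j + 3 + (J + 1) * (2 * k)) + (N : ℝ) ^ (4 * j + 6 + (J + 1) * k))) := by
  obtain ⟨C1, hC1, h1⟩ := tau_bound (K + 1)
  obtain ⟨C2, hC2, h2⟩ := tau_bound (K * (2 * k))
  have hC1' : (1 : ℝ) ≤ C1 := by exact_mod_cast hC1
  have hC2' : (1 : ℝ) ≤ C2 := by exact_mod_cast hC2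
  have hc9 : (1 : ℝ) ≤ 9 ^ (2 * k) := one_le_pow₀ (by norm_num)
  refine ⟨(C1 : ℝ) ^ (4 * k - 2) * ((C1 : ℝ) ^ (2 * k) * (C2 : ℝ) ^ (2 * k) * (C1 : ℝ) ^ (2 * k) *
    ((C1 : ℝ) ^ 2 * (9 * 9 ^ (2 * k)))), ?_, ?_⟩
  · have e1 : (1 : ℝ) ≤ (C1 : ℝ) ^ (4 * k - 2) := one_le_pow₀ hC1'
    have e2 : (1 : ℝ) ≤ (C1 : ℝ) ^ (2 * k) := one_le_pow₀ hC1'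
    have e3 : (1 : ℝ) ≤ (C2 : ℝ) ^ (2 * k) := one_le_pow₀ hC2'
    have e4 : (1 : ℝ) ≤ (C1 : ℝ) ^ 2 := one_le_pow₀ hC1'
    refine one_le_mul_of_one_le_of_one_le e1 (one_le_mul_of_one_le_of_one_le (one_le_mul_of_one_le_of_one_le (one_le_mul_of_one_le_of_one_le e2 e3) e2) (one_le_mul_of_one_le_of_one_le e4 (by linarith)))
  intro N j J hN hjJ hJ Z W hZ hW α hα
  have hN0 : 0 < N := by omega
  have hN1 : (1 : ℝ) ≤ N := by exact_mod_cast hN0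
  set H : ℕ := 3 * N ^ ((J + 1) / 2) with hH
  have hH1 : 1 ≤ H := by have : 1 ≤ N ^ ((J + 1) / 2) := Nat.one_le_pow _ _ hN0
                         omega
  have tauW : ∀ m : ℕ, 0 < m → m ≤ N ^ (K + 1) → #m.divisors ≤ C1 * N := fun m h h' => h1 N m hN0 h h'
  have hjK : N ^ (j + 1) ≤ N ^ (K + 1) := Nat.pow_le_pow_right hN0 (by omega)
  have hJK : N ^ J ≤ N ^ (K + 1) := Nat.pow_le_pow_right hN0 (by omega)
  have cZ : (#Z : ℝ) ≤ C1 * (N : ℝ) ^ (j + 2) := by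
    have := card_S Z (Icc 1 (N ^ (j + 1))) (C1 * N) (fun w hw => ⟨(hZ w hw).1, Finset.mem_Icc.2 ⟨(hZ w hw).1.tp.nn_pos, (hZ w hw).2.2⟩⟩)
      (fun m hm h => tauW m h ((Finset.mem_Icc.1 hm).2.trans hjK))
    rw [Nat.card_Icc, Nat.add_sub_cancel] at this
    have h3 : (#Z : ℝ) ≤ ((C1 * N * N ^ (j + 1) : ℕ) : ℝ) := by exact_mod_cast this
    refine h3.trans (le_of_eq ?_)
    push_cast; ring
  have cW : (#W : ℝ) ≤ C1 * (N : ℝ) ^ (J + 1) := by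
    have := card_S W (Icc 1 (N ^ J)) (C1 * N) (fun w hw => ⟨(hW w hw).1, Finset.mem_Icc.2 ⟨(hW w hw).1.tp.nn_pos, (hW w hw).2⟩⟩)
      (fun m hm h => tauW m h ((Finset.mem_Icc.1 hm).2.trans hJK))
    rw [Nat.card_Icc, Nat.add_sub_cancel] at this
    have h3 : (#W : ℝ) ≤ ((C1 * N * N ^ J : ℕ) : ℝ) := by exact_mod_cast this
    refine h3.trans (le_of_eq ?_)
    push_cast; ring
  have hD : (#{q ∈ Z ×ˢ Z | nn q.1 = nn q.2} : ℝ) ≤ (C1 * (N : ℝ) ^ (j + 2)) * (C1 * N) := by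
    have : #{q ∈ Z ×ˢ Z | nn q.1 = nn q.2} ≤ (C1 * N) * #Z := by
      apply Finset.card_le_mul_card_image_of_maps_to (f := fun q => q.1)
      · intro q hq
        simp only [Finset.mem_filter, Finset.mem_product] at hq
        exact hq.1.1
      · intro z hz
        have hzz := hZ z hz
        have : #{a ∈ ({q ∈ Z ×ˢ Z | nn q.1 = nn q.2} : Finset _) | a.1 = z} ≤ #{w ∈ Z | nn w = nn z} := by
          apply Finset.card_le_card_of_injOn (fun q => q.2)
          · intro q hq
            simp only [Finset.coe_filter, Set.mem_ofPred_eq, Finset.mem_filter, Finset.mem_product] at hq ⊢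
            refine ⟨hq.1.1.2, ?_⟩
            rw [← hq.1.2, hq.2]
          · intro q hq q' hq' he
            simp only [Finset.coe_filter, Set.mem_ofPred_eq, Finset.mem_filter, Finset.mem_product] at hq hq'
            exact Prod.ext (hq.2.trans hq'.2.symm) he
        refine this.trans (le_trans (card_norm_le _ (nn z) hzz.1.tp.nn_pos ?_) (tauW _ hzz.1.tp.nn_pos (hzz.2.2.trans hjK)))
        intro w hw
        rw [Finset.mem_filter] at hw
        exact ⟨(hZ w hw.1).1, hw.2⟩
    have h3 : (#{q ∈ Z ×ˢ Z | nn q.1 = nn q.2} : ℝ) ≤ (C1 * N) * #Z := by exact_mod_cast this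
    refine h3.trans ?_
    rw [mul_comm]; gcongr
  have hb := bilinear Z W chi α hα (2 * k) (even_two_mul k) (by omega) abs_chi (box (H ^ (2 * k)))
    (by
      intro f hf
      rw [Fintype.mem_piFinset] at hf
      have hg := gau_prod f (H : ℤ) (fun i => by
        have := gau_S (hW _ (hf i)).1 N J hN0 (hW _ (hf i)).2
        rw [hH]; push_cast; exact this)
      unfold gau at hg
      rw [mem_box]
      push_cast
      have a1 := abs_nonneg (∏ i, f i).re
      have a2 := abs_nonneg (∏ i, f i).im
      constructor <;> linarith)
    ((((C1 * N) * (C2 * N) : ℕ) : ℝ) ^ (2 * k)) (by positivity)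
    (by
      intro f₀ hf
      rw [Fintype.mem_piFinset] at hf
      have hm0 : 0 < nn (∏ i, f₀ i) := by
        rw [nn_prod]
        exact Finset.prod_pos fun i _ => (hW _ (hf i)).1.tp.nn_pos
      have hm : nn (∏ i, f₀ i) ≤ N ^ (K * (2 * k)) := by
        rw [nn_prod]
        calc ∏ i, nn (f₀ i) ≤ ∏ _i : Fin (2 * k), N ^ K :=
              Finset.prod_le_prod' fun i _ => (hW _ (hf i)).2.trans (Nat.pow_le_pow_right hN0 (by omega))
          _ = _ := by rw [Finset.prod_const, Finset.card_univ, Fintype.card_fin, ← pow_mul]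
      apply reps_le W (2 * k) f₀ {w ∈ W | w ∣ ∏ i, f₀ i} (fun w hw h => Finset.mem_filter.2 ⟨hw, h⟩)
      refine (card_S _ ((nn (∏ i, f₀ i)).divisors ∩ Icc 1 (N ^ J)) (C1 * N) ?_ ?_).trans ?_
      · intro w hw
        rw [Finset.mem_filter] at hw
        refine ⟨(hW w hw.1).1, Finset.mem_inter.2 ⟨Nat.mem_divisors.2 ⟨dvd_nn hw.2, hm0.ne'⟩, ?_⟩⟩
        exact Finset.mem_Icc.2 ⟨(hW w hw.1).1.tp.nn_pos, (hW w hw.1).2⟩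
      · intro m hm h
        exact tauW m h ((Finset.mem_Icc.1 (Finset.mem_inter.1 hm).2).2.trans hJK)
      · apply Nat.mul_le_mul_left
        exact (Finset.card_le_card Finset.inter_subset_left).trans (h2 N _ hN0 hm0 hm))
    ((C1 * (N : ℝ) ^ (j + 2)) * (C1 * N)) ((2 * (H ^ (2 * k) : ℕ) + 1) * ((N : ℝ) ^ (j + 1) * (N : ℝ) ^ (j + 1)))
    (fun z₁ z₂ => nn z₁ = nn z₂) (by convert hD) (by positivity)
    (by
      intro z₁ hz₁ z₂ hz₂ hne
      refine (chi_offdiag (hZ _ hz₁).1 (hZ _ hz₂).1 (hZ _ hz₁).2.1 (hZ _ hz₂).2.1 hne _).trans ?_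
      have a1 : (nn z₁ : ℝ) ≤ (N : ℝ) ^ (j + 1) := by exact_mod_cast (hZ _ hz₁).2.2
      have a2 : (nn z₂ : ℝ) ≤ (N : ℝ) ^ (j + 1) := by exact_mod_cast (hZ _ hz₂).2.2
      gcongr)
  refine hb.trans ?_
  rw [card_box]
  have hHk : (((H ^ (2 * k) : ℕ)) : ℝ) ≤ 9 ^ k * (N : ℝ) ^ ((J + 1) * k) := by
    rw [hH]; push_cast
    rw [mul_pow, pow_mul, ← pow_mul (N : ℝ)]
    norm_num
    exact pow_le_pow_right₀ hN1 (by
      have : (J + 1) / 2 * 2 ≤ J + 1 := Nat.div_mul_le_self _ _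
      calc (J + 1) / 2 * (2 * k) = ((J + 1) / 2 * 2) * k := by ring
        _ ≤ _ := Nat.mul_le_mul_right k this)
  have hHk1 : (1 : ℝ) ≤ ((H ^ (2 * k) : ℕ) : ℝ) := by exact_mod_cast Nat.one_le_pow _ _ hH1
  set L : ℝ := ((H ^ (2 * k) : ℕ) : ℝ) with hL
  have hbox : (((2 * H ^ (2 * k) + 1) ^ 2 : ℕ) : ℝ) ≤ 9 * (9 ^ (2 * k) * (N : ℝ) ^ ((J + 1) * (2 * k))) := by
    have : (((2 * H ^ (2 * k) + 1) ^ 2 : ℕ) : ℝ) = (2 * L + 1) ^ 2 := by rw [hL]; push_cast; ring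
    rw [this]
    calc (2 * L + 1) ^ 2 ≤ (3 * (9 ^ k * (N : ℝ) ^ ((J + 1) * k))) ^ 2 := by gcongr; linarith
      _ = _ := by rw [mul_pow, mul_pow, ← pow_mul, ← pow_mul]; ring_nf
  have h9 : (9 : ℝ) ^ k ≤ 9 ^ (2 * k) := pow_le_pow_right₀ (by norm_num) (by omega)
  have hE : (2 * L + 1) * ((N : ℝ) ^ (j + 1) * (N : ℝ) ^ (j + 1)) ≤
      9 * (9 ^ (2 * k) * (N : ℝ) ^ ((J + 1) * k)) * ((N : ℝ) ^ (j + 1) * (N : ℝ) ^ (j + 1)) := by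
    gcongr
    calc 2 * L + 1 ≤ 3 * L := by linarith
      _ ≤ 9 * L := by linarith
      _ ≤ 9 * (9 ^ k * (N : ℝ) ^ ((J + 1) * k)) := by gcongr
      _ ≤ _ := by gcongr
  have e0 : 2 * (2 * k - 1) = 4 * k - 2 := by omega
  rw [e0]
  calc _ ≤ (C1 * (N : ℝ) ^ (j + 2)) ^ (4 * k - 2) * (((C1 * N * (C2 * N) : ℕ) : ℝ) ^ (2 * k) *
        (C1 * (N : ℝ) ^ (J + 1)) ^ (2 * k) *
        (C1 * (N : ℝ) ^ (j + 2) * (C1 * N) * (9 * (9 ^ (2 * k) * (N : ℝ) ^ ((J + 1) * (2 * k)))) +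
          (C1 * (N : ℝ) ^ (j + 2)) ^ 2 * (9 * (9 ^ (2 * k) * (N : ℝ) ^ ((J + 1) * k)) *
            ((N : ℝ) ^ (j + 1) * (N : ℝ) ^ (j + 1))))) := by
        gcongr
    _ = _ := by
      push_cast
      have t1 : ((C1 : ℝ) * N * (C2 * N)) ^ (2 * k) = (C1 : ℝ) ^ (2 * k) * (C2 : ℝ) ^ (2 * k) * (N : ℝ) ^ (4 * k) := by
        rw [show (C1 : ℝ) * N * (C2 * N) = C1 * C2 * N ^ 2 by ring, mul_pow, mul_pow, ← pow_mul]; ring_nf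
      have t2 : ((C1 : ℝ) * (N : ℝ) ^ (j + 2)) ^ (4 * k - 2) = (C1 : ℝ) ^ (4 * k - 2) * (N : ℝ) ^ ((j + 2) * (4 * k - 2)) := by
        rw [mul_pow, ← pow_mul]
      have t3 : ((C1 : ℝ) * (N : ℝ) ^ (J + 1)) ^ (2 * k) = (C1 : ℝ) ^ (2 * k) * (N : ℝ) ^ ((J + 1) * (2 * k)) := by
        rw [mul_pow, ← pow_mul]
      have t4 : (N : ℝ) ^ (j + 3 + (J + 1) * (2 * k)) = (N : ℝ) ^ (j + 2) * N * (N : ℝ) ^ ((J + 1) * (2 * k)) := by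
        rw [pow_add]; ring
      have t5 : (N : ℝ) ^ (4 * j + 6 + (J + 1) * k) = ((N : ℝ) ^ (j + 2)) ^ 2 * ((N : ℝ) ^ (j + 1) * (N : ℝ) ^ (j + 1)) * (N : ℝ) ^ ((J + 1) * k) := by
        rw [pow_add]; ring
      have t6 : (N : ℝ) ^ ((j + 2) * (4 * k - 2) + 4 * k + (J + 1) * (2 * k)) =
          (N : ℝ) ^ ((j + 2) * (4 * k - 2)) * (N : ℝ) ^ (4 * k) * (N : ℝ) ^ ((J + 1) * (2 * k)) := by
        rw [pow_add, pow_add]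
      rw [t1, t2, t3, t4, t5, t6, mul_pow (C1 : ℝ) ((N : ℝ) ^ (j + 2)) 2]
      generalize (N : ℝ) ^ ((j + 2) * (4 * k - 2)) = y1
      generalize (N : ℝ) ^ ((J + 1) * (2 * k)) = y2
      generalize (N : ℝ) ^ ((J + 1) * k) = y3
      generalize (N : ℝ) ^ (4 * k) = y4
      generalize (N : ℝ) ^ (j + 2) = y5
      generalize (N : ℝ) ^ (j + 1) = y6
      generalize (C1 : ℝ) ^ (4 * k - 2) = y7
      generalize (C1 : ℝ) ^ (2 * k) = y8
      generalize (C2 : ℝ) ^ (2 * k) = y9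
      generalize (9 : ℝ) ^ (2 * k) = y10
      ring

end SpinDensity

namespace SpinDensity
open Finset
open scoped Classical

theorem biPart' (K k u e : ℕ) (hk : 1 ≤ k) (hu1 : 16 * k + 8 * k * e ≤ u)
    (hu2 : 15 * k + 8 * k * e + 2 * K + 2 ≤ k * u) :
    ∃ C : ℝ, 1 ≤ C ∧ ∀ N j J : ℕ, 2 ≤ N → j + J = K → u ≤ j → u ≤ J →
    ∀ Z W : Finset (ℤ√2), (∀ z ∈ Z, IsS z ∧ (nn z).Prime ∧ nn z ≤ N ^ (j + 1)) →
    (∀ w ∈ W, IsS w ∧ nn w ≤ N ^ J) → ∀ α : ℤ√2 → ℝ, (∀ w ∈ W, |α w| ≤ 1) →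
    ∑ z ∈ Z, |∑ w ∈ W, α w * chi z w| ≤ C * (N : ℝ) ^ (K - 2 * e) := by
  obtain ⟨C, hC, h⟩ := biPart K k hk
  refine ⟨2 * C, by linarith, fun N j J hN hjJ hj hJ Z W hZ hW α hα => ?_⟩
  have hN1 : (1 : ℝ) ≤ N := by exact_mod_cast (by omega : 1 ≤ N)
  have hke : e ≤ k * e := Nat.le_mul_of_pos_left e hk
  obtain ⟨M, hM⟩ : ∃ M, M + 2 * e = K := ⟨K - 2 * e, Nat.sub_add_cancel (by nlinarith)⟩
  have hM' : K - 2 * e = M := by omega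
  rw [hM']
  apply root_le (m := 2 * (2 * k)) (by omega) (by linarith) (by positivity)
  refine (h N j J hN hjJ (by nlinarith) Z W hZ hW α hα).trans ?_
  have hs : (j + 2) * (4 * k - 2) + 2 * (j + 2) = 4 * k * (j + 2) := by
    rw [show 2 * (j + 2) = (j + 2) * 2 by ring, ← Nat.mul_add, show 4 * k - 2 + 2 = 4 * k by omega]; ring
  have hkM : 4 * k * M + 8 * k * e = 4 * k * j + 4 * k * J := by
    calc 4 * k * M + 8 * k * e = 4 * k * (M + 2 * e) := by ring
      _ = 4 * k * (j + J) := by rw [hM, hjJ]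
      _ = _ := by ring
  have hkJ : k * u ≤ k * J := Nat.mul_le_mul_left k hJ
  have a1 : (N : ℝ) ^ ((j + 2) * (4 * k - 2) + 4 * k + (J + 1) * (2 * k)) * (N : ℝ) ^ (j + 3 + (J + 1) * (2 * k)) ≤
      ((N : ℝ) ^ M) ^ (2 * (2 * k)) := by
    rw [← pow_add, ← pow_mul]
    apply pow_le_pow_right₀ hN1
    have : M * (2 * (2 * k)) = 4 * k * M := by ring
    rw [this]
    nlinarith
  have a2 : (N : ℝ) ^ ((j + 2) * (4 * k - 2) + 4 * k + (J + 1) * (2 * k)) * (N : ℝ) ^ (4 * j + 6 + (J + 1) * k) ≤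
      ((N : ℝ) ^ M) ^ (2 * (2 * k)) := by
    rw [← pow_add, ← pow_mul]
    apply pow_le_pow_right₀ hN1
    have : M * (2 * (2 * k)) = 4 * k * M := by ring
    rw [this]
    nlinarith
  rw [mul_add]
  have := mul_le_mul_of_nonneg_left (add_le_add a1 a2) (by linarith : (0 : ℝ) ≤ C)
  linarith

theorem typeII (K k u e : ℕ) (hk : 1 ≤ k) (hu1 : 16 * k + 8 * k * e ≤ u)
    (hu2 : 15 * k + 8 * k * e + 2 * K + 2 ≤ k * u) :
    ∃ C : ℝ, 1 ≤ C ∧ ∀ N j x : ℕ, 2 ≤ N → u ≤ j → j + u ≤ K → x ≤ N ^ K →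
    ∀ γ : ℕ → ℝ, (∀ m, 0 < m → |γ m| ≤ #m.divisors) →
    ∑ z ∈ SF x with (nn z).Prime ∧ N ^ j < nn z ∧ nn z ≤ N ^ (j + 1),
      |∑ t ∈ SF x with nn z * nn t ≤ x, (spin (z * t) : ℝ) * γ (nn t)| ≤ C * (N : ℝ) ^ (K + 4 - e) := by
  obtain ⟨C, hC, h⟩ := biPart' K k u e hk hu1 hu2
  obtain ⟨C1, hC1, h1⟩ := tau_bound (K + 1)
  have hC1' : (1 : ℝ) ≤ C1 := by exact_mod_cast hC1
  have hke : e ≤ k * e := Nat.le_mul_of_pos_left e hk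
  refine ⟨C1 * ((#clsT + 1) * (3 * C + C1 * C1)), ?_, fun N j x hN hj hjK hx γ hγ => ?_⟩
  · apply one_le_mul_of_one_le_of_one_le hC1'
    apply one_le_mul_of_one_le_of_one_le (by linarith [Nat.cast_nonneg (α := ℝ) (#clsT)])
    nlinarith
  have hN0 : 0 < N := by omega
  have hN1 : (1 : ℝ) ≤ N := by exact_mod_cast hN0
  obtain ⟨J, hJ⟩ : ∃ J, j + J = K := ⟨K - j, by omega⟩
  have heJ : e ≤ J := by nlinarith
  obtain ⟨J', hJ'⟩ : ∃ J', J' + e = J := ⟨J - e, by omega⟩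
  set Z := ({z ∈ SF x | (nn z).Prime ∧ N ^ j < nn z ∧ nn z ≤ N ^ (j + 1)} : Finset _) with hZdef
  have hZ : ∀ z ∈ Z, IsS z ∧ (nn z).Prime ∧ nn z ≤ N ^ (j + 1) := by
    intro z hz
    simp only [hZdef, Finset.mem_filter, mem_SF'] at hz
    exact ⟨hz.1.1, hz.2.1, hz.2.2.2⟩
  have hZj : ∀ z ∈ Z, N ^ j < nn z := by
    intro z hz
    simp only [hZdef, Finset.mem_filter, mem_SF'] at hz
    exact hz.2.2.1
  let W : (ℤ × ℤ × ℤ × ℕ) → Finset (ℤ√2) := fun i => {t ∈ SF (N ^ J) | cw t = i}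
  have hW : ∀ i, ∀ w ∈ W i, IsS w ∧ nn w ≤ N ^ J := by
    intro i w hw
    simp only [W, Finset.mem_filter, mem_SF'] at hw
    exact hw.1
  have tauW : ∀ m : ℕ, 0 < m → m ≤ N ^ (K + 1) → #m.divisors ≤ C1 * N := fun m h h' => h1 N m hN0 h h'
  have hJK : N ^ J ≤ N ^ (K + 1) := Nat.pow_le_pow_right hN0 (by omega)
  have hjK' : N ^ (j + 1) ≤ N ^ (K + 1) := Nat.pow_le_pow_right hN0 (by omega)
  let f : ℤ√2 → ℕ := fun z => x / nn z + 1
  let α : ℤ√2 → ℝ := fun t => fw t * γ (nn t) / (C1 * N)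
  have hCN : (0 : ℝ) < C1 * N := by positivity
  have hα : ∀ i, ∀ w ∈ W i, |α w| ≤ 1 := by
    intro i w hw
    have hw' := hW i w hw
    have h2 : |γ (nn w)| ≤ C1 * N := (hγ _ hw'.1.tp.nn_pos).trans
      (by exact_mod_cast tauW _ hw'.1.tp.nn_pos (hw'.2.trans hJK))
    simp only [α]
    rw [abs_div, abs_mul, abs_of_pos hCN, div_le_one hCN]
    calc |fw w| * |γ (nn w)| ≤ 1 * |γ (nn w)| := by gcongr; exact abs_fw w
      _ ≤ _ := by rw [one_mul]; exact h2
  have hfle : ∀ z ∈ Z, x / nn z ≤ N ^ J := by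
    intro z hz
    calc x / nn z ≤ N ^ K / N ^ j := Nat.div_le_div hx (hZj z hz).le (by positivity)
      _ = N ^ J := by rw [← hJ, pow_add]; exact Nat.mul_div_cancel_left _ (by positivity)
  have hinner : ∀ z ∈ Z, ∑ t ∈ SF x with nn z * nn t ≤ x, (spin (z * t) : ℝ) * γ (nn t) =
      C1 * N * ∑ i ∈ clsT, kap z i * ∑ t ∈ W i with nn t < f z, α t * chi z t := by
    intro z hz
    have hz' := hZ z hz
    have hzp := hz'.1.tp.nn_pos
    have e1 : ({t ∈ SF x | nn z * nn t ≤ x} : Finset _) = {t ∈ SF (N ^ J) | nn t < f z} := by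
      ext t
      simp only [Finset.mem_filter, mem_SF', f, Nat.lt_succ_iff, Nat.le_div_iff_mul_le hzp]
      rw [mul_comm (nn t)]
      constructor
      · rintro ⟨⟨a, b⟩, c⟩
        refine ⟨⟨a, ?_⟩, c⟩
        exact le_trans ((Nat.le_div_iff_mul_le hzp).2 (by rw [mul_comm]; exact c)) (hfle z hz)
      · rintro ⟨⟨a, b⟩, c⟩
        exact ⟨⟨a, le_trans (Nat.le_mul_of_pos_left _ hzp) c⟩, c⟩
    rw [e1, ← Finset.sum_fiberwise_of_maps_to (t := clsT) (g := cw) (fun t _ => cw_mem t), Finset.mul_sum]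
    apply Finset.sum_congr rfl
    intro i _
    rw [Finset.mul_sum, Finset.mul_sum]
    have e2 : ({t ∈ ({t ∈ SF (N ^ J) | nn t < f z} : Finset _) | cw t = i} : Finset _) = {t ∈ W i | nn t < f z} := by
      simp only [W]; rw [Finset.filter_filter, Finset.filter_filter]; congr 1; ext t; tauto
    rw [e2]
    apply Finset.sum_congr rfl
    intro t ht
    rw [Finset.mem_filter] at ht
    have ht' := hW i t ht.1
    have hcw : cw t = i := by
      have := ht.1
      simp only [W, Finset.mem_filter] at this; exact this.2
    rw [spin_factor hz'.1 ht'.1 hz'.2.1, hcw]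
    simp only [α]
    field_simp
  have cZ : (#Z : ℝ) ≤ C1 * (N : ℝ) ^ (j + 2) := by
    have := card_S Z (Icc 1 (N ^ (j + 1))) (C1 * N) (fun w hw => ⟨(hZ w hw).1, Finset.mem_Icc.2 ⟨(hZ w hw).1.tp.nn_pos, (hZ w hw).2.2⟩⟩)
      (fun m hm h => tauW m h ((Finset.mem_Icc.1 hm).2.trans hjK'))
    rw [Nat.card_Icc, Nat.add_sub_cancel] at this
    have h3 : (#Z : ℝ) ≤ ((C1 * N * N ^ (j + 1) : ℕ) : ℝ) := by exact_mod_cast this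
    refine h3.trans (le_of_eq ?_)
    push_cast; ring
  obtain ⟨M, hM⟩ : ∃ M, M + 2 * e = K := ⟨K - 2 * e, Nat.sub_add_cancel (by nlinarith)⟩
  have hM' : K - 2 * e = M := by omega
  have hi : ∀ i ∈ clsT, ∑ z ∈ Z, |∑ t ∈ W i with nn t < f z, α t * chi z t| ≤
      (3 * C + C1 * C1) * (N : ℝ) ^ (M + e + 3) := by
    intro i _
    have hd := decouple Z (W i) (fun z t => α t * chi z t) (fun z _ w hw => by
        rw [abs_mul]; exact mul_le_one₀ (hα i w hw) (abs_nonneg _) (abs_chi z w)) nn f (2 * N ^ J) (N ^ J')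
      (by positivity) (fun z hz => by
        have := hfle z hz
        have h2 : 1 ≤ N ^ J := Nat.one_le_pow _ _ hN0
        simp only [f]; omega) (C * (N : ℝ) ^ M) (((C1 * N * N ^ J' : ℕ) : ℝ))
      (fun t => by
        rw [← hM']
        exact h N j J hN hJ hj (by omega) Z _ hZ (fun w hw => hW i w (Finset.mem_filter.1 hw).1) α
          (fun w hw => hα i w (Finset.mem_filter.1 hw).1))
      (fun t => by
        apply Nat.cast_le.2
        refine (card_S _ (Ico t (t + N ^ J') ∩ Icc 1 (N ^ J)) (C1 * N) ?_ ?_).trans ?_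
        · intro w hw
          rw [Finset.mem_filter] at hw
          have hw' := hW i w hw.1
          exact ⟨hw'.1, Finset.mem_inter.2 ⟨Finset.mem_Ico.2 hw.2, Finset.mem_Icc.2 ⟨hw'.1.tp.nn_pos, hw'.2⟩⟩⟩
        · intro m hm h
          exact tauW m h ((Finset.mem_Icc.1 (Finset.mem_inter.1 hm).2).2.trans hJK)
        · apply Nat.mul_le_mul_left
          refine (Finset.card_le_card Finset.inter_subset_left).trans (by simp))
    refine hd.trans ?_
    have e1 : 2 * N ^ J / N ^ J' = 2 * N ^ e := by
      rw [← hJ', pow_add, show 2 * (N ^ J' * N ^ e) = (2 * N ^ e) * N ^ J' by ring]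
      exact Nat.mul_div_cancel _ (by positivity)
    rw [e1]
    have hNe : (1 : ℝ) ≤ (N : ℝ) ^ e := one_le_pow₀ hN1
    have x1 : (((2 * N ^ e : ℕ) : ℝ) + 1) * (C * (N : ℝ) ^ M) ≤ 3 * C * (N : ℝ) ^ (M + e + 3) := by
      calc _ ≤ (3 * (N : ℝ) ^ e) * (C * (N : ℝ) ^ M) := by
            gcongr
            push_cast; linarith
        _ = 3 * C * (N : ℝ) ^ (M + e) := by rw [pow_add]; ring
        _ ≤ _ := by
          apply mul_le_mul_of_nonneg_left (pow_le_pow_right₀ hN1 (by omega)) (by linarith)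
    have x2 : (#Z : ℝ) * ((C1 * N * N ^ J' : ℕ) : ℝ) ≤ C1 * C1 * (N : ℝ) ^ (M + e + 3) := by
      calc _ ≤ (C1 * (N : ℝ) ^ (j + 2)) * ((C1 * N * N ^ J' : ℕ) : ℝ) := by gcongr
        _ = C1 * C1 * (N : ℝ) ^ (j + 2 + 1 + J') := by push_cast; rw [pow_add, pow_add]; ring
        _ = _ := by congr 2; omega
    linarith
  have hfin : ∑ z ∈ Z, |∑ t ∈ SF x with nn z * nn t ≤ x, (spin (z * t) : ℝ) * γ (nn t)| ≤
      C1 * N * ∑ i ∈ clsT, ∑ z ∈ Z, |∑ t ∈ W i with nn t < f z, α t * chi z t| := by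
    rw [Finset.sum_comm, Finset.mul_sum]
    apply Finset.sum_le_sum
    intro z hz
    rw [hinner z hz, abs_mul, abs_of_pos hCN]
    gcongr
    refine (Finset.abs_sum_le_sum_abs _ _).trans ?_
    apply Finset.sum_le_sum
    intro i _
    rw [abs_mul]
    calc _ ≤ 1 * |∑ t ∈ W i with nn t < f z, α t * chi z t| := by gcongr; exact abs_kap z i
      _ = _ := one_mul _
  refine hfin.trans ?_
  have hs := Finset.sum_le_sum hi
  rw [Finset.sum_const, nsmul_eq_mul] at hs
  calc _ ≤ C1 * N * (#clsT * ((3 * C + C1 * C1) * (N : ℝ) ^ (M + e + 3))) := by gcongr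
    _ ≤ C1 * N * ((#clsT + 1) * ((3 * C + C1 * C1) * (N : ℝ) ^ (M + e + 3))) := by gcongr; linarith
    _ = _ := by
      rw [show K + 4 - e = M + e + 3 + 1 by omega, pow_succ (N : ℝ) (M + e + 3)]; ring

end SpinDensity

namespace SpinDensity
open Finset
open scoped Classical
open scoped ArithmeticFunction.Moebius ArithmeticFunction.vonMangoldt ArithmeticFunction.zeta

/-- truncation to `n ≤ U` -/
noncomputable def trlo (f : ArithmeticFunction ℝ) (U : ℕ) : ArithmeticFunction ℝ :=
  ⟨fun n => if n ≤ U then f n else 0, by simp⟩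

/-- truncation to `n > U` -/
noncomputable def trhi (f : ArithmeticFunction ℝ) (U : ℕ) : ArithmeticFunction ℝ :=
  ⟨fun n => if n ≤ U then 0 else f n, by simp⟩

theorem trlo_apply (f : ArithmeticFunction ℝ) (U n : ℕ) : trlo f U n = if n ≤ U then f n else 0 := rfl
theorem trhi_apply (f : ArithmeticFunction ℝ) (U n : ℕ) : trhi f U n = if n ≤ U then 0 else f n := rfl

theorem tr_add (f : ArithmeticFunction ℝ) (U : ℕ) : trlo f U + trhi f U = f := by
  ext n
  rw [ArithmeticFunction.add_apply, trlo_apply, trhi_apply]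
  split_ifs <;> simp

/-- real Moebius -/
noncomputable def muR : ArithmeticFunction ℝ := ((μ : ArithmeticFunction ℤ) : ArithmeticFunction ℝ)
noncomputable def zeR : ArithmeticFunction ℝ := ((ζ : ArithmeticFunction ℕ) : ArithmeticFunction ℝ)

theorem muR_zeR : muR * zeR = 1 := ArithmeticFunction.coe_moebius_mul_coe_zeta

theorem abs_muR (n : ℕ) : |muR n| ≤ 1 := by
  have : |(μ n : ℤ)| ≤ 1 := ArithmeticFunction.abs_moebius_le_one
  rw [muR, ArithmeticFunction.intCoe_apply]
  exact_mod_cast this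

theorem La_zeR : Λ * zeR = ArithmeticFunction.log := ArithmeticFunction.vonMangoldt_mul_zeta

noncomputable def gam (U : ℕ) : ArithmeticFunction ℝ := zeR * trhi muR U

theorem vaughan (U V : ℕ) : (Λ : ArithmeticFunction ℝ) = trlo Λ V + trlo muR U * ArithmeticFunction.log
    - (trlo Λ V * trlo muR U) * zeR + trhi Λ V * gam U := by
  have h1 := tr_add Λ V
  have h2 := tr_add muR U
  have h3 := muR_zeR
  rw [← La_zeR, gam]
  rw [← h2] at h3
  calc (Λ : ArithmeticFunction ℝ) = trlo Λ V + trhi Λ V * 1 := by rw [mul_one, h1]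
    _ = trlo Λ V + trhi Λ V * ((trlo muR U + trhi muR U) * zeR) := by rw [h3]
    _ = trlo Λ V + trlo muR U * ((trlo Λ V + trhi Λ V) * zeR) - trlo Λ V * trlo muR U * zeR + trhi Λ V * (zeR * trhi muR U) := by ring
    _ = _ := by rw [h1]

theorem zeR_apply {n : ℕ} (h : n ≠ 0) : zeR n = 1 := by
  rw [zeR, ArithmeticFunction.natCoe_apply, ArithmeticFunction.zeta_apply_ne h]; simp

theorem mul_apply' (f g : ArithmeticFunction ℝ) (n : ℕ) :
    (f * g) n = ∑ d ∈ n.divisors, f d * g (n / d) := by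
  rw [ArithmeticFunction.mul_apply, Nat.sum_divisorsAntidiagonal (fun a b => f a * g b)]

theorem mul_zeR (f : ArithmeticFunction ℝ) (n : ℕ) : (f * zeR) n = ∑ d ∈ n.divisors, f d := by
  rw [mul_apply']
  apply Finset.sum_congr rfl
  intro d hd
  have hd' := Nat.mem_divisors.1 hd
  have hn : n / d ≠ 0 := (Nat.div_pos (Nat.le_of_dvd (Nat.pos_of_ne_zero hd'.2) hd'.1) (Nat.pos_of_mem_divisors hd)).ne'
  rw [zeR_apply hn, mul_one]

theorem gam_apply (U m : ℕ) : gam U m = ∑ d ∈ m.divisors, trhi muR U d := by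
  rw [gam, mul_comm, mul_zeR]

theorem gam_zero {U m : ℕ} (h : m ≤ U) : gam U m = 0 := by
  rw [gam_apply]
  apply Finset.sum_eq_zero
  intro d hd
  rw [trhi_apply, if_pos ((Nat.divisor_le hd).trans h)]

theorem abs_gam (U m : ℕ) : |gam U m| ≤ #m.divisors := by
  rw [gam_apply]
  refine (Finset.abs_sum_le_sum_abs _ _).trans ?_
  calc _ ≤ ∑ d ∈ m.divisors, (1 : ℝ) := by
        apply Finset.sum_le_sum
        intro d _
        rw [trhi_apply]
        split_ifs
        · simp
        · exact abs_muR d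
    _ = _ := by simp

theorem abs_beta (U V q : ℕ) : |(trlo Λ V * trlo muR U) q| ≤ Real.log q := by
  rw [mul_apply', ← ArithmeticFunction.vonMangoldt_sum]
  refine (Finset.abs_sum_le_sum_abs _ _).trans ?_
  apply Finset.sum_le_sum
  intro d _
  rw [abs_mul]
  have h1 : |trlo Λ V d| ≤ Λ d := by
    rw [trlo_apply]
    split_ifs
    · rw [abs_of_nonneg ArithmeticFunction.vonMangoldt_nonneg]
    · simpa using ArithmeticFunction.vonMangoldt_nonneg
  have h2 : |trlo muR U (q / d)| ≤ 1 := by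
    rw [trlo_apply]
    split_ifs
    · exact abs_muR _
    · simp
  calc _ ≤ Λ d * 1 := mul_le_mul h1 h2 (abs_nonneg _) ArithmeticFunction.vonMangoldt_nonneg
    _ = _ := mul_one _

theorem beta_zero {U V q : ℕ} (h : V * U < q) : (trlo Λ V * trlo muR U) q = 0 := by
  rw [mul_apply']
  apply Finset.sum_eq_zero
  intro d hd
  rw [trlo_apply, trlo_apply]
  by_cases h1 : d ≤ V
  · have h3 : ¬ (q / d ≤ U) := by
      intro h2
      have := Nat.mul_le_mul h1 h2
      rw [Nat.mul_div_cancel' (Nat.dvd_of_mem_divisors hd)] at this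
      omega
    rw [if_neg h3, mul_zero]
  · rw [if_neg h1, zero_mul]

theorem swap_div (x : ℕ) (a : ℤ√2 → ℝ) (F : ℕ → ℕ → ℝ) :
    ∑ w ∈ SF x, a w * ∑ d ∈ (nn w).divisors, F d (nn w) =
    ∑ d ∈ Icc 1 x, ∑ w ∈ SF x with d ∣ nn w, a w * F d (nn w) := by
  simp_rw [Finset.sum_filter]
  rw [Finset.sum_comm]
  apply Finset.sum_congr rfl
  intro w hw
  have hw' := mem_SF'.1 hw
  have hp := hw'.1.tp.nn_pos
  rw [Finset.mul_sum, ← Finset.sum_filter]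
  apply Finset.sum_congr
  · ext d
    simp only [Nat.mem_divisors, Finset.mem_filter, Finset.mem_Icc]
    constructor
    · rintro ⟨h1, h2⟩
      exact ⟨⟨Nat.pos_of_dvd_of_pos h1 hp, (Nat.le_of_dvd hp h1).trans hw'.2⟩, h1⟩
    · rintro ⟨h1, h2⟩; exact ⟨h2, hp.ne'⟩
  · intros; rfl

theorem abel_mono {ι : Type*} (S : Finset ι) (key : ι → ℕ) (a : ι → ℝ) (g : ℕ → ℝ) (x : ℕ) (B : ℝ)
    (hk : ∀ i ∈ S, key i ≤ x) (hg : Monotone g) (hg0 : g 0 = 0)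
    (hB : ∀ y ≤ x, |∑ i ∈ S with key i ≤ y, a i| ≤ B) :
    |∑ i ∈ S, a i * g (key i)| ≤ 2 * B * g x := by
  have h1 : ∀ i ∈ S, a i * g (key i) = ∑ y ∈ range x, (g (y + 1) - g y) * (if key i ≤ y then 0 else a i) := by
    intro i hi
    have : ∑ y ∈ range x, (g (y + 1) - g y) * (if key i ≤ y then 0 else a i) =
        ∑ y ∈ range (key i), (g (y + 1) - g y) * a i := by
      rw [← Finset.sum_filter_add_sum_filter_not (range x) (fun y => key i ≤ y)]
      have e1 : ∑ y ∈ range x with key i ≤ y, (g (y + 1) - g y) * (if key i ≤ y then 0 else a i) = 0 := by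
        apply Finset.sum_eq_zero
        intro y hy
        rw [if_pos (Finset.mem_filter.1 hy).2, mul_zero]
      rw [e1, zero_add]
      apply Finset.sum_congr
      · ext y
        have := hk i hi
        simp only [Finset.mem_filter, Finset.mem_range]; omega
      · intro y hy
        rw [Finset.mem_range] at hy
        rw [if_neg (by omega)]
    rw [this, ← Finset.sum_mul, Finset.sum_range_sub, hg0, sub_zero, mul_comm]
  rw [Finset.sum_congr rfl h1, Finset.sum_comm]
  refine (Finset.abs_sum_le_sum_abs _ _).trans ?_
  calc _ ≤ ∑ y ∈ range x, (g (y + 1) - g y) * (2 * B) := by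
        apply Finset.sum_le_sum
        intro y hy
        rw [Finset.mem_range] at hy
        rw [← Finset.mul_sum, abs_mul, abs_of_nonneg (sub_nonneg.2 (hg (Nat.le_succ y)))]
        apply mul_le_mul_of_nonneg_left _ (sub_nonneg.2 (hg (Nat.le_succ y)))
        have e : ∑ i ∈ S, (if key i ≤ y then 0 else a i) =
            ∑ i ∈ S with key i ≤ x, a i - ∑ i ∈ S with key i ≤ y, a i := by
          rw [Finset.sum_filter, Finset.sum_filter, ← Finset.sum_sub_distrib]
          apply Finset.sum_congr rfl
          intro i hi
          rw [if_pos (hk i hi)]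
          split_ifs <;> simp
        rw [e]
        refine (abs_sub _ _).trans ?_
        linarith [hB x le_rfl, hB y hy.le]
    _ = _ := by rw [← Finset.sum_mul, Finset.sum_range_sub, hg0]; ring

theorem log_mono : Monotone (fun n : ℕ => Real.log n) := by
  intro a b h
  rcases Nat.eq_zero_or_pos a with h0 | h0
  · subst h0
    simp only [Nat.cast_zero, Real.log_zero]
    exact Real.log_natCast_nonneg b
  · exact Real.log_le_log (by exact_mod_cast h0) (by exact_mod_cast h)

theorem log_le {N K n : ℕ} (hn : n ≤ N ^ K) : Real.log n ≤ K * N := by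
  refine (log_mono hn).trans ?_
  simp only
  push_cast
  rw [Real.log_pow]
  have := Real.log_le_self (Nat.cast_nonneg (α := ℝ) N)
  gcongr

end SpinDensity

namespace SpinDensity
open Finset
open scoped Classical
open scoped ArithmeticFunction.Moebius ArithmeticFunction.vonMangoldt ArithmeticFunction.zeta

theorem abs_spinR (w : ℤ√2) : |(spin w : ℝ)| ≤ 1 := by
  have := abs_spin w
  exact_mod_cast this

theorem SF_nn_pos {x : ℕ} {w : ℤ√2} (hw : w ∈ SF x) : 0 < nn w := (mem_SF'.1 hw).1.tp.nn_pos

theorem La_le {N K n : ℕ} (hn : n ≤ N ^ K) : |Λ n| ≤ K * N := by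
  rw [abs_of_nonneg ArithmeticFunction.vonMangoldt_nonneg]
  exact ArithmeticFunction.vonMangoldt_le_log.trans (log_le hn)

theorem card_SF_le (K : ℕ) : ∃ C : ℝ, 1 ≤ C ∧ ∀ N y : ℕ, 2 ≤ N → y ≤ N ^ K → (#(SF y) : ℝ) ≤ C * N * y := by
  obtain ⟨C, hC, h⟩ := tau_bound K
  refine ⟨C, by exact_mod_cast hC, fun N y hN hy => ?_⟩
  have := card_S (SF y) (Icc 1 y) (C * N) (fun w hw => ⟨(mem_SF'.1 hw).1, by
      rw [Finset.mem_Icc]; exact ⟨SF_nn_pos hw, (mem_SF'.1 hw).2⟩⟩)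
    (fun m hm h0 => h N m (by omega) h0 ((Finset.mem_Icc.1 hm).2.trans hy))
  rw [Nat.card_Icc] at this
  have h2 : #(SF y) ≤ C * N * y := by simpa using this
  exact_mod_cast h2

theorem sub_SF {x y : ℕ} (h : y ≤ x) (d : ℕ) :
    ((SF x).filter fun w => d ∣ nn w).filter (fun w => nn w ≤ y) = (SF y).filter fun w => d ∣ nn w := by
  ext w
  simp only [Finset.mem_filter, mem_SF']
  constructor
  · rintro ⟨⟨⟨h1, h2⟩, h3⟩, h4⟩; exact ⟨⟨h1, h4⟩, h3⟩
  · rintro ⟨⟨h1, h2⟩, h3⟩; exact ⟨⟨⟨h1, h2.trans h⟩, h3⟩, h2⟩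

theorem termA (K u : ℕ) (hu : u ≤ K) : ∃ C : ℝ, 1 ≤ C ∧ ∀ N x : ℕ, 2 ≤ N → 
    ∑ w ∈ SF x with nn w ≤ N ^ u, |Λ (nn w)| ≤ C * (N : ℝ) ^ (u + 2) := by
  obtain ⟨C, hC, h⟩ := card_SF_le K
  refine ⟨C * (K + 1), by nlinarith [(Nat.cast_nonneg K : (0:ℝ) ≤ K)], fun N x hN => ?_⟩
  have hN1 : 1 ≤ N := by omega
  have hle : N ^ u ≤ N ^ K := pow_le_pow_right₀ hN1 hu
  have h1 := h N (N ^ u) hN hle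
  have h2 : #((SF x).filter fun w => nn w ≤ N ^ u) ≤ #(SF (N ^ u)) := by
    apply Finset.card_le_card
    intro w hw
    rw [Finset.mem_filter, mem_SF'] at hw
    exact mem_SF'.2 ⟨hw.1.1, hw.2⟩
  have h3 : ∑ w ∈ SF x with nn w ≤ N ^ u, |Λ (nn w)| ≤ #((SF x).filter fun w => nn w ≤ N ^ u) • ((K : ℝ) * N) := by
    apply Finset.sum_le_card_nsmul
    intro w hw
    exact La_le ((Finset.mem_filter.1 hw).2.trans hle)
  refine h3.trans ?_
  rw [nsmul_eq_mul]
  have h4 : ((#((SF x).filter fun w => nn w ≤ N ^ u) : ℕ) : ℝ) ≤ C * N * (N ^ u : ℕ) := le_trans (by exact_mod_cast h2) h1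
  calc _ ≤ (C * N * (N ^ u : ℕ)) * ((K : ℝ) * N) := by gcongr
    _ = C * K * (N : ℝ) ^ (u + 2) := by push_cast; ring
    _ ≤ _ := by gcongr; linarith

theorem badCard (K : ℕ) : ∃ C : ℝ, 1 ≤ C ∧ ∀ N x t : ℕ, 2 ≤ N → x ≤ N ^ K → t ≤ K →
    (#((SF x).filter fun w => ∃ s, N ^ t < s ∧ s ^ 2 ∣ nn w) : ℝ) ≤ C * (N : ℝ) ^ (K + 1 - t) := by
  obtain ⟨C, hC, h⟩ := tau_bound K
  refine ⟨C, by exact_mod_cast hC, fun N x t hN hx ht => ?_⟩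
  have hN1 : 1 ≤ N := by omega
  have hN0 : (0:ℝ) < N := by exact_mod_cast hN1
  have h1 := card_S ((SF x).filter fun w => ∃ s, N ^ t < s ∧ s ^ 2 ∣ nn w)
    ((Icc 1 x).filter fun n => ∃ s, N ^ t < s ∧ s ^ 2 ∣ n) (C * N) (fun w hw => by
      rw [Finset.mem_filter] at hw
      exact ⟨(mem_SF'.1 hw.1).1, Finset.mem_filter.2 ⟨Finset.mem_Icc.2 ⟨SF_nn_pos hw.1, (mem_SF'.1 hw.1).2⟩, hw.2⟩⟩)
    (fun m hm h0 => h N m (by omega) h0 ((Finset.mem_Icc.1 (Finset.mem_filter.1 hm).1).2.trans hx))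
  have h2 : (#((Icc 1 x).filter fun n => ∃ s, N ^ t < s ∧ s ^ 2 ∣ n) : ℝ) ≤ (N : ℝ) ^ (K - t) := by
    have hsub : ((Icc 1 x).filter fun n => ∃ s, N ^ t < s ∧ s ^ 2 ∣ n) ⊆
        (Ioc (N ^ t) (max (N ^ t + 1) x)).biUnion fun s => (Ioc 0 x).filter fun n => s ^ 2 ∣ n := by
      intro n hn
      rw [Finset.mem_filter, Finset.mem_Icc] at hn
      obtain ⟨⟨h1, h2⟩, s, hs, hd⟩ := hn
      rw [Finset.mem_biUnion]
      have : s ≤ n := by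
        have h5 := Nat.le_of_dvd (by omega) hd
        nlinarith [Nat.zero_le s]
      refine ⟨s, Finset.mem_Ioc.2 ⟨hs, le_max_of_le_right (this.trans h2)⟩, Finset.mem_filter.2 ⟨Finset.mem_Ioc.2 ⟨by omega, h2⟩, hd⟩⟩
    have h3 := (Finset.card_le_card hsub).trans Finset.card_biUnion_le
    have h4 : (#((Icc 1 x).filter fun n => ∃ s, N ^ t < s ∧ s ^ 2 ∣ n) : ℝ) ≤ 
        ∑ s ∈ Ioc (N ^ t) (max (N ^ t + 1) x), (x : ℝ) * ((s : ℝ) ^ 2)⁻¹ := by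
      refine le_trans (Nat.cast_le.2 h3) ?_
      push_cast
      apply Finset.sum_le_sum
      intro s hs
      rw [Nat.Ioc_filter_dvd_card_eq_div]
      refine Nat.cast_div_le.trans ?_
      push_cast
      rw [div_eq_mul_inv]
    refine h4.trans ?_
    rw [← Finset.mul_sum]
    have h5 := sum_Ioc_inv_sq_le_sub (α := ℝ) (k := N ^ t) (n := max (N ^ t + 1) x) (pow_pos hN1 t).ne' (by omega)
    have h6 : ∑ s ∈ Ioc (N ^ t) (max (N ^ t + 1) x), ((s : ℝ) ^ 2)⁻¹ ≤ ((N ^ t : ℕ) : ℝ)⁻¹ := by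
      refine h5.trans ?_
      have : (0:ℝ) ≤ ((max (N ^ t + 1) x : ℕ) : ℝ)⁻¹ := by positivity
      linarith
    calc _ ≤ ((N ^ K : ℕ) : ℝ) * ((N ^ t : ℕ) : ℝ)⁻¹ := by gcongr
      _ = _ := by
        push_cast
        rw [← div_eq_mul_inv, pow_sub₀ _ hN0.ne' ht, div_eq_mul_inv]
  calc _ ≤ ((C * N * #((Icc 1 x).filter fun n => ∃ s, N ^ t < s ∧ s ^ 2 ∣ n) : ℕ) : ℝ) := by exact_mod_cast h1
    _ = C * N * (#((Icc 1 x).filter fun n => ∃ s, N ^ t < s ∧ s ^ 2 ∣ n) : ℝ) := by push_cast; ring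
    _ ≤ C * N * (N : ℝ) ^ (K - t) := by gcongr
    _ = _ := by rw [show K + 1 - t = (K - t) + 1 by omega]; ring

/-- proper prime powers have a large square divisor -/
theorem bad_of_pp {N t d : ℕ} (h1 : N ^ (3 * t) < d) (h2 : IsPrimePow d) (h3 : ¬ d.Prime) :
    ∃ s, N ^ t < s ∧ s ^ 2 ∣ d := by
  rw [isPrimePow_nat_iff] at h2
  obtain ⟨p, a, hp, ha, rfl⟩ := h2
  have ha2 : 2 ≤ a := by
    by_contra hc
    have : a = 1 := by omega
    subst this
    simp [hp] at h3
  refine ⟨p ^ (a / 2), ?_, ?_⟩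
  · have : N ^ (3 * t) < p ^ (a / 2 * 3) := h1.trans_le (Nat.pow_le_pow_right hp.pos (by omega))
    rw [mul_comm 3 t, pow_mul, pow_mul p] at this
    exact lt_of_pow_lt_pow_left₀ 3 (Nat.zero_le _) this
  · rw [← pow_mul]
    exact pow_dvd_pow _ (by omega)

theorem termB (c u : ℕ) : ∃ C : ℝ, 1 ≤ C ∧ ∀ N x : ℕ, 2 ≤ N → x ≤ N ^ (32 * c + 16) →
    |∑ w ∈ SF x, (spin w : ℝ) * (trlo muR (N ^ u) * ArithmeticFunction.log) (nn w)| ≤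
      C * (N : ℝ) ^ (2 * u + 1 + (31 * c + 16)) := by
  obtain ⟨C, hC, h⟩ := typeI c
  set K := 32 * c + 16 with hK
  refine ⟨3 * C * K, ?_, fun N x hN hx => ?_⟩
  · have : (1:ℝ) ≤ K := by exact_mod_cast (by omega : 1 ≤ K)
    nlinarith
  have hN1 : 1 ≤ N := by omega
  simp_rw [mul_apply']
  rw [swap_div x (fun w => (spin w : ℝ)) (fun d n => trlo muR (N ^ u) d * ArithmeticFunction.log (n / d))]
  have key : ∀ d ∈ Icc 1 x, |∑ w ∈ SF x with d ∣ nn w, (spin w : ℝ) * (trlo muR (N ^ u) d * ArithmeticFunction.log (nn w / d))|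
      ≤ if d ≤ N ^ u then 3 * (C * (N : ℝ) ^ u * (N : ℝ) ^ (31 * c + 16)) * (K * N) else 0 := by
    intro d hd
    rw [Finset.mem_Icc] at hd
    rw [trlo_apply]
    split_ifs with hdU
    · have e : ∑ w ∈ SF x with d ∣ nn w, (spin w : ℝ) * (muR d * ArithmeticFunction.log (nn w / d)) =
          muR d * (∑ w ∈ SF x with d ∣ nn w, (spin w : ℝ) * Real.log (nn w) - Real.log d * ∑ w ∈ SF x with d ∣ nn w, (spin w : ℝ)) := by
        rw [mul_sub, Finset.mul_sum, Finset.mul_sum, Finset.mul_sum, ← Finset.sum_sub_distrib]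
        apply Finset.sum_congr rfl
        intro w hw
        rw [Finset.mem_filter] at hw
        have h0 := SF_nn_pos hw.1
        have hd0 : (d : ℝ) ≠ 0 := by exact_mod_cast (by omega : d ≠ 0)
        have hw0 : (nn w : ℝ) ≠ 0 := by exact_mod_cast h0.ne'
        rw [ArithmeticFunction.log_apply, Nat.cast_div hw.2 hd0, Real.log_div hw0 hd0]
        ring
      rw [e, abs_mul]
      have hB : ∀ y ≤ x, |∑ w ∈ (SF x).filter (fun w => d ∣ nn w) with nn w ≤ y, (spin w : ℝ)| ≤ C * (N : ℝ) ^ u * (N : ℝ) ^ (31 * c + 16) := by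
        intro y hy
        rw [sub_SF hy]
        refine (h N y d hN (hy.trans hx) (by omega)).trans ?_
        have : (d : ℝ) ≤ (N : ℝ) ^ u := by exact_mod_cast hdU
        gcongr
      have hB2 := hB x le_rfl
      rw [sub_SF le_rfl] at hB2
      have hA := abel_mono ((SF x).filter (fun w => d ∣ nn w)) nn (fun w => (spin w : ℝ)) (fun n => Real.log n) x _
        (fun w hw => (mem_SF'.1 (Finset.mem_filter.1 hw).1).2) log_mono (by simp) hB
      have hlx : Real.log x ≤ K * N := log_le hx
      have hld : Real.log d ≤ K * N := log_le (hd.2.trans hx)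
      have hld0 : 0 ≤ Real.log d := Real.log_natCast_nonneg d
      have hBp : 0 ≤ C * (N : ℝ) ^ u * (N : ℝ) ^ (31 * c + 16) := by positivity
      set B := C * (N : ℝ) ^ u * (N : ℝ) ^ (31 * c + 16)
      calc _ ≤ 1 * (2 * B * (K * N) + (K * N) * B) := by
            apply mul_le_mul (abs_muR d) _ (abs_nonneg _) zero_le_one
            refine (abs_sub _ _).trans ?_
            apply add_le_add
            · refine hA.trans ?_
              gcongr
            · rw [abs_mul, abs_of_nonneg hld0]
              gcongr
        _ = _ := by ring
    · simp
  refine (Finset.abs_sum_le_sum_abs _ _).trans ((Finset.sum_le_sum key).trans ?_)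
  rw [← Finset.sum_filter, Finset.sum_const, nsmul_eq_mul]
  have hc : #((Icc 1 x).filter fun d => d ≤ N ^ u) ≤ N ^ u := by
    have : ((Icc 1 x).filter fun d => d ≤ N ^ u) ⊆ Icc 1 (N ^ u) := by
      intro d; simp only [Finset.mem_filter, Finset.mem_Icc]; omega
    simpa using Finset.card_le_card this
  have hc' : (#((Icc 1 x).filter fun d => d ≤ N ^ u) : ℝ) ≤ (N : ℝ) ^ u := by exact_mod_cast hc
  calc _ ≤ (N : ℝ) ^ u * (3 * (C * (N : ℝ) ^ u * (N : ℝ) ^ (31 * c + 16)) * (K * N)) := by gcongr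
    _ = _ := by ring

theorem termC (c u : ℕ) : ∃ C : ℝ, 1 ≤ C ∧ ∀ N x : ℕ, 2 ≤ N → x ≤ N ^ (32 * c + 16) →
    |∑ w ∈ SF x, (spin w : ℝ) * (trlo Λ (N ^ u) * trlo muR (N ^ u) * zeR) (nn w)| ≤
      C * (N : ℝ) ^ (4 * u + 1 + (31 * c + 16)) := by
  obtain ⟨C, hC, h⟩ := typeI c
  set K := 32 * c + 16 with hK
  refine ⟨C * K, ?_, fun N x hN hx => ?_⟩
  · have : (1:ℝ) ≤ K := by exact_mod_cast (by omega : 1 ≤ K)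
    nlinarith
  have hN1 : 1 ≤ N := by omega
  simp_rw [mul_zeR]
  rw [swap_div x (fun w => (spin w : ℝ)) (fun d _ => (trlo Λ (N ^ u) * trlo muR (N ^ u)) d)]
  have key : ∀ d ∈ Icc 1 x, |∑ w ∈ SF x with d ∣ nn w, (spin w : ℝ) * (trlo Λ (N ^ u) * trlo muR (N ^ u)) d|
      ≤ if d ≤ N ^ (2 * u) then (C * (N : ℝ) ^ (2 * u) * (N : ℝ) ^ (31 * c + 16)) * (K * N) else 0 := by
    intro d hd
    rw [Finset.mem_Icc] at hd
    split_ifs with hdU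
    · rw [← Finset.sum_mul, abs_mul]
      apply mul_le_mul _ _ (abs_nonneg _) (by positivity)
      · refine (h N x d hN hx (by omega)).trans ?_
        have : (d : ℝ) ≤ (N : ℝ) ^ (2 * u) := by exact_mod_cast hdU
        gcongr
      · exact (abs_beta _ _ _).trans (log_le (hd.2.trans hx))
    · rw [beta_zero]
      · simp
      · rw [← pow_add, ← two_mul]; omega
  refine (Finset.abs_sum_le_sum_abs _ _).trans ((Finset.sum_le_sum key).trans ?_)
  rw [← Finset.sum_filter, Finset.sum_const, nsmul_eq_mul]
  have hc : #((Icc 1 x).filter fun d => d ≤ N ^ (2 * u)) ≤ N ^ (2 * u) := by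
    have : ((Icc 1 x).filter fun d => d ≤ N ^ (2 * u)) ⊆ Icc 1 (N ^ (2 * u)) := by
      intro d; simp only [Finset.mem_filter, Finset.mem_Icc]; omega
    simpa using Finset.card_le_card this
  have hc' : (#((Icc 1 x).filter fun d => d ≤ N ^ (2 * u)) : ℝ) ≤ (N : ℝ) ^ (2 * u) := by exact_mod_cast hc
  calc _ ≤ (N : ℝ) ^ (2 * u) * ((C * (N : ℝ) ^ (2 * u) * (N : ℝ) ^ (31 * c + 16)) * (K * N)) := by gcongr
    _ = _ := by ring

end SpinDensity

namespace SpinDensity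
open Finset
open scoped Classical
open scoped ArithmeticFunction.Moebius ArithmeticFunction.vonMangoldt ArithmeticFunction.zeta

theorem exists_block {N u K n : ℕ} (hN : 2 ≤ N) (h1 : N ^ u < n) (h2 : n ≤ N ^ K) :
    ∃ j ∈ Ico u K, N ^ j < n ∧ n ≤ N ^ (j + 1) := by
  induction K with
  | zero =>
    exfalso
    have : N ^ 0 ≤ N ^ u := Nat.pow_le_pow_right (by omega) (Nat.zero_le _)
    omega
  | succ K ih =>
    by_cases h : n ≤ N ^ K
    · obtain ⟨j, hj, h3⟩ := ih h
      rw [Finset.mem_Ico] at hj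
      exact ⟨j, Finset.mem_Ico.2 ⟨hj.1, by omega⟩, h3⟩
    · refine ⟨K, Finset.mem_Ico.2 ⟨?_, by omega⟩, by omega, h2⟩
      by_contra hc
      have : N ^ (K + 1) ≤ N ^ u := Nat.pow_le_pow_right (by omega) (by omega)
      omega

theorem termD1 (K k u e : ℕ) (hk : 1 ≤ k) (hu1 : 16*k + 8*k*e ≤ u) (hu2 : 15*k + 8*k*e + 2*K + 2 ≤ k*u) :
    ∃ C : ℝ, 1 ≤ C ∧ ∀ N x : ℕ, 2 ≤ N → x ≤ N ^ K →
    |∑ w ∈ SF x, (spin w : ℝ) * ∑ d ∈ (nn w).primeFactors, trhi Λ (N ^ u) d * gam (N ^ u) (nn w / d)| ≤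
      C * (N : ℝ) ^ (K + 4 - e + 1) := by
  obtain ⟨C, hC, h⟩ := typeII K k u e hk hu1 hu2
  refine ⟨(K + 1) * (K + 1) * C, ?_, fun N x hN hx => ?_⟩
  · have : (0:ℝ) ≤ K := Nat.cast_nonneg K
    nlinarith [mul_nonneg this this, mul_nonneg (mul_nonneg this this) (by linarith : (0:ℝ) ≤ C), mul_nonneg this (by linarith : (0:ℝ) ≤ C)]
  have hN1 : 1 ≤ N := by omega
  rw [bij x (fun p m => trhi Λ (N ^ u) p * gam (N ^ u) m)]
  set T : ℤ√2 → ℝ := fun z => |∑ t ∈ SF x with nn z * nn t ≤ x, (spin (z*t):ℝ) * gam (N ^ u) (nn t)| with hT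
  have hT0 : ∀ z, 0 ≤ T z := fun z => abs_nonneg _
  have s1 : ∀ z ∈ (SF x).filter (fun z => (nn z).Prime),
      |∑ t ∈ SF x with nn z * nn t ≤ x, (spin (z * t) : ℝ) * (trhi Λ (N ^ u) (nn z) * gam (N ^ u) (nn t))| ≤
      ∑ j ∈ Ico u K, if N ^ j < nn z ∧ nn z ≤ N ^ (j + 1) then (K * N) * T z else 0 := by
    intro z hz
    rw [Finset.mem_filter] at hz
    have hzK := (mem_SF'.1 hz.1).2.trans hx
    have e : ∑ t ∈ SF x with nn z * nn t ≤ x, (spin (z * t) : ℝ) * (trhi Λ (N ^ u) (nn z) * gam (N ^ u) (nn t)) =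
        trhi Λ (N ^ u) (nn z) * ∑ t ∈ SF x with nn z * nn t ≤ x, (spin (z*t):ℝ) * gam (N ^ u) (nn t) := by
      rw [Finset.mul_sum]
      apply Finset.sum_congr rfl
      intros; ring
    rw [e, abs_mul]
    have hnn : ∀ j ∈ Ico u K, 0 ≤ (if N ^ j < nn z ∧ nn z ≤ N ^ (j + 1) then (K * N) * T z else 0) := by
      intro j _
      split_ifs
      · exact mul_nonneg (by positivity) (hT0 z)
      · exact le_rfl
    rw [trhi_apply]
    split_ifs with hc
    · rw [abs_zero, zero_mul]
      exact Finset.sum_nonneg hnn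
    · obtain ⟨j, hj, hj2⟩ := exists_block hN (not_le.1 hc) hzK
      refine le_trans ?_ (Finset.single_le_sum hnn hj)
      rw [if_pos hj2]
      exact mul_le_mul_of_nonneg_right (La_le hzK) (hT0 z)
  refine (Finset.abs_sum_le_sum_abs _ _).trans ((Finset.sum_le_sum s1).trans ?_)
  rw [Finset.sum_comm]
  have s2 : ∀ j ∈ Ico u K, ∑ z ∈ SF x with (nn z).Prime, (if N ^ j < nn z ∧ nn z ≤ N ^ (j + 1) then (K * N) * T z else 0) ≤
      (K * N) * (C * (N : ℝ) ^ (K + 4 - e)) := by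
    intro j hj
    rw [Finset.mem_Ico] at hj
    rw [← Finset.sum_filter, Finset.filter_filter, ← Finset.mul_sum]
    apply mul_le_mul_of_nonneg_left _ (by positivity)
    by_cases hjK : j + u ≤ K
    · have := h N j x hN hj.1 hjK hx (gam (N ^ u)) (fun m _ => abs_gam _ m)
      convert this
    · refine le_of_eq_of_le (Finset.sum_eq_zero ?_) (by positivity)
      intro z hz
      rw [Finset.mem_filter] at hz
      rw [hT]
      simp only
      rw [abs_eq_zero]
      apply Finset.sum_eq_zero
      intro t ht
      rw [Finset.mem_filter] at ht
      rw [gam_zero, mul_zero]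
      by_contra hc
      push Not at hc
      have a1 : N ^ j * N ^ u < nn z * nn t := Nat.mul_lt_mul'' hz.2.2.1 hc
      rw [← pow_add] at a1
      have a2 : N ^ K ≤ N ^ (j + u) := Nat.pow_le_pow_right hN1 (by omega)
      omega
  refine (Finset.sum_le_card_nsmul _ _ _ s2).trans ?_
  rw [nsmul_eq_mul, Nat.card_Ico]
  have : ((K - u : ℕ) : ℝ) ≤ K + 1 := by
    have : K - u ≤ K + 1 := by omega
    exact_mod_cast this
  calc _ ≤ ((K : ℝ) + 1) * (((K + 1 : ℝ) * N) * (C * (N : ℝ) ^ (K + 4 - e))) := by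
        gcongr
        linarith
    _ = _ := by ring

theorem termD2 (K t : ℕ) (ht : t ≤ K) : ∃ C : ℝ, 1 ≤ C ∧ ∀ N x : ℕ, 2 ≤ N → x ≤ N ^ K →
    |∑ w ∈ SF x, (spin w : ℝ) * ∑ d ∈ (nn w).divisors with ¬ d.Prime, trhi Λ (N ^ (3 * t)) d * gam (N ^ (3 * t)) (nn w / d)| ≤
      C * (N : ℝ) ^ (K + 4 - t) := by
  obtain ⟨C1, hC1, h1⟩ := tau_bound K
  obtain ⟨C, hC, h⟩ := badCard K
  have hC1' : (1:ℝ) ≤ C1 := by exact_mod_cast hC1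
  have hK0 : (0:ℝ) ≤ K := Nat.cast_nonneg K
  refine ⟨C * C1 ^ 2 * (K + 1), ?_, fun N x hN hx => ?_⟩
  · have := one_le_pow₀ hC1' (n := 2)
    have := one_le_mul_of_one_le_of_one_le hC this
    exact one_le_mul_of_one_le_of_one_le this (by linarith)
  have hN1 : 1 ≤ N := by omega
  have key : ∀ w ∈ SF x, |(spin w : ℝ) * ∑ d ∈ (nn w).divisors with ¬ d.Prime, trhi Λ (N ^ (3 * t)) d * gam (N ^ (3 * t)) (nn w / d)| ≤
      if ∃ s, N ^ t < s ∧ s ^ 2 ∣ nn w then ((C1 : ℝ) * N) * (((K : ℝ) * N) * ((C1 : ℝ) * N)) else (0:ℝ) := by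
    intro w hw
    have hw0 := SF_nn_pos hw
    have hwK := (mem_SF'.1 hw).2.trans hx
    rw [abs_mul]
    refine (mul_le_of_le_one_left (abs_nonneg _) (abs_spinR w)).trans ?_
    split_ifs with hb
    · refine (Finset.abs_sum_le_sum_abs _ _).trans ?_
      refine (Finset.sum_le_card_nsmul _ _ (((K : ℝ) * N) * ((C1 : ℝ) * N)) ?_).trans ?_
      · intro d hd
        rw [Finset.mem_filter] at hd
        have hdd := Nat.dvd_of_mem_divisors hd.1
        rw [abs_mul]
        apply mul_le_mul _ _ (abs_nonneg _) (by positivity)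
        · rw [trhi_apply]
          split_ifs
          · rw [abs_zero]; positivity
          · exact La_le ((Nat.le_of_dvd hw0 hdd).trans hwK)
        · refine (abs_gam _ _).trans ?_
          have := h1 N (nn w / d) (by omega) (Nat.div_pos (Nat.le_of_dvd hw0 hdd) (Nat.pos_of_dvd_of_pos hdd hw0)) ((Nat.div_le_self _ _).trans hwK)
          exact_mod_cast this
      · rw [nsmul_eq_mul]
        apply mul_le_mul_of_nonneg_right _ (by positivity)
        have := (Finset.card_filter_le (nn w).divisors (fun d => ¬ d.Prime)).trans (h1 N (nn w) (by omega) hw0 hwK)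
        exact_mod_cast this
    · rw [Finset.sum_eq_zero, abs_zero]
      intro d hd
      rw [Finset.mem_filter] at hd
      have hdd := Nat.dvd_of_mem_divisors hd.1
      rw [trhi_apply]
      split_ifs with hc
      · rw [zero_mul]
      · by_cases hpp : IsPrimePow d
        · obtain ⟨s, hs, hs2⟩ := bad_of_pp (not_le.1 hc) hpp hd.2
          exact absurd ⟨s, hs, hs2.trans hdd⟩ hb
        · rw [ArithmeticFunction.vonMangoldt_eq_zero_iff.2 hpp, zero_mul]
  refine (Finset.abs_sum_le_sum_abs _ _).trans ((Finset.sum_le_sum key).trans ?_)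
  rw [← Finset.sum_filter, Finset.sum_const, nsmul_eq_mul]
  calc _ ≤ (C * (N : ℝ) ^ (K + 1 - t)) * ((C1 * N) * (((K + 1) * N) * (C1 * N))) := by
        apply mul_le_mul (h N x t hN hx ht) _ (by positivity) (by positivity)
        gcongr
        linarith
    _ = _ := by rw [show K + 4 - t = (K + 1 - t) + 3 by omega]; ring

theorem params : ∃ t c K k u : ℕ, 5 ≤ t ∧ t ≤ K ∧ u = 3 * t ∧ c = 4 * u + 2 ∧ K = 32 * c + 16 ∧ 1 ≤ k ∧
    16*k + 8*k*6 ≤ u ∧ 15*k + 8*k*6 + 2*K + 2 ≤ k*u :=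
  ⟨30000, 4 * 90000 + 2, 32 * (4 * 90000 + 2) + 16, 1000, 90000, by norm_num, by norm_num, by norm_num, by norm_num, by norm_num,
    by norm_num, by norm_num, by norm_num⟩

theorem mainBound : ∃ K : ℕ, 2 ≤ K ∧ ∃ C : ℝ, 1 ≤ C ∧ ∀ N x : ℕ, 2 ≤ N → x ≤ N ^ K →
    |∑ w ∈ SF x with (nn w).Prime, (spin w : ℝ) * Real.log (nn w)| ≤ C * (N : ℝ) ^ (K - 1) := by
  obtain ⟨t, c, K, k, u, ht, htK, hu, hc, hK, hk, hp1, hp2⟩ := params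
  obtain ⟨CA, hCA, hA⟩ := termA K u (by omega)
  obtain ⟨CB, hCB, hB⟩ := termB c u
  obtain ⟨CC, hCC, hC⟩ := termC c u
  obtain ⟨CD, hCD, hD⟩ := termD1 K k u 6 hk hp1 hp2
  obtain ⟨CE, hCE, hE⟩ := termD2 K t htK
  obtain ⟨CF, hCF, hF⟩ := badCard K
  rw [← hK] at hB hC
  refine ⟨K, by omega, CA + CB + CC + CD + CE + (CA + CF * (K + 1)), ?_, fun N x hN hx => ?_⟩
  · have : 0 ≤ CF * (K + 1 : ℝ) := by positivity
    linarith
  have hN1 : 1 ≤ N := by omega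
  have hN1' : (1:ℝ) ≤ N := by exact_mod_cast hN1
  have up : ∀ (B : ℝ) (a : ℕ), 1 ≤ B → a ≤ K - 1 → B * (N:ℝ) ^ a ≤ B * (N : ℝ) ^ (K - 1) := by
    intro B a hB ha
    exact mul_le_mul_of_nonneg_left (pow_le_pow_right₀ hN1' ha) (by linarith)
  have a1 : |∑ w ∈ SF x, (spin w : ℝ) * trlo Λ (N ^ u) (nn w)| ≤ CA * (N : ℝ) ^ (K - 1) := by
    refine le_trans ?_ ((hA N x hN).trans (up CA _ hCA (by omega)))
    rw [Finset.sum_filter]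
    refine (Finset.abs_sum_le_sum_abs _ _).trans (Finset.sum_le_sum ?_)
    intro w hw
    rw [abs_mul, trlo_apply]
    refine (mul_le_of_le_one_left (abs_nonneg _) (abs_spinR w)).trans ?_
    split_ifs <;> simp
  have a2 := (hB N x hN hx).trans (up CB _ hCB (by omega))
  have a3 := (hC N x hN hx).trans (up CC _ hCC (by omega))
  have a4 := (hD N x hN hx).trans (up CD _ hCD (by omega))
  have a5 := (hE N x hN hx).trans (up CE _ hCE (by omega))
  rw [← hu] at a5
  have e1 : ∑ w ∈ SF x, (spin w : ℝ) * Λ (nn w) = ∑ w ∈ SF x, (spin w : ℝ) * trlo Λ (N ^ u) (nn w)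
     + ∑ w ∈ SF x, (spin w : ℝ) * (trlo muR (N ^ u) * ArithmeticFunction.log) (nn w)
     - ∑ w ∈ SF x, (spin w : ℝ) * (trlo Λ (N ^ u) * trlo muR (N ^ u) * zeR) (nn w)
     + ∑ w ∈ SF x, (spin w : ℝ) * ∑ d ∈ (nn w).primeFactors, trhi Λ (N ^ u) d * gam (N ^ u) (nn w / d)
     + ∑ w ∈ SF x, (spin w : ℝ) * ∑ d ∈ (nn w).divisors with ¬ d.Prime, trhi Λ (N ^ u) d * gam (N ^ u) (nn w / d) := by
    rw [← Finset.sum_add_distrib, ← Finset.sum_sub_distrib, ← Finset.sum_add_distrib, ← Finset.sum_add_distrib]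
    apply Finset.sum_congr rfl
    intro w hw
    have hw0 := SF_nn_pos hw
    have e2 : ∑ d ∈ (nn w).primeFactors, trhi Λ (N ^ u) d * gam (N ^ u) (nn w / d)
       + ∑ d ∈ (nn w).divisors with ¬ d.Prime, trhi Λ (N ^ u) d * gam (N ^ u) (nn w / d) = (trhi Λ (N ^ u) * gam (N ^ u)) (nn w) := by
      rw [mul_apply', ← Finset.sum_filter_add_sum_filter_not (nn w).divisors (fun d => d.Prime)]
      congr 1
      apply Finset.sum_congr _ (fun _ _ => rfl)
      ext d
      simp only [Nat.mem_primeFactors, Finset.mem_filter, Nat.mem_divisors]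
      tauto
    have e3 : Λ (nn w) = _ := congrArg (fun f : ArithmeticFunction ℝ => f (nn w)) (vaughan (N ^ u) (N ^ u))
    rw [ArithmeticFunction.add_apply, sub_eq_add_neg, ArithmeticFunction.add_apply, ArithmeticFunction.neg_apply, ArithmeticFunction.add_apply] at e3
    rw [e3, ← e2]
    ring
  have a6 : |∑ w ∈ SF x with ¬ (nn w).Prime, (spin w : ℝ) * Λ (nn w)| ≤ (CA + CF * (K + 1)) * (N : ℝ) ^ (K - 1) := by
    have b1 : ∀ w ∈ (SF x).filter (fun w => ¬ (nn w).Prime), |(spin w : ℝ) * Λ (nn w)| ≤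
        (if nn w ≤ N ^ u then |Λ (nn w)| else 0) + (if ∃ s, N ^ t < s ∧ s ^ 2 ∣ nn w then (K * N : ℝ) else 0) := by
      intro w hw
      rw [Finset.mem_filter] at hw
      rw [abs_mul]
      refine (mul_le_of_le_one_left (abs_nonneg _) (abs_spinR w)).trans ?_
      have b2 : (0:ℝ) ≤ (if ∃ s, N ^ t < s ∧ s ^ 2 ∣ nn w then (K * N : ℝ) else 0) := by
        split_ifs
        · positivity
        · exact le_rfl
      by_cases hc : nn w ≤ N ^ u
      · rw [if_pos hc]; linarith
      · rw [if_neg hc, zero_add]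
        by_cases hpp : IsPrimePow (nn w)
        · rw [hu] at hc
          rw [if_pos (bad_of_pp (not_le.1 hc) hpp hw.2)]
          exact La_le ((mem_SF'.1 hw.1).2.trans hx)
        · rw [ArithmeticFunction.vonMangoldt_eq_zero_iff.2 hpp, abs_zero]; exact b2
    refine (Finset.abs_sum_le_sum_abs _ _).trans ((Finset.sum_le_sum b1).trans ?_)
    refine (Finset.sum_le_sum_of_subset_of_nonneg (Finset.filter_subset _ _) ?_).trans ?_
    · intro w _ _
      apply add_nonneg <;> split_ifs <;> positivity
    rw [Finset.sum_add_distrib, ← Finset.sum_filter, ← Finset.sum_filter, Finset.sum_const, nsmul_eq_mul, add_mul]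
    apply add_le_add
    · exact (hA N x hN).trans (up CA _ hCA (by omega))
    · calc _ ≤ (CF * (N : ℝ) ^ (K + 1 - t)) * ((K + 1) * N) := by
            apply mul_le_mul (hF N x t hN hx htK) _ (by positivity) (by positivity)
            gcongr
            linarith
        _ = CF * (K + 1) * (N : ℝ) ^ (K + 1 - t + 1) := by ring
        _ ≤ _ := up _ _ (one_le_mul_of_one_le_of_one_le hCF (by linarith [(Nat.cast_nonneg K : (0:ℝ) ≤ K)])) (by omega)
  have e4 : ∑ w ∈ SF x with (nn w).Prime, (spin w : ℝ) * Real.log (nn w) = ∑ w ∈ SF x, (spin w : ℝ) * Λ (nn w)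
      - ∑ w ∈ SF x with ¬ (nn w).Prime, (spin w : ℝ) * Λ (nn w) := by
    rw [← Finset.sum_filter_add_sum_filter_not (SF x) (fun w => (nn w).Prime) (fun w => (spin w : ℝ) * Λ (nn w)), add_sub_cancel_right]
    apply Finset.sum_congr rfl
    intro w hw
    rw [ArithmeticFunction.vonMangoldt_apply_prime (Finset.mem_filter.1 hw).2]
  rw [e4, e1]
  rw [abs_le] at *
  constructor <;> linarith [a1.1, a1.2, a2.1, a2.2, a3.1, a3.2, a4.1, a4.2, a5.1, a5.2, a6.1, a6.2]

end SpinDensity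

namespace SpinDensity
open Finset
open scoped Classical

open ArithmeticFunction.vonMangoldt in
/-- prime-supported coefficients -/
noncomputable def bq (n : ℕ) : ℝ := if n.Prime then residueClass (15 : ZMod 16) n else 0

theorem bq_nonneg (n : ℕ) : 0 ≤ bq n := by
  unfold bq
  split_ifs
  · exact ArithmeticFunction.vonMangoldt.residueClass_nonneg _ _
  · exact le_rfl

theorem bq_zero : bq 0 = 0 := by
  unfold bq; rw [if_neg Nat.not_prime_zero]

theorem bq_le {n : ℕ} : bq n ≤ Real.log n := by
  unfold bq
  split_ifs
  · exact (ArithmeticFunction.vonMangoldt.residueClass_le _ _).trans ArithmeticFunction.vonMangoldt_le_log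
  · exact Real.log_natCast_nonneg n

theorem bq_ne {n : ℕ} (h : bq n ≠ 0) : n.Prime ∧ n % 16 = 15 := by
  unfold bq at h
  split_ifs at h with hp
  · refine ⟨hp, ?_⟩
    unfold ArithmeticFunction.vonMangoldt.residueClass at h
    have := Set.mem_of_indicator_ne_zero h
    rw [Set.mem_ofPred_eq] at this
    have h2 : ((n : ℕ) : ZMod 16) = ((15 : ℕ) : ZMod 16) := this
    rw [ZMod.natCast_eq_natCast_iff'] at h2
    simpa using h2
  · exact absurd rfl h

theorem unit15 : IsUnit (15 : ZMod 16) := IsUnit.of_mul_eq_one 15 (by decide)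

open ArithmeticFunction.vonMangoldt in
theorem res_series : ∃ C : ℝ, ∀ δ : ℝ, 0 < δ → δ ≤ 1 →
    Summable (fun n : ℕ => residueClass (15 : ZMod 16) n / (n : ℝ) ^ (1 + δ)) ∧
    |∑' n : ℕ, residueClass (15 : ZMod 16) n / (n : ℝ) ^ (1 + δ) - (1/8) / δ| ≤ C := by
  have ha := unit15
  have H {x : ℝ} (hx : 1 < x) :
      ∑' n, residueClass (15 : ZMod 16) n / (n : ℝ) ^ x =
        (LFunctionResidueClassAux (15 : ZMod 16) x).re + ((16:ℕ).totient : ℝ)⁻¹ / (x - 1) := by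
    refine Complex.ofReal_injective ?_
    simp only [Complex.ofReal_tsum, Complex.ofReal_div, Complex.ofReal_cpow (Nat.cast_nonneg _), Complex.ofReal_natCast,
      Complex.ofReal_add, Complex.ofReal_inv, Complex.ofReal_sub, Complex.ofReal_one]
    simp_rw [← LFunctionResidueClassAux_real ha hx,
      eqOn_LFunctionResidueClassAux ha <| Set.mem_ofPred.mpr (Complex.ofReal_re x ▸ hx), sub_add_cancel,
      LSeries, LSeries.term]
    refine tsum_congr fun n ↦ ?_
    split_ifs with hn
    · simp only [hn, residueClass_apply_zero, Complex.ofReal_zero, zero_div]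
    · rfl
  have hc : ContinuousOn (fun x : ℝ ↦ (LFunctionResidueClassAux (15 : ZMod 16) x).re) (Set.Icc 1 2) :=
    Complex.continuous_re.continuousOn.comp (t := Set.univ) (continuousOn_LFunctionResidueClassAux _)
      (fun ⦃x⦄ a ↦ trivial) |>.comp Complex.continuous_ofReal.continuousOn fun x hx ↦ by
        simpa only [Set.mem_ofPred_eq, Complex.ofReal_re] using hx.1
  obtain ⟨C, hC⟩ := isCompact_Icc.exists_bound_of_continuousOn hc
  refine ⟨C, fun δ h0 h1 => ⟨?_, ?_⟩⟩
  · exact LSeries.summable_real_of_abscissaOfAbsConv_lt <|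
        (abscissaOfAbsConv_residueClass_le_one _).trans_lt <| mod_cast (by linarith)
  · rw [H (by linarith)]
    have h8 : ((16:ℕ).totient : ℝ)⁻¹ = 1/8 := by
      have : (16:ℕ).totient = 8 := by decide
      rw [this]; norm_num
    rw [h8, add_sub_cancel_left, add_sub_cancel_right]
    exact hC (1 + δ) ⟨by linarith, by linarith⟩

open ArithmeticFunction.vonMangoldt in
theorem bq_series : ∃ C : ℝ, ∀ δ : ℝ, 0 < δ → δ ≤ 1 →
    Summable (fun n : ℕ => bq n / (n : ℝ) ^ (1 + δ)) ∧
    |∑' n : ℕ, bq n / (n : ℝ) ^ (1 + δ) - (1/8) / δ| ≤ C := by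
  obtain ⟨C, hC⟩ := res_series
  have hs := summable_residueClass_non_primes_div (15 : ZMod 16)
  set f : ℕ → ℝ := fun n => (if n.Prime then 0 else residueClass (15 : ZMod 16) n) / n with hf
  refine ⟨C + ∑' n, f n, fun δ h0 h1 => ?_⟩
  obtain ⟨h2, h3⟩ := hC δ h0 h1
  set g : ℕ → ℝ := fun n => (if n.Prime then 0 else residueClass (15 : ZMod 16) n) / (n : ℝ) ^ (1 + δ) with hg
  have hnum : ∀ n, 0 ≤ (if n.Prime then 0 else residueClass (15 : ZMod 16) n) := by
    intro n
    split_ifs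
    · exact le_rfl
    · exact residueClass_nonneg _ _
  have hg0 : ∀ n, 0 ≤ g n := fun n => div_nonneg (hnum n) (by positivity)
  have hgf : ∀ n, g n ≤ f n := by
    intro n
    rcases n.eq_zero_or_pos with rfl | hn
    · simp [hg, hf]
    · refine div_le_div_of_nonneg_left (hnum n) (mod_cast hn) ?_
      conv_lhs => rw [← Real.rpow_one n]
      exact Real.rpow_le_rpow_of_exponent_le (by exact_mod_cast hn) (by linarith)
  have hgs : Summable g := Summable.of_nonneg_of_le hg0 hgf hs
  have e : (fun n : ℕ => bq n / (n : ℝ) ^ (1 + δ)) = fun n => residueClass (15 : ZMod 16) n / (n : ℝ) ^ (1 + δ) - g n := by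
    ext n
    simp only [hg, bq]
    split_ifs <;> simp
  rw [e]
  refine ⟨h2.sub hgs, ?_⟩
  rw [h2.tsum_sub hgs]
  have b1 : 0 ≤ ∑' n, g n := tsum_nonneg hg0
  have b2 := hgs.tsum_le_tsum hgf hs
  rw [abs_le] at *
  constructor <;> linarith [h3.1, h3.2]

theorem poly_series (R : Polynomial ℝ) : ∃ C : ℝ, ∀ L : ℝ, (R.natDegree + 1 : ℝ) ≤ L →
    Summable (fun n : ℕ => bq n / n * ((n : ℝ) ^ (-1 / L) * R.eval ((n : ℝ) ^ (-1 / L)))) ∧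
    |∑' n : ℕ, bq n / n * ((n : ℝ) ^ (-1 / L) * R.eval ((n : ℝ) ^ (-1 / L))) - L / 8 * ∫ y in (0:ℝ)..1, R.eval y| ≤ C := by
  obtain ⟨C, hC⟩ := bq_series
  refine ⟨∑ i ∈ range (R.natDegree + 1), |R.coeff i| * C, fun L hL => ?_⟩
  have hD0 : (0:ℝ) ≤ R.natDegree := Nat.cast_nonneg _
  have hL0 : 0 < L := by linarith
  have key : ∀ i ∈ range (R.natDegree + 1), 0 < ((i : ℝ) + 1) / L ∧ ((i : ℝ) + 1) / L ≤ 1 := by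
    intro i hi
    rw [Finset.mem_range] at hi
    have : (i : ℝ) ≤ R.natDegree := by exact_mod_cast (by omega : i ≤ R.natDegree)
    refine ⟨by positivity, ?_⟩
    rw [div_le_one hL0]; linarith
  have e1 : (fun n : ℕ => bq n / n * ((n : ℝ) ^ (-1 / L) * R.eval ((n : ℝ) ^ (-1 / L)))) =
      fun n : ℕ => ∑ i ∈ range (R.natDegree + 1), R.coeff i * (bq n / (n : ℝ) ^ (1 + ((i : ℝ) + 1) / L)) := by
    ext n
    rcases n.eq_zero_or_pos with rfl | hn
    · simp [bq_zero]
    · have hn' : (0:ℝ) < n := by exact_mod_cast hn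
      rw [Polynomial.eval_eq_sum_range, Finset.mul_sum, Finset.mul_sum]
      apply Finset.sum_congr rfl
      intro i _
      have : (n : ℝ) ^ (1 + ((i : ℝ) + 1) / L) = n * ((n : ℝ) ^ (-1 / L) * ((n : ℝ) ^ (-1 / L)) ^ i)⁻¹ := by
        rw [← pow_succ', ← Real.rpow_natCast, ← Real.rpow_mul hn'.le, ← Real.rpow_neg hn'.le, Real.rpow_add hn', Real.rpow_one]
        congr 2
        push_cast
        ring
      rw [this]
      have : (n : ℝ) ^ (-1 / L) ≠ 0 := (Real.rpow_pos_of_pos hn' _).ne'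
      field_simp
  have hsum : ∀ i ∈ range (R.natDegree + 1), Summable fun n : ℕ => R.coeff i * (bq n / (n : ℝ) ^ (1 + ((i : ℝ) + 1) / L)) :=
    fun i hi => ((hC _ (key i hi).1 (key i hi).2).1).mul_left _
  rw [e1]
  refine ⟨summable_sum hsum, ?_⟩
  rw [Summable.tsum_finsetSum hsum]
  have e2 : ∫ y in (0:ℝ)..1, R.eval y = ∑ i ∈ range (R.natDegree + 1), R.coeff i / (i + 1) := by
    simp_rw [Polynomial.eval_eq_sum_range]
    rw [intervalIntegral.integral_finsetSum]
    · apply Finset.sum_congr rfl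
      intro i _
      rw [intervalIntegral.integral_const_mul, integral_pow]
      simp
      ring
    · intro i _
      apply Continuous.intervalIntegrable
      fun_prop
  rw [e2, Finset.mul_sum, ← Finset.sum_sub_distrib]
  refine (Finset.abs_sum_le_sum_abs _ _).trans (Finset.sum_le_sum ?_)
  intro i hi
  have h2 := (hC _ (key i hi).1 (key i hi).2).2
  rw [tsum_mul_left]
  have : R.coeff i * ∑' n : ℕ, (bq n / (n : ℝ) ^ (1 + ((i : ℝ) + 1) / L)) - L / 8 * (R.coeff i / (i + 1)) =
     R.coeff i * (∑' n : ℕ, (bq n / (n : ℝ) ^ (1 + ((i : ℝ) + 1) / L)) - (1/8) / (((i : ℝ) + 1) / L)) := by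
    field_simp
  rw [this, abs_mul]
  gcongr

theorem exists_R (α β : ℝ) (h0 : 0 < α) (hab : α < β) (h1 : β < 1) : ∃ R : Polynomial ℝ,
    0 < ∫ y in (0:ℝ)..1, R.eval y ∧ (∀ y ∈ Set.Icc (0:ℝ) 1, R.eval y ≤ 1) ∧
    (∀ y ∈ Set.Icc (0:ℝ) 1, (y < α ∨ β < y) → R.eval y ≤ 0) := by
  set h : ℝ → ℝ := fun y => max 0 ((y - α) * (β - y)) with hh
  have hcont : Continuous h := by fun_prop
  have hI : 0 < ∫ y in (0:ℝ)..1, h y := by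
    apply intervalIntegral.integral_pos (by norm_num) hcont.continuousOn
    · intro y _; exact le_max_left _ _
    · refine ⟨(α + β) / 2, ⟨by linarith, by linarith⟩, lt_max_of_lt_right ?_⟩
      have : 0 < β - α := by linarith
      nlinarith
  set I := ∫ y in (0:ℝ)..1, h y
  obtain ⟨R, hR⟩ := exists_polynomial_near_of_continuousOn 0 1 (fun y => h y - I / 2) (by fun_prop) (I / 4) (by positivity)
  refine ⟨R, ?_, ?_, ?_⟩
  · have : ∫ y in (0:ℝ)..1, (h y - 3 * I / 4) ≤ ∫ y in (0:ℝ)..1, R.eval y := by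
      apply intervalIntegral.integral_mono_on (by norm_num)
      · apply Continuous.intervalIntegrable; fun_prop
      · apply Continuous.intervalIntegrable; fun_prop
      · intro y hy
        have := (abs_lt.1 (hR y hy)).1
        linarith
    rw [intervalIntegral.integral_sub (hcont.intervalIntegrable _ _) (by simp)] at this
    simp only [intervalIntegral.integral_const, sub_zero, one_smul] at this
    change I - _ ≤ _ at this
    linarith
  · intro y hy
    have := (abs_lt.1 (hR y hy)).2
    have h3 : h y ≤ 1 := by
      apply max_le (by norm_num)
      nlinarith [sq_nonneg (2 * y - α - β), hy.1, hy.2]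
    linarith
  · intro y hy hc
    have := (abs_lt.1 (hR y hy)).2
    have h3 : h y = 0 := by
      apply max_eq_left
      rcases hc with hc | hc
      · nlinarith
      · nlinarith
    linarith

end SpinDensity

namespace SpinDensity
open Finset
open scoped Classical

/-- primes up to `x` congruent to 15 mod 16 -/
noncomputable def P15s (x : ℕ) : Finset ℕ := (Icc 1 x).filter fun p => p.Prime ∧ p % 16 = 15

theorem prime_lower (ε : ℝ) (h0 : 0 < ε) (h1 : ε < 1) : ∃ c : ℝ, 0 < c ∧
    ∀ᶠ x : ℕ in Filter.atTop, c * (x : ℝ) ^ (1 - ε) ≤ #(P15s x) := by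
  obtain ⟨R, hJ, hR1, hR2⟩ := exists_R (Real.exp (-1)) (Real.exp (-(1 - ε))) (Real.exp_pos _)
    (Real.exp_lt_exp.2 (by linarith)) (by rw [Real.exp_lt_one_iff]; linarith)
  set J := ∫ y in (0:ℝ)..1, R.eval y
  obtain ⟨C, hC⟩ := poly_series R
  refine ⟨J / 16, by positivity, ?_⟩
  have hlog : Filter.Tendsto (fun x : ℕ => Real.log x) Filter.atTop Filter.atTop :=
    Real.tendsto_log_atTop.comp tendsto_natCast_atTop_atTop
  filter_upwards [hlog.eventually_ge_atTop (R.natDegree + 1 : ℝ), hlog.eventually_ge_atTop (16 * C / J),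
    Filter.eventually_ge_atTop 2] with x hx1 hx2 hx3
  obtain ⟨hs, hb⟩ := hC _ hx1
  set L := Real.log x with hL
  have hx0 : (0:ℝ) < x := by exact_mod_cast (by omega : 0 < x)
  have hL0 : 0 < L := lt_of_lt_of_le (by positivity) hx1
  set W := (Icc 1 x).filter fun n : ℕ => (x : ℝ) ^ (1 - ε) ≤ n with hW
  have hterm : ∀ n : ℕ, bq n / n * ((n : ℝ) ^ (-1 / L) * R.eval ((n : ℝ) ^ (-1 / L))) ≤ if n ∈ W then bq n / n else 0 := by
    intro n
    rcases n.eq_zero_or_pos with rfl | hn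
    · simp [bq_zero]
    have hn0 : (0:ℝ) < n := by exact_mod_cast hn
    have hn1 : (1:ℝ) ≤ n := by exact_mod_cast hn
    have hq : 0 ≤ bq n / n := div_nonneg (bq_nonneg n) hn0.le
    have hy : (n : ℝ) ^ (-1 / L) = Real.exp (-(Real.log n / L)) := by
      rw [Real.rpow_def_of_pos hn0]; congr 1; ring
    have hln : 0 ≤ Real.log n := Real.log_natCast_nonneg n
    have hyI : (n : ℝ) ^ (-1 / L) ∈ Set.Icc (0:ℝ) 1 := by
      rw [hy]
      refine ⟨(Real.exp_pos _).le, ?_⟩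
      rw [Real.exp_le_one_iff]
      have : 0 ≤ Real.log n / L := by positivity
      linarith
    split_ifs with hw
    · refine mul_le_of_le_one_right hq ?_
      have := hR1 _ hyI
      calc _ ≤ (n : ℝ) ^ (-1 / L) * 1 := mul_le_mul_of_nonneg_left this hyI.1
        _ ≤ 1 := by rw [mul_one]; exact hyI.2
    · refine mul_nonpos_of_nonneg_of_nonpos hq (mul_nonpos_of_nonneg_of_nonpos hyI.1 (hR2 _ hyI ?_))
      rw [hW, Finset.mem_filter, Finset.mem_Icc] at hw
      rw [hy, Real.exp_lt_exp, Real.exp_lt_exp]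
      by_cases hnx : n ≤ x
      · right
        have h2 : (n : ℝ) < (x : ℝ) ^ (1 - ε) := by
          by_contra hc
          exact hw ⟨⟨hn, hnx⟩, not_lt.1 hc⟩
        have h3 := Real.log_lt_log hn0 h2
        rw [Real.log_rpow hx0] at h3
        have : Real.log n / L < 1 - ε := by rw [div_lt_iff₀ hL0]; exact h3
        linarith
      · left
        have h3 : L < Real.log n := Real.log_lt_log hx0 (by exact_mod_cast not_le.1 hnx)
        have : 1 < Real.log n / L := by rw [one_lt_div hL0]; exact h3
        linarith
  have hle : ∑' n : ℕ, bq n / n * ((n : ℝ) ^ (-1 / L) * R.eval ((n : ℝ) ^ (-1 / L))) ≤ ∑ n ∈ W, bq n / n := by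
    apply hs.tsum_le_of_sum_le
    intro s
    refine (Finset.sum_le_sum fun n _ => hterm n).trans ?_
    rw [← Finset.sum_filter]
    apply Finset.sum_le_sum_of_subset_of_nonneg
    · intro n hn; exact (Finset.mem_filter.1 hn).2
    · intro n _ _
      exact div_nonneg (bq_nonneg n) (Nat.cast_nonneg n)
  have hxe : 0 < (x : ℝ) ^ (1 - ε) := Real.rpow_pos_of_pos hx0 _
  have hle2 : ∑ n ∈ W, bq n / n ≤ #(P15s x) * (L / (x : ℝ) ^ (1 - ε)) := by
    calc _ ≤ ∑ n ∈ W, if n ∈ P15s x then L / (x : ℝ) ^ (1 - ε) else 0 := by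
          apply Finset.sum_le_sum
          intro n hn
          rw [hW, Finset.mem_filter, Finset.mem_Icc] at hn
          split_ifs with hp
          · apply div_le_div₀ hL0.le _ hxe hn.2
            exact bq_le.trans (log_mono hn.1.2)
          · have : bq n = 0 := by
              by_contra hne
              exact hp (Finset.mem_filter.2 ⟨Finset.mem_Icc.2 hn.1, bq_ne hne⟩)
            rw [this, zero_div]
      _ = #(W.filter fun n => n ∈ P15s x) * (L / (x : ℝ) ^ (1 - ε)) := by
          rw [← Finset.sum_filter, Finset.sum_const, nsmul_eq_mul]
      _ ≤ _ := by
          gcongr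
          intro n hn; exact (Finset.mem_filter.1 hn).2
  have hb1 := (abs_le.1 hb).1
  have h16 : 16 * C ≤ L * J := by rwa [div_le_iff₀ hJ] at hx2
  have h5 : L * (J / 16) ≤ #(P15s x) * (L / (x : ℝ) ^ (1 - ε)) := by
    linarith
  have h6 : #(P15s x) * (L / (x : ℝ) ^ (1 - ε)) = L * (#(P15s x) / (x : ℝ) ^ (1 - ε)) := by ring
  rw [h6] at h5
  have h7 := le_of_mul_le_mul_left h5 hL0
  rwa [le_div_iff₀ hxe] at h7

/-- the sign attached to a prime -/
noncomputable def sg (p : ℕ) : ℤ := if h : p.Prime ∧ p % 16 = 15 then (prime_reps h.1 h.2).choose else 0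

theorem sg_spec {p : ℕ} (hp : p.Prime) (h16 : p % 16 = 15) : (sg p = 1 ∨ sg p = -1) ∧
    (∀ x : ℕ, p ≤ x → ∑ w ∈ SF x with nn w = p, (spin w : ℝ) = 2 * sg p) ∧
    ((∀ u v : ℕ, 0 < u → 0 < v → (p : ℤ) = u ^ 2 - 2 * v ^ 2 → jacobiSym (2 * u) v = -1) ↔ sg p = -1) := by
  have e : sg p = (prime_reps hp h16).choose := by
    unfold sg; rw [dif_pos ⟨hp, h16⟩]
  rw [e]
  exact (prime_reps hp h16).choose_spec

theorem sum_spin_eq (x : ℕ) : ∑ w ∈ SF x with (nn w).Prime, (spin w : ℝ) = 2 * ∑ p ∈ P15s x, (sg p : ℝ) := by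
  have h1 : ∑ w ∈ SF x with (nn w).Prime, (spin w : ℝ) = ∑ w ∈ SF x with nn w ∈ P15s x, (spin w : ℝ) := by
    symm
    apply Finset.sum_subset
    · intro w hw
      rw [Finset.mem_filter] at hw ⊢
      exact ⟨hw.1, (Finset.mem_filter.1 hw.2).2.1⟩
    · intro w hw hw2
      rw [Finset.mem_filter] at hw hw2
      have h3 := mem_SF'.1 hw.1
      have h4 : ¬ (nn w % 16 = 15) := by
        intro hc
        exact hw2 ⟨hw.1, Finset.mem_filter.2 ⟨Finset.mem_Icc.2 ⟨SF_nn_pos hw.1, h3.2⟩, hw.2, hc⟩⟩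
      have h5 := h3.1.tp.nn_eq
      have : spin w = 0 := by
        unfold spin
        rw [if_neg]
        intro hc
        omega
      rw [this]; simp
  rw [h1, ← Finset.sum_fiberwise_of_maps_to (s := (SF x).filter fun w => nn w ∈ P15s x) (t := P15s x) (g := nn)
    (fun w hw => (Finset.mem_filter.1 hw).2), Finset.mul_sum]
  apply Finset.sum_congr rfl
  intro p hp
  have hp' := Finset.mem_filter.1 hp
  rw [← (sg_spec hp'.2.1 hp'.2.2).2.1 x (Finset.mem_Icc.1 hp'.1).2]
  apply Finset.sum_congr _ (fun _ _ => rfl)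
  ext w
  simp only [Finset.mem_filter]
  constructor
  · rintro ⟨⟨h1, h2⟩, h3⟩; exact ⟨h1, h3⟩
  · rintro ⟨h1, h3⟩; exact ⟨⟨h1, by rw [h3]; exact hp⟩, h3⟩

theorem sign_bound : ∃ K : ℕ, 2 ≤ K ∧ ∃ C : ℝ, 1 ≤ C ∧ ∀ N x : ℕ, 2 ≤ N → x ≤ N ^ K →
    |∑ p ∈ P15s x, (sg p : ℝ)| ≤ C * (N : ℝ) ^ (K - 1) := by
  obtain ⟨K, hK, C, hC, h⟩ := mainBound
  refine ⟨K, hK, 3 * C, by linarith, fun N x hN hx => ?_⟩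
  have hN0 : (0:ℝ) < N := by exact_mod_cast (by omega : 0 < N)
  set B := C * (N : ℝ) ^ (K - 1) with hB
  have hB0 : 0 ≤ B := by positivity
  set S := (SF x).filter fun w => (nn w).Prime with hS
  set g : ℕ → ℝ := fun n => if n ≤ 1 then 0 else (Real.log 2)⁻¹ - (Real.log n)⁻¹ with hg
  have hl2 : (1:ℝ) / 2 ≤ Real.log 2 := by linarith [Real.log_two_gt_d9]
  have hl2' : 0 < Real.log 2 := by linarith
  have hlog : ∀ n : ℕ, 2 ≤ n → Real.log 2 ≤ Real.log n := fun n hn =>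
    Real.log_le_log (by norm_num) (by exact_mod_cast hn)
  have hgm : Monotone g := by
    intro a b hab
    simp only [hg]
    by_cases ha : a ≤ 1
    · rw [if_pos ha]
      split_ifs with hb
      · exact le_rfl
      · have := inv_anti₀ hl2' (hlog b (by omega))
        linarith
    · rw [if_neg ha, if_neg (by omega)]
      have h2 := hlog a (by omega)
      have := inv_anti₀ (by linarith) (log_mono hab)
      simp only at this
      linarith
  have hgx : g x ≤ 2 := by
    simp only [hg]
    split_ifs
    · norm_num
    · have : (Real.log 2)⁻¹ ≤ 2 := by
        rw [inv_le_comm₀ hl2' (by norm_num)]; linarith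
      have h2 : 0 ≤ (Real.log x)⁻¹ := inv_nonneg.2 (Real.log_natCast_nonneg x)
      linarith
  have hBy : ∀ y ≤ x, |∑ w ∈ S with nn w ≤ y, (spin w : ℝ) * Real.log (nn w)| ≤ B := by
    intro y hy
    have e : S.filter (fun w => nn w ≤ y) = (SF y).filter fun w => (nn w).Prime := by
      ext w
      simp only [hS, Finset.mem_filter, mem_SF']
      constructor
      · rintro ⟨⟨⟨h1, h2⟩, h3⟩, h4⟩; exact ⟨⟨h1, h4⟩, h3⟩
      · rintro ⟨⟨h1, h2⟩, h3⟩; exact ⟨⟨⟨h1, h2.trans hy⟩, h3⟩, h2⟩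
    rw [e]
    exact h N y hN (hy.trans hx)
  have hA := abel_mono S nn (fun w => (spin w : ℝ) * Real.log (nn w)) g x B
    (fun w hw => (mem_SF'.1 (Finset.mem_filter.1 hw).1).2) hgm (by simp [hg]) hBy
  have h0 := h N x hN hx
  have e : ∑ w ∈ S, (spin w : ℝ) = (Real.log 2)⁻¹ * ∑ w ∈ S, (spin w : ℝ) * Real.log (nn w)
      - ∑ w ∈ S, ((spin w : ℝ) * Real.log (nn w)) * g (nn w) := by
    rw [Finset.mul_sum, ← Finset.sum_sub_distrib]
    apply Finset.sum_congr rfl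
    intro w hw
    have hp := (Finset.mem_filter.1 hw).2
    have h2 := hlog _ hp.two_le
    have : Real.log (nn w) ≠ 0 := by linarith
    simp only [hg]
    rw [if_neg (by have := hp.two_le; omega)]
    field_simp
    ring
  have e2 := sum_spin_eq x
  have h3 : |∑ w ∈ S, (spin w : ℝ)| ≤ 6 * B := by
    rw [e]
    refine (abs_sub _ _).trans ?_
    have b1 : |(Real.log 2)⁻¹ * ∑ w ∈ S, (spin w : ℝ) * Real.log (nn w)| ≤ 2 * B := by
      rw [abs_mul, abs_of_nonneg (inv_nonneg.2 hl2'.le)]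
      apply mul_le_mul _ h0 (abs_nonneg _) (by norm_num)
      rw [inv_le_comm₀ hl2' (by norm_num)]; linarith
    have b2 : 2 * B * g x ≤ 2 * B * 2 := by gcongr
    linarith
  rw [e2, abs_mul] at h3
  simp only [Nat.abs_ofNat] at h3
  linarith

theorem sign_ratio : Filter.Tendsto (fun x : ℕ => (∑ p ∈ P15s x, (sg p : ℝ)) / #(P15s x)) Filter.atTop (nhds 0) := by
  obtain ⟨K, hK, C, hC, h⟩ := sign_bound
  have hK0 : (0:ℝ) < K := by exact_mod_cast (by omega : 0 < K)
  have hK2 : (2:ℝ) ≤ K := by exact_mod_cast hK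
  obtain ⟨c, hc, hlow⟩ := prime_lower (1 / (2 * K)) (by positivity) (by
    rw [div_lt_one (by positivity)]; linarith)
  have hlim : Filter.Tendsto (fun x : ℕ => (C * 2 ^ (K - 1) / c) * (x : ℝ) ^ (-(1 / (2 * K) : ℝ))) Filter.atTop (nhds 0) := by
    have := ((tendsto_rpow_neg_atTop (y := 1 / (2 * K)) (by positivity)).comp tendsto_natCast_atTop_atTop).const_mul (C * 2 ^ (K - 1) / c)
    simpa using this
  apply squeeze_zero_norm' _ hlim
  filter_upwards [hlow, Filter.eventually_ge_atTop 2] with x hx hx2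
  have hx0 : (0:ℝ) < x := by exact_mod_cast (by omega : 0 < x)
  have hx1 : (1:ℝ) < x := by exact_mod_cast (by omega : 1 < x)
  set r := (x : ℝ) ^ (1 / K : ℝ) with hr
  have hr1 : 1 < r := Real.one_lt_rpow hx1 (by positivity)
  set N := ⌈r⌉₊ with hN
  have hNr : r ≤ N := Nat.le_ceil r
  have hN2 : 2 ≤ N := by
    have : (1:ℝ) < N := by linarith
    have : 1 < N := by exact_mod_cast this
    omega
  have hNle : (N : ℝ) ≤ 2 * r := by
    have := Nat.ceil_lt_add_one (by linarith : 0 ≤ r)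
    linarith
  have hrK : r ^ K = x := by
    rw [hr, ← Real.rpow_natCast, ← Real.rpow_mul hx0.le]
    rw [one_div, inv_mul_cancel₀ hK0.ne', Real.rpow_one]
  have hxN : x ≤ N ^ K := by
    have : (x : ℝ) ≤ (N : ℝ) ^ K := by
      rw [← hrK]
      gcongr
    exact_mod_cast this
  have h1 := h N x hN2 hxN
  have h2 : (N : ℝ) ^ (K - 1) ≤ 2 ^ (K - 1) * (x : ℝ) ^ (1 - 1 / K : ℝ) := by
    calc (N : ℝ) ^ (K - 1) ≤ (2 * r) ^ (K - 1) := by gcongr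
      _ = 2 ^ (K - 1) * r ^ (K - 1) := mul_pow _ _ _
      _ = _ := by
        congr 1
        rw [hr, ← Real.rpow_natCast, ← Real.rpow_mul hx0.le, Nat.cast_sub (by omega)]
        congr 1
        field_simp
        simp
  have hpos : 0 < c * (x : ℝ) ^ (1 - 1 / (2 * K) : ℝ) := mul_pos hc (Real.rpow_pos_of_pos hx0 _)
  rw [Real.norm_eq_abs, abs_div, abs_of_nonneg (Nat.cast_nonneg _ : (0:ℝ) ≤ #(P15s x))]
  calc _ ≤ (C * (2 ^ (K - 1) * (x : ℝ) ^ (1 - 1 / K : ℝ))) / (c * (x : ℝ) ^ (1 - 1 / (2 * K) : ℝ)) := by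
        apply div_le_div₀ (by positivity) _ hpos hx
        refine h1.trans ?_
        gcongr
    _ = (C * 2 ^ (K - 1) / c) * ((x : ℝ) ^ (1 - 1 / K : ℝ) / (x : ℝ) ^ (1 - 1 / (2 * K) : ℝ)) := by
        have := hc.ne'
        field_simp
    _ = _ := by
        rw [← Real.rpow_sub hx0]
        congr 2
        field_simp
        ring

theorem density_main : Filter.Tendsto
      (fun X : ℕ =>
        (Nat.card {p : ℕ | p ≤ X ∧ p.Prime ∧ p % 16 = 15 ∧
            ∀ u v : ℕ, 0 < u → 0 < v → (p : ℤ) = u ^ 2 - 2 * v ^ 2 →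
              jacobiSym (2 * u) v = -1} : ℝ) /
          (Nat.card {p : ℕ | p ≤ X ∧ p.Prime ∧ p % 16 = 15} : ℝ))
      Filter.atTop (nhds (1 / 2)) := by
  have hlim : Filter.Tendsto (fun x : ℕ => 1 / 2 - (1 / 2) * ((∑ p ∈ P15s x, (sg p : ℝ)) / #(P15s x))) Filter.atTop (nhds (1 / 2)) := by
    have := (sign_ratio.const_mul (1/2 : ℝ)).const_sub (1/2 : ℝ)
    simpa using this
  refine hlim.congr' ?_
  obtain ⟨c, hc, hlow⟩ := prime_lower (1 / 2) (by norm_num) (by norm_num)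
  filter_upwards [hlow, Filter.eventually_ge_atTop 1] with x hx hx1
  have hx0 : (0:ℝ) < x := by exact_mod_cast hx1
  have hpos : (0:ℝ) < #(P15s x) := lt_of_lt_of_le (mul_pos hc (Real.rpow_pos_of_pos hx0 _)) hx
  have e1 : Nat.card {p : ℕ | p ≤ x ∧ p.Prime ∧ p % 16 = 15} = #(P15s x) := by
    have : {p : ℕ | p ≤ x ∧ p.Prime ∧ p % 16 = 15} = ((P15s x : Finset ℕ) : Set ℕ) := by
      ext p
      simp only [P15s, Set.mem_ofPred_eq, Finset.coe_filter, Finset.mem_Icc]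
      constructor
      · rintro ⟨h1, h2, h3⟩; exact ⟨⟨h2.pos, h1⟩, h2, h3⟩
      · rintro ⟨⟨_, h1⟩, h2, h3⟩; exact ⟨h1, h2, h3⟩
    rw [this]; simp
  have e2 : Nat.card {p : ℕ | p ≤ x ∧ p.Prime ∧ p % 16 = 15 ∧
            ∀ u v : ℕ, 0 < u → 0 < v → (p : ℤ) = u ^ 2 - 2 * v ^ 2 →
              jacobiSym (2 * u) v = -1} = #((P15s x).filter fun p => sg p = -1) := by
    have : {p : ℕ | p ≤ x ∧ p.Prime ∧ p % 16 = 15 ∧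
            ∀ u v : ℕ, 0 < u → 0 < v → (p : ℤ) = u ^ 2 - 2 * v ^ 2 →
              jacobiSym (2 * u) v = -1} = (((P15s x).filter fun p => sg p = -1 : Finset ℕ) : Set ℕ) := by
      ext p
      simp only [P15s, Set.mem_ofPred_eq, Finset.coe_filter, Finset.mem_filter, Finset.mem_Icc]
      constructor
      · rintro ⟨h1, h2, h3, h4⟩; exact ⟨⟨⟨h2.pos, h1⟩, h2, h3⟩, (sg_spec h2 h3).2.2.1 h4⟩
      · rintro ⟨⟨⟨_, h1⟩, h2, h3⟩, h4⟩; exact ⟨h1, h2, h3, (sg_spec h2 h3).2.2.2 h4⟩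
    rw [this]; simp
  rw [e1, e2]
  have e3 : ∑ p ∈ P15s x, (sg p : ℝ) = #(P15s x) - 2 * #((P15s x).filter fun p => sg p = -1) := by
    have : ∀ p ∈ P15s x, (sg p : ℝ) = 1 - 2 * (if sg p = -1 then 1 else 0) := by
      intro p hp
      have hp' := (Finset.mem_filter.1 hp).2
      rcases (sg_spec hp'.1 hp'.2).1 with h | h
      · rw [h]; norm_num
      · rw [h]; norm_num
    rw [Finset.sum_congr rfl this, Finset.sum_sub_distrib, ← Finset.mul_sum, Finset.sum_boole]
    simp
  rw [e3]
  have := hpos.ne'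
  field_simp
  ring

end SpinDensity

open Filter

/-- The primes `p ≡ -1 (mod 16)` with `(p) = -1` have relative density
`1/2` among the primes `p ≡ -1 (mod 16)`, where for a prime `p ≡ -1 (mod 8)` the symbol
`(p)` denotes the Jacobi symbol `(2u/v)` for any positive integers `u, v` with
`p = u² - 2v²`. -/
theorem density_of_primes_with_spin_neg_one :
    Tendsto
      (fun X : ℕ =>
        (Nat.card {p : ℕ | p ≤ X ∧ p.Prime ∧ p % 16 = 15 ∧
            ∀ u v : ℕ, 0 < u → 0 < v → (p : ℤ) = u ^ 2 - 2 * v ^ 2 →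
              jacobiSym (2 * u) v = -1} : ℝ) /
          (Nat.card {p : ℕ | p ≤ X ∧ p.Prime ∧ p % 16 = 15} : ℝ))
      atTop (nhds (1 / 2)) := by
  exact SpinDensity.density_main
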